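/- arXiv:1406.6966 — 4 statements merged into one kernel-verified Lean document; each statement's English description precedes it below -/
import Mathlib

section
/- Let ψ ∈ L²(ℝ₊ × ℝ, r dr dθ). Then Δψ = ψ distributionally if and only if there exists a measurable function g : (−1, 1) → ℂ with ∫_{−1}^{1} (1/2)Γ(1+ξ)Γ(1−ξ) |g(ξ)|² dξ < ∞ such that ψ(r, θ) = (1/2π) ∫_{−1}^{1} g(ξ) K_ξ(r) e^{iξθ} dξ for almost every (r, θ) ∈ ℝ₊ × ℝ. -/
open MeasureTheory Set

/-- The measure `r dr dθ` on `ℝ₊ × ℝ` (polar coordinates model of the Riemann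
surface of `log z`). -/
noncomputable def polarMeasure : Measure (ℝ × ℝ) :=
  ((volume : Measure (ℝ × ℝ)).restrict (Set.Ioi (0:ℝ) ×ˢ Set.univ)).withDensity
    fun p => ENNReal.ofReal p.1

/-- `C_c^∞(ℝ₊ × ℝ)`: smooth compactly supported functions with support in `ℝ₊ × ℝ`. -/
def IsLogTest (f : ℝ × ℝ → ℂ) : Prop :=
  ContDiff ℝ (⊤ : ℕ∞) f ∧ HasCompactSupport f ∧ tsupport f ⊆ Set.Ioi (0:ℝ) ×ˢ Set.univ

/-- `∂/∂r`. -/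
noncomputable def pdr (f : ℝ × ℝ → ℂ) (p : ℝ × ℝ) : ℂ := fderiv ℝ f p (1, 0)

/-- `∂/∂θ`. -/
noncomputable def pdθ (f : ℝ × ℝ → ℂ) (p : ℝ × ℝ) : ℂ := fderiv ℝ f p (0, 1)

/-- The polar-coordinate Laplacian `Δφ = ∂²φ/∂r² + (1/r)∂φ/∂r + (1/r²)∂²φ/∂θ²`. -/
noncomputable def polarLap (f : ℝ × ℝ → ℂ) (p : ℝ × ℝ) : ℂ :=
  pdr (pdr f) p + (1 / (p.1 : ℂ)) * pdr f p + (1 / (p.1 : ℂ) ^ 2) * pdθ (pdθ f) p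

/-- The modified Bessel function of the second kind,
`K_ν(z) = ∫₀^∞ e^{−z cosh t} cosh(νt) dt`. -/
noncomputable def besselK (ν z : ℝ) : ℝ :=
  ∫ t in Set.Ioi (0:ℝ), Real.exp (-z * Real.cosh t) * Real.cosh (ν * t)

open Filter
open scoped ContDiff Topology SchwartzMap FourierTransform

/-- The moments `∫₀^∞ cosh^n t · e^{−r cosh t} cosh(νt) dt`, which are up to sign the derivatives
of `K_ν`. -/
noncomputable def besselMoment (n : ℕ) (ν r : ℝ) : ℝ :=
  ∫ t in Ioi (0 : ℝ), Real.cosh t ^ n * (Real.exp (-r * Real.cosh t) * Real.cosh (ν * t))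

lemma besselMoment_zero (ν r : ℝ) : besselMoment 0 ν r = besselK ν r := by
  simp [besselMoment, besselK]

lemma cosh_le_exp_abs_mul (ν : ℝ) {t : ℝ} (ht : 0 ≤ t) :
    Real.cosh (ν * t) ≤ Real.exp (|ν| * t) := by
  rw [← Real.cosh_abs, abs_mul, abs_of_nonneg ht, Real.cosh_eq]
  have : Real.exp (-(|ν| * t)) ≤ Real.exp (|ν| * t) :=
    Real.exp_le_exp.2 (by have := mul_nonneg (abs_nonneg ν) ht; linarith)
  linarith

lemma abs_sinh_le_cosh (x : ℝ) : |Real.sinh x| ≤ Real.cosh x := by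
  rw [abs_le, Real.sinh_eq, Real.cosh_eq]
  constructor <;> linarith [Real.exp_pos x, Real.exp_pos (-x)]

lemma exists_bound_besselMoment_integrand (n : ℕ) (ν : ℝ) {r : ℝ} (hr : 0 < r) :
    ∃ C, ∀ t, 0 ≤ t →
      Real.cosh t ^ n * (Real.exp (-r * Real.cosh t) * Real.cosh (ν * t)) ≤ C * Real.exp (-t) := by
  obtain ⟨m, hm⟩ := exists_nat_ge |ν|
  refine ⟨2 ^ (m + 1) * ((n + m + 1).factorial / r ^ (n + m + 1)), fun t ht => ?_⟩
  set x := Real.cosh t with hx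
  have hx0 : 0 < x := Real.cosh_pos t
  have hex : Real.exp t ≤ 2 * x := by
    rw [hx, Real.cosh_eq]; linarith [Real.exp_pos (-t)]
  have h1 : Real.cosh (ν * t) ≤ (2 * x) ^ m := by
    calc Real.cosh (ν * t) ≤ Real.exp (|ν| * t) := cosh_le_exp_abs_mul ν ht
      _ ≤ Real.exp (m * t) := Real.exp_le_exp.2 (by gcongr)
      _ = Real.exp t ^ m := by rw [Real.exp_nat_mul]
      _ ≤ _ := by gcongr
  have h2 : (r * x) ^ (n + m + 1) / (n + m + 1).factorial ≤ Real.exp (r * x) :=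
    Real.pow_div_factorial_le_exp _ (by positivity) _
  have h3 : x ^ (n + m + 1) * Real.exp (-r * x) ≤ (n + m + 1).factorial / r ^ (n + m + 1) := by
    rw [neg_mul, Real.exp_neg, ← div_eq_mul_inv, div_le_div_iff₀ (by positivity) (by positivity)]
    rw [div_le_iff₀ (by positivity)] at h2
    calc _ = (r * x) ^ (n + m + 1) := by rw [mul_pow]; ring
      _ ≤ _ := by linarith
  rw [Real.exp_neg, ← div_eq_mul_inv, le_div_iff₀ (Real.exp_pos t)]
  calc x ^ n * (Real.exp (-r * x) * Real.cosh (ν * t)) * Real.exp t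
      ≤ x ^ n * (Real.exp (-r * x) * (2 * x) ^ m) * (2 * x) := by gcongr
    _ = 2 ^ (m + 1) * (x ^ (n + m + 1) * Real.exp (-r * x)) := by ring
    _ ≤ _ := by gcongr

lemma integrableOn_besselMoment_integrand (n : ℕ) (ν : ℝ) {r : ℝ} (hr : 0 < r) :
    IntegrableOn (fun t => Real.cosh t ^ n * (Real.exp (-r * Real.cosh t) * Real.cosh (ν * t)))
      (Ioi 0) := by
  obtain ⟨C, hC⟩ := exists_bound_besselMoment_integrand n ν hr
  refine Integrable.mono' ((integrableOn_exp_neg_Ioi 0).const_mul C) ?_ ?_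
  · exact (by fun_prop : Continuous _).aestronglyMeasurable
  · filter_upwards [ae_restrict_mem measurableSet_Ioi] with t ht
    rw [Real.norm_of_nonneg (by positivity)]
    exact hC t (le_of_lt ht)

lemma hasDerivAt_besselMoment (n : ℕ) (ν : ℝ) {r : ℝ} (hr : 0 < r) :
    HasDerivAt (besselMoment n ν) (-besselMoment (n + 1) ν r) r := by
  have hr2 : 0 < r / 2 := by positivity
  have key := hasDerivAt_integral_of_dominated_loc_of_deriv_le
    (μ := volume.restrict (Ioi (0 : ℝ)))
    (F := fun s t => Real.cosh t ^ n * (Real.exp (-s * Real.cosh t) * Real.cosh (ν * t)))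
    (F' := fun s t => -(Real.cosh t ^ (n + 1) *
      (Real.exp (-s * Real.cosh t) * Real.cosh (ν * t)))) (x₀ := r)
    (bound := fun t => Real.cosh t ^ (n + 1) *
      (Real.exp (-(r / 2) * Real.cosh t) * Real.cosh (ν * t)))
    (s := Ioi (r / 2)) (Ioi_mem_nhds (by linarith)) ?_ ?_ ?_ ?_ ?_ ?_
  · have h := key.2
    rw [integral_neg] at h
    exact h
  · exact Eventually.of_forall fun s => (by fun_prop : Continuous _).aestronglyMeasurable
  · exact integrableOn_besselMoment_integrand n ν hr
  · exact (by fun_prop : Continuous _).aestronglyMeasurable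
  · refine Eventually.of_forall fun t s hs => ?_
    have hs : r / 2 < s := hs
    rw [norm_neg, Real.norm_of_nonneg (by positivity)]
    have := Real.cosh_pos t
    gcongr
  · exact integrableOn_besselMoment_integrand (n + 1) ν hr2
  · refine Eventually.of_forall fun t s _ => ?_
    have h1 : HasDerivAt (fun s : ℝ => -s * Real.cosh t) (-1 * Real.cosh t) s :=
      (hasDerivAt_id s).neg.mul_const _
    convert! ((h1.exp).mul_const (Real.cosh (ν * t))).const_mul (Real.cosh t ^ n) using 1
    ring

lemma contDiffOn_besselMoment (ν : ℝ) (n : ℕ) : ContDiffOn ℝ ∞ (besselMoment n ν) (Ioi 0) := by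
  rw [contDiffOn_infty]
  intro k
  induction k generalizing n with
  | zero =>
    rw [Nat.cast_zero, contDiffOn_zero]
    exact fun r hr => (hasDerivAt_besselMoment n ν hr).continuousAt.continuousWithinAt
  | succ k ih =>
    rw [Nat.cast_succ, contDiffOn_succ_iff_deriv_of_isOpen isOpen_Ioi]
    refine ⟨fun r hr => (hasDerivAt_besselMoment n ν hr).differentiableAt.differentiableWithinAt,
      by simp, ?_⟩
    exact (ih (n + 1)).neg.congr fun r hr => (hasDerivAt_besselMoment n ν hr).deriv

lemma hasDerivAt_besselK (ν : ℝ) {r : ℝ} (hr : 0 < r) :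
    HasDerivAt (besselK ν) (-besselMoment 1 ν r) r := by
  have h := hasDerivAt_besselMoment 0 ν hr
  rwa [show besselMoment 0 ν = besselK ν from funext (besselMoment_zero ν)] at h

lemma contDiffOn_besselK (ν : ℝ) : ContDiffOn ℝ ∞ (besselK ν) (Ioi 0) :=
  (contDiffOn_besselMoment ν 0).congr fun r _ => (besselMoment_zero ν r).symm

/-- The modified Bessel equation, with `K_ν' = -besselMoment 1 ν` and `K_ν'' = besselMoment 2 ν`. -/
lemma besselK_ode (ν : ℝ) {r : ℝ} (hr : 0 < r) :
    r ^ 2 * besselMoment 2 ν r - r * besselMoment 1 ν r - (r ^ 2 + ν ^ 2) * besselK ν r = 0 := by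
  rw [← besselMoment_zero]
  set e : ℝ → ℝ := fun t => Real.exp (-r * Real.cosh t) with he
  set W : ℝ → ℝ := fun t => -r * Real.sinh t * e t * Real.cosh (ν * t)
    - ν * e t * Real.sinh (ν * t) with hW
  set F : ℕ → ℝ → ℝ := fun n t => Real.cosh t ^ n * (e t * Real.cosh (ν * t)) with hF
  have hFi : ∀ n, IntegrableOn (F n) (Ioi 0) := fun n =>
    integrableOn_besselMoment_integrand n ν hr
  have hderiv : ∀ t, HasDerivAt W (r ^ 2 * F 2 t - r * F 1 t - (r ^ 2 + ν ^ 2) * F 0 t) t := by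
    intro t
    have h1 : HasDerivAt e (e t * (-r * Real.sinh t)) t :=
      ((Real.hasDerivAt_cosh t).const_mul (-r)).exp
    have h0 : HasDerivAt (fun t : ℝ => ν * t) ν t := by
      simpa using (hasDerivAt_id t).const_mul ν
    convert! (((((Real.hasDerivAt_sinh t).const_mul (-r)).mul h1).mul h0.cosh).sub
      ((h1.const_mul ν).mul h0.sinh)) using 1
    simp only [hF, Pi.mul_apply]
    have := Real.cosh_sq t
    linear_combination (r ^ 2 * e t * Real.cosh (ν * t)) * this
  have hlim : Tendsto W atTop (𝓝 0) := by
    obtain ⟨C₀, h₀⟩ := exists_bound_besselMoment_integrand 0 ν hr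
    obtain ⟨C₁, h₁⟩ := exists_bound_besselMoment_integrand 1 ν hr
    refine squeeze_zero_norm' (a := fun t => (r * C₁ + |ν| * C₀) * Real.exp (-t)) ?_ ?_
    · filter_upwards [eventually_ge_atTop 0] with t ht
      have he0 : 0 < e t := Real.exp_pos _
      calc ‖W t‖ ≤ ‖-r * Real.sinh t * e t * Real.cosh (ν * t)‖ + ‖ν * e t * Real.sinh (ν * t)‖ :=
            norm_sub_le _ _
        _ = r * (|Real.sinh t| * (e t * Real.cosh (ν * t))) + |ν| * (e t * |Real.sinh (ν * t)|) := by
            simp only [Real.norm_eq_abs, abs_mul, abs_neg, abs_of_pos hr, abs_of_pos he0,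
              abs_of_pos (Real.cosh_pos (ν * t))]
            ring
        _ ≤ r * (Real.cosh t ^ 1 * (e t * Real.cosh (ν * t)))
            + |ν| * (Real.cosh t ^ 0 * (e t * Real.cosh (ν * t))) := by
            rw [pow_one, pow_zero, one_mul]
            have := abs_sinh_le_cosh t
            have := abs_sinh_le_cosh (ν * t)
            gcongr
        _ ≤ r * (C₁ * Real.exp (-t)) + |ν| * (C₀ * Real.exp (-t)) := by
            exact add_le_add (mul_le_mul_of_nonneg_left (h₁ t ht) hr.le)
              (mul_le_mul_of_nonneg_left (h₀ t ht) (abs_nonneg ν))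
        _ = _ := by ring
    · simpa using Real.tendsto_exp_neg_atTop_nhds_zero.const_mul (r * C₁ + |ν| * C₀)
  have hint : IntegrableOn (fun t => r ^ 2 * F 2 t - r * F 1 t - (r ^ 2 + ν ^ 2) * F 0 t)
      (Ioi 0) := (((hFi 2).const_mul _).sub ((hFi 1).const_mul _)).sub ((hFi 0).const_mul _)
  have key := integral_Ioi_of_hasDerivAt_of_tendsto' (a := 0) (fun t _ => hderiv t) hint hlim
  have e₁ := integral_sub (((hFi 2).const_mul (r ^ 2)).sub ((hFi 1).const_mul r))
    ((hFi 0).const_mul (r ^ 2 + ν ^ 2))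
  have e₂ := integral_sub ((hFi 2).const_mul (r ^ 2)) ((hFi 1).const_mul r)
  simp only [Pi.sub_apply] at e₁
  rw [e₁, e₂, integral_const_mul,
    integral_const_mul, integral_const_mul] at key
  simpa [hW, besselMoment, hF, he] using key

lemma integrableOn_besselK_integrand (ν : ℝ) {r : ℝ} (hr : 0 < r) :
    IntegrableOn (fun t => Real.exp (-r * Real.cosh t) * Real.cosh (ν * t)) (Ioi 0) := by
  simpa using integrableOn_besselMoment_integrand 0 ν hr

lemma besselK_pos (ν : ℝ) {r : ℝ} (hr : 0 < r) : 0 < besselK ν r := by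
  rw [besselK, setIntegral_pos_iff_support_of_nonneg_ae
    (Eventually.of_forall fun t => by positivity) (integrableOn_besselK_integrand ν hr)]
  have : (Function.support fun t => Real.exp (-r * Real.cosh t) * Real.cosh (ν * t)) = univ := by
    ext t
    simpa using (Real.cosh_pos (ν * t)).ne'
  rw [this]
  simp

lemma besselK_le_besselK_one (ν : ℝ) {r : ℝ} (hr : 1 ≤ r) :
    besselK ν r ≤ Real.exp (-(r - 1)) * besselK ν 1 := by
  have hr0 : 0 < r := by linarith
  rw [besselK, besselK, ← integral_const_mul]
  refine integral_mono (integrableOn_besselK_integrand ν hr0)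
    ((integrableOn_besselK_integrand ν one_pos).const_mul _) fun t => ?_
  simp only []
  rw [← mul_assoc, ← Real.exp_add]
  have := Real.one_le_cosh t
  gcongr
  nlinarith

lemma besselK_le_of_abs_le_one {ν a r : ℝ} (hν : |ν| ≤ 1) (ha : 0 < a) (har : a ≤ r) :
    besselK ν r ≤ besselK 1 a := by
  refine integral_mono (integrableOn_besselK_integrand ν (ha.trans_le har))
    (integrableOn_besselK_integrand 1 ha) fun t => ?_
  simp only []
  have := Real.cosh_pos t
  have h2 : Real.cosh (ν * t) ≤ Real.cosh (1 * t) := by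
    rw [Real.cosh_le_cosh, abs_mul, abs_mul, abs_one]
    gcongr
  gcongr

lemma rpow_neg_le_besselK (ν : ℝ) {r : ℝ} (hr : 0 < r) (hr1 : r ≤ 1) :
    Real.exp (-Real.exp 1) / 2 * r ^ (-|ν|) ≤ besselK ν r := by
  set L := -Real.log r with hL
  have hL0 : 0 ≤ L := by
    have := Real.log_nonpos hr.le hr1
    linarith
  calc Real.exp (-Real.exp 1) / 2 * r ^ (-|ν|)
      = ∫ _ in Ioc L (L + 1), Real.exp (-Real.exp 1) * (r ^ (-|ν|) / 2) := by
        rw [setIntegral_const]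
        simp
        ring
    _ ≤ ∫ t in Ioc L (L + 1), Real.exp (-r * Real.cosh t) * Real.cosh (ν * t) := by
        refine setIntegral_mono_on (integrableOn_const (by simp))
          ((integrableOn_besselK_integrand ν hr).mono_set fun t ht => hL0.trans_lt ht.1)
          measurableSet_Ioc fun t ht => ?_
        have ht0 : 0 ≤ t := hL0.trans ht.1.le
        have h1 : r * Real.cosh t ≤ Real.exp 1 := by
          have h2 : Real.cosh t ≤ Real.exp t := by
            simpa using cosh_le_exp_abs_mul 1 ht0
          calc r * Real.cosh t ≤ r * Real.exp (L + 1) := by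
                gcongr
                exact h2.trans (Real.exp_le_exp.2 ht.2)
            _ = Real.exp 1 := by
                rw [Real.exp_add, hL, Real.exp_neg, Real.exp_log hr]
                field_simp
        have h3 : r ^ (-|ν|) / 2 ≤ Real.cosh (ν * t) := by
          rw [← Real.cosh_abs, abs_mul, abs_of_nonneg ht0, Real.cosh_eq]
          have : r ^ (-|ν|) ≤ Real.exp (|ν| * t) := by
            rw [Real.rpow_def_of_pos hr]
            refine Real.exp_le_exp.2 ?_
            calc Real.log r * -|ν| = |ν| * L := by rw [hL]; ring
              _ ≤ |ν| * t := by gcongr; exact ht.1.le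
          linarith [Real.exp_pos (-(|ν| * t))]
        gcongr
        linarith
    _ ≤ besselK ν r := by
        refine setIntegral_mono_set (integrableOn_besselK_integrand ν hr)
          (Eventually.of_forall fun t => by positivity) ?_
        exact LE.le.eventuallyLE fun t (ht : t ∈ Ioc L (L + 1)) => hL0.trans_lt ht.1

lemma measurable_besselK_uncurry : Measurable fun p : ℝ × ℝ => besselK p.1 p.2 := by
  have h : Measurable (fun q : (ℝ × ℝ) × ℝ =>
      Real.exp (-q.1.2 * Real.cosh q.2) * Real.cosh (q.1.1 * q.2)) :=
    (by fun_prop : Continuous _).measurable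
  exact h.stronglyMeasurable.integral_prod_right'.measurable

/-- Real-valued test functions on the half-line `(0, ∞)`. -/
def IsRadialTest (f : ℝ → ℝ) : Prop :=
  ContDiff ℝ ∞ f ∧ HasCompactSupport f ∧ tsupport f ⊆ Ioi 0

namespace IsRadialTest

variable {f g : ℝ → ℝ}

lemma continuous (hf : IsRadialTest f) : Continuous f := hf.1.continuous

lemma differentiable (hf : IsRadialTest f) : Differentiable ℝ f :=
  hf.1.differentiable (by simp)

lemma apply_eq_zero (hf : IsRadialTest f) {r : ℝ} (hr : r ≤ 0) : f r = 0 :=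
  image_eq_zero_of_notMem_tsupport fun h => (hf.2.2 h).not_ge hr

lemma deriv (hf : IsRadialTest f) : IsRadialTest (deriv f) :=
  ⟨(contDiff_infty_iff_deriv.1 hf.1).2, hf.2.1.deriv, tsupport_deriv_subset.trans hf.2.2⟩

lemma sub (hf : IsRadialTest f) (hg : IsRadialTest g) : IsRadialTest (fun r => f r - g r) := by
  have h : tsupport (fun r => f r - g r) ⊆ tsupport f ∪ tsupport g := tsupport_sub f g
  exact ⟨hf.1.sub hg.1, hf.2.1.sub hg.2.1, h.trans (union_subset hf.2.2 hg.2.2)⟩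

lemma add (hf : IsRadialTest f) (hg : IsRadialTest g) : IsRadialTest (fun r => f r + g r) := by
  have h : tsupport (fun r => f r + g r) ⊆ tsupport f ∪ tsupport g := tsupport_add f g
  exact ⟨hf.1.add hg.1, hf.2.1.add hg.2.1, h.trans (union_subset hf.2.2 hg.2.2)⟩

lemma mul_left (hf : IsRadialTest f) (hg : ContDiffOn ℝ ∞ g (Ioi 0)) :
    IsRadialTest (fun r => g r * f r) := by
  refine ⟨contDiff_iff_contDiffAt.2 fun r => ?_, hf.2.1.mul_left,
    (tsupport_mul_subset_right (f := g)).trans hf.2.2⟩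
  by_cases hr : r ∈ tsupport f
  · exact (hg.contDiffAt (Ioi_mem_nhds (hf.2.2 hr))).mul hf.1.contDiffAt
  · have h0 : (fun r => g r * f r) =ᶠ[𝓝 r] fun _ => 0 := by
      filter_upwards [notMem_tsupport_iff_eventuallyEq.1 hr] with s hs
      simp [hs]
    exact contDiffAt_const.congr_of_eventuallyEq h0

lemma const_mul (hf : IsRadialTest f) (c : ℝ) : IsRadialTest (fun r => c * f r) :=
  hf.mul_left contDiffOn_const

lemma integrable (hf : IsRadialTest f) : Integrable f :=
  hf.continuous.integrable_of_hasCompactSupport hf.2.1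

lemma integrable_smul (hf : IsRadialTest f) {w : ℝ → ℂ}
    (hw : LocallyIntegrableOn w (Ioi 0)) : Integrable (fun r => f r • w r) := by
  have h : IntegrableOn (fun r => f r • w r) (tsupport f) :=
    (hw.integrableOn_compact_subset hf.2.2 hf.2.1).continuousOn_smul
      hf.continuous.continuousOn hf.2.1
  rwa [integrableOn_iff_integrable_of_support_subset] at h
  exact (Function.support_smul_subset_left f w).trans (subset_tsupport f)

/-- A test function of zero mean has a primitive that is a test function. -/
lemma exists_primitive (hf : IsRadialTest f) (h0 : ∫ r, f r = 0) :
    ∃ F, IsRadialTest F ∧ _root_.deriv F = f := by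
  obtain ⟨a, b, ha, hab⟩ : ∃ a b, 0 < a ∧ tsupport f ⊆ Icc a b := by
    rcases (tsupport f).eq_empty_or_nonempty with he | hne
    · exact ⟨1, 1, one_pos, by simp [he]⟩
    · obtain ⟨a, ha, hmin⟩ := (show IsCompact (tsupport f) from hf.2.1).exists_isLeast hne
      obtain ⟨b, hb, hmax⟩ := (show IsCompact (tsupport f) from hf.2.1).exists_isGreatest hne
      exact ⟨a, b, hf.2.2 ha, fun r hr => ⟨hmin hr, hmax hr⟩⟩
  have hfz : ∀ r, r ∉ Icc a b → f r = 0 := fun r hr =>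
    image_eq_zero_of_notMem_tsupport fun h => hr (hab h)
  set F : ℝ → ℝ := fun r => ∫ s in a..r, f s with hF
  have hd : ∀ r, HasDerivAt F (f r) r := fun r => hf.continuous.integral_hasStrictDerivAt a r
    |>.hasDerivAt
  have hdF : _root_.deriv F = f := funext fun r => (hd r).deriv
  have hFz : ∀ r, r ∉ Icc a b → F r = 0 := by
    intro r hr
    rcases lt_or_ge r a with hra | hra
    · refine (intervalIntegral.integral_congr_ae (g := fun _ => 0) ?_).trans (by simp)
      rw [uIoc_of_ge hra.le]
      have : ∀ᵐ s : ℝ, s ≠ a := by simp [ae_iff]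
      filter_upwards [this] with s hsa hs
      exact hfz s fun h => hsa (le_antisymm hs.2 h.1)
    · have hrb : b < r := by
        by_contra! h
        exact hr ⟨hra, h⟩
      rw [← h0]
      simp only [hF]
      rw [intervalIntegral.integral_of_le hra, ← integral_Icc_eq_integral_Ioc]
      exact setIntegral_eq_integral_of_forall_compl_eq_zero
        fun s hs => hfz s fun h => hs ⟨h.1, h.2.trans hrb.le⟩
  have hsub : tsupport F ⊆ Icc a b :=
    closure_minimal (fun r hr => by_contra fun h => hr (hFz r h)) isClosed_Icc
  refine ⟨F, ⟨?_, ?_, hsub.trans fun r hr => ha.trans_le hr.1⟩, hdF⟩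
  · rw [contDiff_infty_iff_deriv, hdF]
    exact ⟨fun r => (hd r).differentiableAt, hf.1⟩
  · exact HasCompactSupport.intro isCompact_Icc hFz

/-- Integration by parts against a function differentiable on the half-line. -/
lemma integral_deriv_mul (hf : IsRadialTest f) {g' : ℝ → ℝ}
    (hg : ∀ r, 0 < r → HasDerivAt g (g' r) r) (hg' : ContinuousOn g' (Ioi 0)) :
    ∫ r, _root_.deriv f r * g r = - ∫ r, g' r * f r := by
  have hgc : ContinuousOn g (Ioi 0) := fun r hr => (hg r hr).continuousAt.continuousWithinAt
  have hi : ∀ {p q : ℝ → ℝ}, IsRadialTest p → ContinuousOn q (Ioi 0) →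
      Integrable (fun r => q r * p r) := by
    intro p q hp hq
    have h : IntegrableOn (fun r => q r * p r) (tsupport p) :=
      ((hq.mono hp.2.2).mul hp.continuous.continuousOn).integrableOn_compact hp.2.1
    rwa [integrableOn_iff_integrable_of_support_subset] at h
    exact (Function.support_mul_subset_right q p).trans (subset_tsupport p)
  have h := integral_mul_deriv_eq_deriv_mul_of_integrable (u := g) (v := f) (u' := g')
    (v' := _root_.deriv f) (fun r hr => hg r (hf.2.2 hr))
    (fun r _ => (hf.differentiable r).hasDerivAt) (hi hf.deriv hgc) (hi hf hg') (hi hf hgc)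
  simpa only [mul_comm] using h

end IsRadialTest

lemma exists_isRadialTest_integral_eq_one : ∃ f, IsRadialTest f ∧ ∫ r, f r = 1 := by
  let b : ContDiffBump (1 : ℝ) := ⟨1 / 4, 1 / 2, by norm_num, by norm_num⟩
  refine ⟨b.normed volume, ⟨b.contDiff_normed, b.hasCompactSupport_normed, ?_⟩, b.integral_normed⟩
  rw [b.tsupport_normed_eq, Real.closedBall_eq_Icc]
  intro r hr
  have h := hr.1
  norm_num [b] at h
  exact lt_of_lt_of_le (by norm_num) h

/-- The lemma of du Bois-Reymond on the half-line. -/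
lemma ae_eq_const_of_integral_deriv_smul_eq_zero {w : ℝ → ℂ}
    (hw : LocallyIntegrableOn w (Ioi 0))
    (h : ∀ f, IsRadialTest f → ∫ r, deriv f r • w r = 0) :
    ∃ c : ℂ, ∀ᵐ r, r ∈ Ioi (0 : ℝ) → w r = c := by
  obtain ⟨δ, hδ, hδ1⟩ := exists_isRadialTest_integral_eq_one
  set c : ℂ := ∫ r, δ r • w r with hc
  refine ⟨c, ?_⟩
  have hcl : LocallyIntegrableOn (fun _ : ℝ => c) (Ioi 0) :=
    (locallyIntegrable_const c).locallyIntegrableOn _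
  have key := isOpen_Ioi.ae_eq_zero_of_integral_contDiff_smul_eq_zero (hw.sub hcl) ?_
  · filter_upwards [key] with r hr hr0
    exact sub_eq_zero.1 (hr hr0)
  intro g hg1 hg2 hg3
  have hg : IsRadialTest g := ⟨hg1, hg2, hg3⟩
  obtain ⟨F, hF, hFd⟩ := (hg.sub (hδ.const_mul (∫ r, g r))).exists_primitive (by
    rw [integral_sub hg.integrable (hδ.const_mul _).integrable, integral_const_mul, hδ1]
    ring)
  have h1 := h F hF
  rw [hFd] at h1
  simp only [sub_smul, mul_smul] at h1
  have h2 := integral_sub (hg.integrable_smul hw) ((hδ.integrable_smul hw).smul (∫ r, g r))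
  simp only [Pi.smul_apply] at h2
  rw [h2, integral_smul, sub_eq_zero] at h1
  simp only [Pi.sub_apply, smul_sub]
  rw [integral_sub (hg.integrable_smul hw) (hg.integrable_smul hcl), h1, integral_smul_const,
    ← hc, sub_self]

/-- The Bessel operator `r α'' + α' − r α − (ν² / r) α`. -/
noncomputable def besselOp (ν : ℝ) (f : ℝ → ℝ) (r : ℝ) : ℝ :=
  r * deriv (deriv f) r + deriv f r - r * f r - ν ^ 2 * (f r / r)

lemma besselOp_besselK_mul {f : ℝ → ℝ} (hf : IsRadialTest f) (ν r : ℝ) :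
    besselOp ν (fun s => besselK ν s * f s) r =
      deriv (fun s => s * besselK ν s ^ 2 * deriv f s) r / besselK ν r := by
  have hKf := hf.mul_left (contDiffOn_besselK ν)
  have hPf := hf.deriv.mul_left (g := fun s => s * besselK ν s ^ 2)
    (contDiffOn_id.mul ((contDiffOn_besselK ν).pow 2))
  rcases le_or_gt r 0 with hr | hr
  · rw [besselOp, hKf.deriv.deriv.apply_eq_zero hr, hKf.deriv.apply_eq_zero hr,
      hKf.apply_eq_zero hr, hPf.deriv.apply_eq_zero hr]
    simp
  have hM : ∀ {s : ℝ}, 0 < s → HasDerivAt (besselMoment 1 ν) (-besselMoment 2 ν s) s :=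
    fun hs => hasDerivAt_besselMoment 1 ν hs
  have hfd : ∀ s, HasDerivAt f (deriv f s) s := fun s => (hf.differentiable s).hasDerivAt
  have hfdd : ∀ s, HasDerivAt (deriv f) (deriv (deriv f) s) s := fun s =>
    (hf.deriv.differentiable s).hasDerivAt
  have h1 : ∀ {s : ℝ}, 0 < s → deriv (fun s => besselK ν s * f s) s =
      -besselMoment 1 ν s * f s + besselK ν s * deriv f s :=
    fun hs => ((hasDerivAt_besselK ν hs).mul (hfd _)).deriv
  have h2 : deriv (deriv (fun s => besselK ν s * f s)) r =
      (- -besselMoment 2 ν r * f r + -besselMoment 1 ν r * deriv f r) +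
        (-besselMoment 1 ν r * deriv f r + besselK ν r * deriv (deriv f) r) := by
    have : deriv (fun s => besselK ν s * f s) =ᶠ[𝓝 r]
        fun s => -besselMoment 1 ν s * f s + besselK ν s * deriv f s := by
      filter_upwards [Ioi_mem_nhds hr] with s hs using h1 hs
    rw [this.deriv_eq]
    exact (((hM hr).neg.mul (hfd r)).add ((hasDerivAt_besselK ν hr).mul (hfdd r))).deriv
  have h3 : deriv (fun s => s * besselK ν s ^ 2 * deriv f s) r =
      (besselK ν r ^ 2 - 2 * r * besselK ν r * besselMoment 1 ν r) * deriv f r +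
        r * besselK ν r ^ 2 * deriv (deriv f) r := by
    have := (((hasDerivAt_id r).mul ((hasDerivAt_besselK ν hr).pow 2)).mul (hfdd r)).deriv
    convert! this using 1
    simp only [id, Pi.mul_apply, Pi.pow_apply]
    push_cast
    ring
  have hK := (besselK_pos ν hr).ne'
  have hode := besselK_ode ν hr
  rw [besselOp, h1 hr, h2, h3]
  field_simp
  linear_combination f r * hode

/-- The function `∫₁^r ds / (s K_ν(s)²)`; its product with `K_ν` is a second solution of the
modified Bessel equation. -/
noncomputable def besselRatio (ν r : ℝ) : ℝ := ∫ s in (1 : ℝ)..r, 1 / (s * besselK ν s ^ 2)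

lemma continuousOn_besselK (ν : ℝ) : ContinuousOn (besselK ν) (Ioi 0) :=
  (contDiffOn_besselK ν).continuousOn

lemma contDiffOn_mul_besselK_sq (ν : ℝ) :
    ContDiffOn ℝ ∞ (fun s => s * besselK ν s ^ 2) (Ioi 0) :=
  contDiffOn_id.mul ((contDiffOn_besselK ν).pow 2)

lemma mul_besselK_sq_pos (ν : ℝ) {r : ℝ} (hr : 0 < r) : 0 < r * besselK ν r ^ 2 :=
  mul_pos hr (pow_pos (besselK_pos ν hr) 2)

lemma contDiffOn_inv_mul_besselK_sq (ν : ℝ) :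
    ContDiffOn ℝ ∞ (fun s => 1 / (s * besselK ν s ^ 2)) (Ioi 0) :=
  contDiffOn_const.div (contDiffOn_mul_besselK_sq ν) fun _ hs => (mul_besselK_sq_pos ν hs).ne'

lemma hasDerivAt_besselRatio (ν : ℝ) {r : ℝ} (hr : 0 < r) :
    HasDerivAt (besselRatio ν) (1 / (r * besselK ν r ^ 2)) r := by
  have hc := (contDiffOn_inv_mul_besselK_sq ν).continuousOn
  refine intervalIntegral.integral_hasDerivAt_right ?_ ?_ (hc.continuousAt (Ioi_mem_nhds hr))
  · refine (hc.mono fun s hs => ?_).intervalIntegrable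
    exact lt_of_lt_of_le (lt_min one_pos hr) hs.1
  · exact hc.stronglyMeasurableAtFilter isOpen_Ioi r hr

/-- Weak solutions of the modified Bessel equation are classical solutions. -/
lemma exists_eq_besselK_mul {ν : ℝ} {h : ℝ → ℂ} (hh : LocallyIntegrableOn h (Ioi 0))
    (hw : ∀ f, IsRadialTest f → ∫ r, besselOp ν f r • h r = 0) :
    ∃ c₁ c₀ : ℂ, ∀ᵐ r, r ∈ Ioi (0 : ℝ) →
      h r = besselK ν r * (c₁ + c₀ * besselRatio ν r) := by
  have hP := contDiffOn_mul_besselK_sq ν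
  have hQ := contDiffOn_inv_mul_besselK_sq ν
  set w : ℝ → ℂ := fun r => (besselK ν r)⁻¹ • h r with hwdef
  have hwl : LocallyIntegrableOn w (Ioi 0) :=
    hh.continuousOn_smul isOpen_Ioi.isLocallyClosed
      ((continuousOn_besselK ν).inv₀ fun r hr => (besselK_pos ν hr).ne')
  have hmean : ∀ f, IsRadialTest f → ∫ r, 1 / (r * besselK ν r ^ 2) * f r = 0 →
      ∫ r, deriv f r • w r = 0 := by
    intro f hf h0
    obtain ⟨b, hb, hbd⟩ := (hf.mul_left hQ).exists_primitive h0
    have hfb : (fun s => s * besselK ν s ^ 2 * deriv b s) = f := by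
      ext r
      rw [hbd]
      rcases le_or_gt r 0 with hr | hr
      · simp [hf.apply_eq_zero hr]
      · have hK := (besselK_pos ν hr).ne'
        field_simp
    rw [← hw _ (hb.mul_left (contDiffOn_besselK ν))]
    refine integral_congr_ae (Eventually.of_forall fun r => ?_)
    simp only [hwdef]
    rw [besselOp_besselK_mul hb, hfb, smul_smul, div_eq_mul_inv]
  obtain ⟨δ, hδ, hδ1⟩ := exists_isRadialTest_integral_eq_one
  have hγ := hδ.mul_left hP
  set γ : ℝ → ℝ := fun r => r * besselK ν r ^ 2 * δ r with hγdef
  have hγ1 : ∫ r, 1 / (r * besselK ν r ^ 2) * γ r = 1 := by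
    refine Eq.trans ?_ hδ1
    congr 1
    ext r
    simp only [hγdef]
    rcases le_or_gt r 0 with hr | hr
    · simp [hδ.apply_eq_zero hr]
    · have h := (mul_besselK_sq_pos ν hr).ne'
      rw [← mul_assoc, one_div_mul_cancel h, one_mul]
  set c : ℂ := ∫ r, deriv γ r • w r with hc
  have hJc : ContinuousOn (besselRatio ν) (Ioi 0) := fun r hr =>
    (hasDerivAt_besselRatio ν hr).continuousAt.continuousWithinAt
  have hJl : LocallyIntegrableOn (fun r => c * (besselRatio ν r : ℂ)) (Ioi 0) :=
    (continuousOn_const.mul (Complex.continuous_ofReal.comp_continuousOn hJc)).locallyIntegrableOn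
      measurableSet_Ioi
  obtain ⟨c₁, hc₁⟩ := ae_eq_const_of_integral_deriv_smul_eq_zero (hwl.add hJl) (by
    intro f hf
    set m : ℝ := ∫ r, 1 / (r * besselK ν r ^ 2) * f r with hm
    have h1 := hmean _ (hf.sub (hγ.const_mul m)) (by
      simp only [mul_sub, mul_left_comm _ m]
      rw [integral_sub (hf.mul_left hQ).integrable ((hγ.mul_left hQ).const_mul m).integrable,
        integral_const_mul, hγ1, ← hm]
      ring)
    have hd : ∀ r, deriv (fun r => f r - m * γ r) r = deriv f r - m * deriv γ r := fun r =>
      ((hf.differentiable r).hasDerivAt.sub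
        ((hγ.differentiable r).hasDerivAt.const_mul m)).deriv
    simp only [hd, sub_smul, mul_smul] at h1
    have h2 := integral_sub (hf.deriv.integrable_smul hwl)
      ((hγ.deriv.integrable_smul hwl).smul m)
    simp only [Pi.smul_apply] at h2
    rw [h2, integral_smul, ← hc, sub_eq_zero] at h1
    simp only [Pi.add_apply, smul_add]
    rw [integral_add (hf.deriv.integrable_smul hwl) (hf.deriv.integrable_smul hJl), h1]
    have h3 := hf.integral_deriv_mul (fun r hr => hasDerivAt_besselRatio ν hr) hQ.continuousOn
    rw [← hm] at h3
    have h4 : ∀ r, deriv f r • (c * (besselRatio ν r : ℂ)) =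
        ((deriv f r * besselRatio ν r : ℝ) : ℂ) * c := by
      intro r
      rw [Complex.real_smul]
      push_cast
      ring
    simp only [h4]
    rw [integral_mul_const, integral_complex_ofReal, h3, Complex.real_smul]
    push_cast
    ring)
  refine ⟨c₁, -c, ?_⟩
  filter_upwards [hc₁] with r hr hr0
  have h1 := hr hr0
  have hK : (besselK ν r : ℂ) ≠ 0 := by exact_mod_cast (besselK_pos ν hr0).ne'
  have h2 : c₁ + -c * (besselRatio ν r : ℂ) = w r := by
    rw [← h1]
    simp only [Pi.add_apply]
    ring
  rw [h2, hwdef]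
  simp only [Complex.real_smul]
  push_cast
  field_simp

/-- Multiples of the growing solution are not square integrable at infinity. -/
lemma eq_zero_of_integrableOn_besselRatio {ν : ℝ} {c₁ c₀ : ℂ}
    (h : IntegrableOn (fun r : ℝ => r * ‖besselK ν r * (c₁ + c₀ * besselRatio ν r)‖ ^ 2) (Ioi 0)) :
    c₀ = 0 := by
  by_contra hc
  set d : ℝ := (c₁ / c₀).re with hd
  set P : ℝ → ℝ := fun r => besselRatio ν r + d with hPdef
  have hPd : ∀ {r : ℝ}, 0 < r → HasDerivAt P (1 / (r * besselK ν r ^ 2)) r := fun hr =>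
    (hasDerivAt_besselRatio ν hr).add_const d
  have hPlow : ∀ r : ℝ, ‖c₀‖ ^ 2 * P r ^ 2 ≤ ‖c₁ + c₀ * besselRatio ν r‖ ^ 2 := by
    intro r
    have h1 : c₁ + c₀ * besselRatio ν r = c₀ * (c₁ / c₀ + besselRatio ν r) := by
      field_simp
    have h2 : |P r| ≤ ‖c₁ / c₀ + besselRatio ν r‖ := by
      have h3 := Complex.abs_re_le_norm (c₁ / c₀ + besselRatio ν r)
      rw [Complex.add_re, Complex.ofReal_re, add_comm, ← hd] at h3
      exact h3
    rw [h1, norm_mul, mul_pow, ← sq_abs (P r)]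
    gcongr
  set k := 1 / besselK ν 1 ^ 2 with hk
  have hK1 := besselK_pos ν one_pos
  have hkpos : 0 < k := by positivity
  have hP' : ∀ r : ℝ, 1 ≤ r → k ≤ 1 / (r * besselK ν r ^ 2) := by
    intro r hr
    have hr0 : 0 < r := by linarith
    refine one_div_le_one_div_of_le (mul_besselK_sq_pos ν hr0) ?_
    have h1 := besselK_le_besselK_one ν hr
    have h2 : r ≤ Real.exp (r - 1) := by linarith [Real.add_one_le_exp (r - 1)]
    have h3 : Real.exp (r - 1) * Real.exp (-(r - 1)) = 1 := by
      rw [← Real.exp_add]; simp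
    have h4 : Real.exp (-(r - 1)) ≤ 1 := Real.exp_le_one_iff.2 (by linarith)
    have hK := besselK_pos ν hr0
    calc r * besselK ν r ^ 2 ≤ Real.exp (r - 1) * (Real.exp (-(r - 1)) * besselK ν 1) ^ 2 := by
          gcongr
      _ = (Real.exp (r - 1) * Real.exp (-(r - 1))) * Real.exp (-(r - 1)) * besselK ν 1 ^ 2 := by
          ring
      _ ≤ besselK ν 1 ^ 2 := by
          rw [h3, one_mul]
          exact mul_le_of_le_one_left (by positivity) h4
  have hlin : ∀ r : ℝ, 1 ≤ r → P 1 + k * (r - 1) ≤ P r := by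
    intro r hr
    have := (convex_Icc 1 r).mul_sub_le_image_sub_of_le_deriv (f := P) (C := k)
      (fun s hs => (hPd (by linarith [hs.1])).continuousAt.continuousWithinAt)
      (fun s hs => (hPd (by
        rw [interior_Icc] at hs; linarith [hs.1])).differentiableAt.differentiableWithinAt)
      (fun s hs => by
        rw [interior_Icc] at hs
        rw [(hPd (by linarith [hs.1])).deriv]
        exact hP' s hs.1.le)
      1 (left_mem_Icc.2 hr) r (right_mem_Icc.2 hr) hr
    linarith
  have hPtop : Tendsto P atTop atTop := by
    refine tendsto_atTop_mono' atTop (eventually_atTop.2 ⟨1, hlin⟩) ?_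
    exact tendsto_atTop_add_const_left _ _
      ((tendsto_atTop_add_const_right _ (-1) tendsto_id).const_mul_atTop hkpos)
  obtain ⟨R, hR1, hRP⟩ : ∃ R : ℝ, 1 ≤ R ∧ ∀ r, R ≤ r → 0 < P r := by
    obtain ⟨R, hR⟩ := eventually_atTop.1 (hPtop.eventually_gt_atTop 0)
    exact ⟨max 1 R, le_max_left _ _, fun r hr => hR r ((le_max_right _ _).trans hr)⟩
  have hI1 : IntegrableOn (fun r => 1 / (r * besselK ν r ^ 2) / P r ^ 2) (Ioi R) := by
    refine integrableOn_Ioi_deriv_of_nonneg' (g := fun r => -(P r)⁻¹) (l := 0) ?_ ?_ ?_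
    · intro r hr
      have hr0 : 0 < r := by linarith [mem_Ici.1 hr]
      convert! ((hPd hr0).inv (hRP r hr).ne').neg using 1
      ring
    · intro r hr
      have hr0 : 0 < r := by linarith [mem_Ioi.1 hr]
      have := mul_besselK_sq_pos ν hr0
      positivity
    · simpa using hPtop.inv_tendsto_atTop.neg
  have hI2 := (h.mono_set (Ioi_subset_Ioi (by linarith : (0 : ℝ) ≤ R))).const_mul (1 / ‖c₀‖ ^ 2)
  have hone : IntegrableOn (fun _ : ℝ => (2 : ℝ)) (Ioi R) := by
    refine (hI1.add hI2).mono' (by fun_prop) ?_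
    filter_upwards [ae_restrict_mem measurableSet_Ioi] with r hr
    have hr0 : 0 < r := by linarith [mem_Ioi.1 hr]
    have hp := mul_besselK_sq_pos ν hr0
    have hPr := hRP r (le_of_lt hr)
    have hc0 : 0 < ‖c₀‖ := norm_pos_iff.2 hc
    rw [Real.norm_of_nonneg zero_le_two]
    simp only [Pi.add_apply]
    rw [norm_mul, mul_pow, Complex.norm_real, Real.norm_eq_abs, sq_abs]
    set a := r * besselK ν r ^ 2 with ha
    calc (2 : ℝ) ≤ 1 / a / P r ^ 2 + a * P r ^ 2 := by
          have hb : 0 < a * P r ^ 2 := by positivity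
          rw [div_div, ← sub_nonneg]
          have : 1 / (a * P r ^ 2) + a * P r ^ 2 - 2 =
              (a * P r ^ 2 - 1) ^ 2 / (a * P r ^ 2) := by
            field_simp
            ring
          rw [this]
          positivity
      _ = 1 / a / P r ^ 2 + 1 / ‖c₀‖ ^ 2 * (a * (‖c₀‖ ^ 2 * P r ^ 2)) := by
          field_simp
      _ ≤ 1 / a / P r ^ 2 + 1 / ‖c₀‖ ^ 2 * (a * ‖c₁ + c₀ * besselRatio ν r‖ ^ 2) := by
          gcongr
          exact hPlow r
      _ = _ := by
          rw [ha]; ring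
  simp [integrableOn_const_iff] at hone

lemma rpow_le_mul_besselK_sq (ν : ℝ) {r : ℝ} (hr : 0 < r) (hr1 : r ≤ 1) :
    (Real.exp (-Real.exp 1) / 2) ^ 2 * r ^ (1 - 2 * |ν|) ≤ r * besselK ν r ^ 2 := by
  have h := rpow_neg_le_besselK ν hr hr1
  have h1 : r ^ (1 - 2 * |ν|) = r * (r ^ (-|ν|)) ^ 2 := by
    rw [← Real.rpow_natCast, ← Real.rpow_mul hr.le, sub_eq_add_neg, Real.rpow_add hr,
      Real.rpow_one]
    congr 2
    push_cast
    ring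
  calc _ = r * (Real.exp (-Real.exp 1) / 2 * r ^ (-|ν|)) ^ 2 := by rw [h1]; ring
    _ ≤ _ := by gcongr

/-- `K_ν` is not square integrable near zero for `|ν| ≥ 1`. -/
lemma abs_lt_one_of_integrableOn_besselK {ν : ℝ}
    (h : IntegrableOn (fun r : ℝ => r * besselK ν r ^ 2) (Ioi 0)) : |ν| < 1 := by
  set κ := (Real.exp (-Real.exp 1) / 2) ^ 2 with hκ
  have hκ0 : 0 < κ := by positivity
  have h1 : IntegrableOn (fun r : ℝ => r ^ (1 - 2 * |ν|)) (Ioo 0 1) := by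
    refine ((h.mono_set Ioo_subset_Ioi_self).const_mul κ⁻¹).mono' ?_ ?_
    · exact (measurable_id.pow_const _).aestronglyMeasurable
    · filter_upwards [ae_restrict_mem measurableSet_Ioo] with r hr
      rw [Real.norm_of_nonneg (Real.rpow_nonneg hr.1.le _)]
      rw [le_inv_mul_iff₀ hκ0]
      exact rpow_le_mul_besselK_sq ν hr.1 hr.2.le
  rw [intervalIntegral.integrableOn_Ioo_rpow_iff one_pos] at h1
  linarith

lemma integral_mul_besselK_sq_ge {ν : ℝ} (hν : |ν| < 1)
    (h : IntegrableOn (fun r : ℝ => r * besselK ν r ^ 2) (Ioi 0)) :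
    (Real.exp (-Real.exp 1) / 2) ^ 2 / (2 * (1 - |ν|)) ≤ ∫ r in Ioi 0, r * besselK ν r ^ 2 := by
  set κ := (Real.exp (-Real.exp 1) / 2) ^ 2 with hκ
  have hs : -1 < 1 - 2 * |ν| := by linarith
  calc κ / (2 * (1 - |ν|)) = ∫ r in Ioo (0 : ℝ) 1, κ * r ^ (1 - 2 * |ν|) := by
        rw [integral_const_mul, ← integral_Ioc_eq_integral_Ioo,
          ← intervalIntegral.integral_of_le zero_le_one, integral_rpow (Or.inl hs)]
        rw [Real.one_rpow, Real.zero_rpow (by linarith)]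
        have : 1 - |ν| ≠ 0 := by linarith
        have h2 : 1 - 2 * |ν| + 1 = 2 * (1 - |ν|) := by ring
        rw [h2]
        field_simp
        ring
    _ ≤ ∫ r in Ioo (0 : ℝ) 1, r * besselK ν r ^ 2 := by
        refine setIntegral_mono_on (((intervalIntegral.integrableOn_Ioo_rpow_iff one_pos).2
          hs).const_mul κ) (h.mono_set Ioo_subset_Ioi_self) measurableSet_Ioo fun r hr => ?_
        exact rpow_le_mul_besselK_sq ν hr.1 hr.2.le
    _ ≤ _ := by
        refine setIntegral_mono_set h ?_ (LE.le.eventuallyLE Ioo_subset_Ioi_self)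
        filter_upwards [ae_restrict_mem measurableSet_Ioi] with r hr
        exact (mul_besselK_sq_pos ν hr).le

lemma locallyIntegrableOn_of_integrableOn_mul_sq {h : ℝ → ℂ}
    (hm : AEStronglyMeasurable h (volume.restrict (Ioi 0)))
    (h2 : IntegrableOn (fun r => r * ‖h r‖ ^ 2) (Ioi 0)) : LocallyIntegrableOn h (Ioi 0) := by
  rw [locallyIntegrableOn_iff isOpen_Ioi.isLocallyClosed]
  intro k hk hkc
  rcases k.eq_empty_or_nonempty with rfl | hne
  · simp
  obtain ⟨a, ha, hmin⟩ := hkc.exists_isLeast hne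
  have ha0 : 0 < a := hk ha
  refine Integrable.mono' ((integrableOn_const hkc.measure_lt_top.ne (C := (1 : ℝ))).add
    ((h2.mono_set hk).const_mul a⁻¹)) (hm.mono_measure (Measure.restrict_mono hk le_rfl)) ?_
  filter_upwards [ae_restrict_mem hkc.measurableSet] with r hr
  have har : a ≤ r := hmin hr
  have h3 : ‖h r‖ ^ 2 ≤ a⁻¹ * (r * ‖h r‖ ^ 2) := by
    rw [le_inv_mul_iff₀ ha0]
    gcongr
  simp only [Pi.add_apply]
  nlinarith [sq_nonneg (‖h r‖ - 1)]

/-- Square integrable weak solutions of the modified Bessel equation are multiples of `K_ν`, and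
vanish for `|ν| ≥ 1`. -/
lemma exists_eq_const_mul_besselK {ν : ℝ} {h : ℝ → ℂ}
    (hm : AEStronglyMeasurable h (volume.restrict (Ioi 0)))
    (h2 : IntegrableOn (fun r => r * ‖h r‖ ^ 2) (Ioi 0))
    (hw : ∀ f, IsRadialTest f → ∫ r, besselOp ν f r • h r = 0) :
    ∃ c : ℂ, (∀ᵐ r, r ∈ Ioi (0 : ℝ) → h r = c * besselK ν r) ∧ (1 ≤ |ν| → c = 0) ∧
      (|ν| < 1 → ‖c‖ ^ 2 * ((Real.exp (-Real.exp 1) / 2) ^ 2 / (2 * (1 - |ν|))) ≤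
        ∫ r in Ioi 0, r * ‖h r‖ ^ 2) := by
  obtain ⟨c₁, c₀, hc⟩ := exists_eq_besselK_mul (locallyIntegrableOn_of_integrableOn_mul_sq hm h2) hw
  have hc' : ∀ᵐ r ∂volume.restrict (Ioi (0 : ℝ)),
      h r = besselK ν r * (c₁ + c₀ * besselRatio ν r) :=
    (ae_restrict_iff' measurableSet_Ioi).2 hc
  have h0 : c₀ = 0 := eq_zero_of_integrableOn_besselRatio (ν := ν) (c₁ := c₁) (by
    refine h2.congr ?_
    filter_upwards [hc'] with r hr
    rw [hr])
  have he : (fun r => r * ‖h r‖ ^ 2) =ᵐ[volume.restrict (Ioi 0)]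
      fun r => ‖c₁‖ ^ 2 * (r * besselK ν r ^ 2) := by
    filter_upwards [hc'] with r hr
    rw [hr, h0, zero_mul, add_zero, norm_mul, Complex.norm_real, mul_pow, Real.norm_eq_abs, sq_abs]
    ring
  have hK : c₁ ≠ 0 → IntegrableOn (fun r : ℝ => r * besselK ν r ^ 2) (Ioi 0) := by
    intro hne
    have h3 := (h2.congr he).const_mul (‖c₁‖ ^ 2)⁻¹
    have : ‖c₁‖ ≠ 0 := norm_ne_zero_iff.2 hne
    refine h3.congr (Eventually.of_forall fun r => ?_)
    field_simp
  refine ⟨c₁, ?_, fun hν => ?_, fun hν => ?_⟩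
  · filter_upwards [hc] with r hr hr0
    rw [hr hr0, h0]
    ring
  · by_contra hne
    exact (abs_lt_one_of_integrableOn_besselK (hK hne)).not_ge hν
  · rcases eq_or_ne c₁ 0 with rfl | hne
    · rw [norm_zero, zero_pow two_ne_zero, zero_mul]
      refine setIntegral_nonneg measurableSet_Ioi fun r hr => ?_
      exact mul_nonneg (le_of_lt hr) (sq_nonneg _)
    · rw [integral_congr_ae he, integral_const_mul]
      gcongr
      exact integral_mul_besselK_sq_ge hν (hK hne)

lemma Gamma_le_one_of_mem_Icc {x : ℝ} (hx : x ∈ Icc (1 : ℝ) 2) : Real.Gamma x ≤ 1 := by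
  have h := Real.convexOn_Gamma.2 (mem_Ioi.2 one_pos) (mem_Ioi.2 two_pos)
    (sub_nonneg.2 hx.2) (sub_nonneg.2 hx.1) (by ring)
  simp only [smul_eq_mul, Real.Gamma_one, Real.Gamma_two] at h
  have e : (2 - x) * 1 + (x - 1) * 2 = x := by ring
  rw [e] at h
  linarith

lemma Gamma_one_add_mul_Gamma_one_sub_le {ξ : ℝ} (hξ : |ξ| < 1) :
    Real.Gamma (1 + ξ) * Real.Gamma (1 - ξ) ≤ 1 / (1 - |ξ|) := by
  wlog h : 0 ≤ ξ generalizing ξ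
  · have := this (ξ := -ξ) (by rwa [abs_neg]) (by linarith)
    rwa [abs_neg, sub_neg_eq_add, ← sub_eq_add_neg, mul_comm] at this
  rw [abs_of_nonneg h] at hξ ⊢
  have h1 : Real.Gamma (1 + ξ) ≤ 1 := Gamma_le_one_of_mem_Icc ⟨by linarith, by linarith⟩
  have h2 : (1 - ξ) * Real.Gamma (1 - ξ) ≤ 1 := by
    rw [← Real.Gamma_add_one (by linarith)]
    exact Gamma_le_one_of_mem_Icc ⟨by linarith, by linarith⟩
  have h3 : 0 < Real.Gamma (1 - ξ) := Real.Gamma_pos_of_pos (by linarith)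
  rw [le_div_iff₀ (by linarith)]
  calc _ = Real.Gamma (1 + ξ) * ((1 - ξ) * Real.Gamma (1 - ξ)) := by ring
    _ ≤ 1 * 1 := mul_le_mul h1 h2 (mul_nonneg (by linarith) h3.le) zero_le_one
    _ = 1 := one_mul 1

lemma one_le_Gamma_one_add_mul_Gamma_one_sub {ξ : ℝ} (hξ : |ξ| < 1) :
    1 ≤ Real.Gamma (1 + ξ) * Real.Gamma (1 - ξ) := by
  wlog h : 0 ≤ ξ generalizing ξ
  · have := this (ξ := -ξ) (by rwa [abs_neg]) (by linarith)
    rwa [sub_neg_eq_add, ← sub_eq_add_neg, mul_comm] at this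
  rcases h.eq_or_lt with rfl | h
  · simp
  rw [abs_of_pos h] at hξ
  rw [add_comm, Real.Gamma_add_one h.ne', mul_assoc, Real.Gamma_mul_Gamma_one_sub]
  have hs : 0 < Real.sin (Real.pi * ξ) :=
    Real.sin_pos_of_pos_of_lt_pi (by positivity) (by nlinarith [Real.pi_pos])
  rw [mul_div_assoc', le_div_iff₀ hs]
  nlinarith [Real.sin_le (x := Real.pi * ξ) (by positivity)]

lemma continuousOn_Gamma_one_add_mul_Gamma_one_sub :
    ContinuousOn (fun ξ : ℝ => 1 / 2 * Real.Gamma (1 + ξ) * Real.Gamma (1 - ξ)) (Ioo (-1) 1) := by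
  intro ξ hξ
  have h : ∀ {u : ℝ → ℝ}, Continuous u → 0 < u ξ → ContinuousAt (fun ξ => Real.Gamma (u ξ)) ξ :=
    fun {u} hu hx => (Real.differentiableAt_Gamma fun m hm => by
      have := m.cast_nonneg (α := ℝ)
      linarith).continuousAt.comp (f := u) hu.continuousAt
  exact ((continuousAt_const.mul (h (by fun_prop) (by linarith [hξ.1]))).mul
    (h (by fun_prop) (by linarith [hξ.2]))).continuousWithinAt

/-- The weighted `L²` space on `(-1, 1)` is contained in `L¹(-1, 1)`. -/
lemma integrableOn_of_integrableOn_weight {g : ℝ → ℂ} (hm : Measurable g)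
    (hg : IntegrableOn (fun ξ : ℝ =>
      (1 / 2) * Real.Gamma (1 + ξ) * Real.Gamma (1 - ξ) * ‖g ξ‖ ^ 2) (Ioo (-1) 1)) :
    IntegrableOn g (Ioo (-1) 1) := by
  refine Integrable.mono' ((integrable_const (1 : ℝ)).add (hg.const_mul 2))
    hm.aestronglyMeasurable ?_
  filter_upwards [ae_restrict_mem measurableSet_Ioo] with ξ hξ
  have h := one_le_Gamma_one_add_mul_Gamma_one_sub (abs_lt.2 hξ)
  simp only [Pi.add_apply]
  nlinarith [sq_nonneg (‖g ξ‖ - 1), sq_nonneg ‖g ξ‖]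

lemma contDiffOn_one_div_fst :
    ContDiffOn ℝ ∞ (fun p : ℝ × ℝ => 1 / (p.1 : ℂ)) (Ioi 0 ×ˢ univ) := by
  have h : ContDiffOn ℝ ∞ (fun p : ℝ × ℝ => 1 / p.1) (Ioi 0 ×ˢ univ) :=
    contDiffOn_const.div contDiff_fst.contDiffOn fun p hp => (mem_Ioi.1 hp.1).ne'
  exact (Complex.ofRealCLM.contDiff.comp_contDiffOn h).congr fun p _ => by simp

namespace IsLogTest

variable {f g : ℝ × ℝ → ℂ}

lemma continuous (hf : IsLogTest f) : Continuous f := hf.1.continuous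

lemma apply_eq_zero (hf : IsLogTest f) {p : ℝ × ℝ} (hp : p.1 ≤ 0) : f p = 0 :=
  image_eq_zero_of_notMem_tsupport fun h => (hf.2.2 h).1.not_ge hp

lemma differentiable (hf : IsLogTest f) : Differentiable ℝ f := hf.1.differentiable (by simp)

lemma fderiv_apply (hf : IsLogTest f) (v : ℝ × ℝ) : IsLogTest (fun p => fderiv ℝ f p v) := by
  refine ⟨(hf.1.fderiv_right (m := ∞) (by simp)).clm_apply contDiff_const, hf.2.1.fderiv_apply ℝ v,
    (tsupport_fderiv_apply_subset ℝ v).trans hf.2.2⟩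

lemma pdr (hf : IsLogTest f) : IsLogTest (pdr f) := hf.fderiv_apply _

lemma pdθ (hf : IsLogTest f) : IsLogTest (pdθ f) := hf.fderiv_apply _

lemma sub (hf : IsLogTest f) (hg : IsLogTest g) : IsLogTest (fun r => f r - g r) := by
  have h : tsupport (fun r => f r - g r) ⊆ tsupport f ∪ tsupport g := tsupport_sub f g
  exact ⟨hf.1.sub hg.1, hf.2.1.sub hg.2.1, h.trans (union_subset hf.2.2 hg.2.2)⟩

lemma add (hf : IsLogTest f) (hg : IsLogTest g) : IsLogTest (fun r => f r + g r) := by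
  have h : tsupport (fun r => f r + g r) ⊆ tsupport f ∪ tsupport g := tsupport_add f g
  exact ⟨hf.1.add hg.1, hf.2.1.add hg.2.1, h.trans (union_subset hf.2.2 hg.2.2)⟩

lemma conj (hf : IsLogTest f) : IsLogTest (fun p => (starRingEnd ℂ) (f p)) :=
  ⟨Complex.conjCLE.contDiff.comp hf.1, hf.2.1.comp_left (map_zero _),
    (tsupport_comp_subset (map_zero (starRingEnd ℂ)) f).trans hf.2.2⟩

lemma mul_left (hf : IsLogTest f) (hg : ContDiffOn ℝ ∞ g (Ioi 0 ×ˢ univ)) :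
    IsLogTest (fun p => g p * f p) := by
  refine ⟨contDiff_iff_contDiffAt.2 fun p => ?_, hf.2.1.mul_left,
    (tsupport_mul_subset_right (f := g)).trans hf.2.2⟩
  by_cases hp : p ∈ tsupport f
  · exact (hg.contDiffAt ((isOpen_Ioi.prod isOpen_univ).mem_nhds (hf.2.2 hp))).mul
      hf.1.contDiffAt
  · have h0 : (fun p => g p * f p) =ᶠ[𝓝 p] fun _ => 0 := by
      filter_upwards [notMem_tsupport_iff_eventuallyEq.1 hp] with s hs
      simp [hs]
    exact contDiffAt_const.congr_of_eventuallyEq h0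

lemma polarLap (hf : IsLogTest f) : IsLogTest (polarLap f) := by
  have h := contDiffOn_one_div_fst
  have h2 : ContDiffOn ℝ ∞ (fun p : ℝ × ℝ => 1 / (p.1 : ℂ) ^ 2) (Ioi 0 ×ˢ univ) := by
    simpa only [one_div, inv_pow] using h.pow 2
  exact (hf.pdr.pdr.add (hf.pdr.mul_left h)).add (hf.pdθ.pdθ.mul_left h2)

lemma integrable (hf : IsLogTest f) : Integrable f :=
  hf.continuous.integrable_of_hasCompactSupport hf.2.1

lemma integral_fderiv_apply (hf : IsLogTest f) (v : ℝ × ℝ) : ∫ p, fderiv ℝ f p v = 0 := by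
  have h := integral_mul_fderiv_eq_neg_fderiv_mul_of_integrable (μ := volume) (𝕜 := ℂ)
    (f := fun _ : ℝ × ℝ => (1 : ℂ)) (g := f) (v := v) (by simp)
    (by simpa using (hf.fderiv_apply v).integrable) (by simpa using hf.integrable)
    (fun _ _ => differentiableAt_const _) fun p _ => hf.differentiable p
  simpa using h

lemma hasDerivAt_left (hf : IsLogTest f) (p : ℝ × ℝ) :
    HasDerivAt (fun s => f (s, p.2)) (_root_.pdr f p) p.1 := by
  have h := (hf.differentiable p).hasFDerivAt.comp_hasDerivAt p.1
    ((hasDerivAt_id p.1).prodMk (hasDerivAt_const p.1 p.2))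
  exact h

lemma hasDerivAt_right (hf : IsLogTest f) (p : ℝ × ℝ) :
    HasDerivAt (fun s => f (p.1, s)) (_root_.pdθ f p) p.2 := by
  have h := (hf.differentiable p).hasFDerivAt.comp_hasDerivAt p.2
    ((hasDerivAt_const p.2 p.1).prodMk (hasDerivAt_id p.2))
  exact h

lemma exists_pos_le (hf : IsLogTest f) : ∃ a > 0, ∀ p : ℝ × ℝ, p.1 < a → f p = 0 := by
  rcases (tsupport f).eq_empty_or_nonempty with he | hne
  · exact ⟨1, one_pos, fun p _ => image_eq_zero_of_notMem_tsupport (by simp [he])⟩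
  · obtain ⟨q, hq, hmin⟩ := (show IsCompact (tsupport f) from hf.2.1).exists_isMinOn hne
      continuous_fst.continuousOn
    refine ⟨q.1, (hf.2.2 hq).1, fun p hp => image_eq_zero_of_notMem_tsupport fun h => ?_⟩
    exact (hmin h).not_gt hp

end IsLogTest

lemma pdr_conj {f : ℝ × ℝ → ℂ} (hf : IsLogTest f) (p : ℝ × ℝ) :
    pdr (fun q => (starRingEnd ℂ) (f q)) p = (starRingEnd ℂ) (pdr f p) :=
  (hf.conj.hasDerivAt_left p).unique
    (Complex.conjCLE.hasFDerivAt.comp_hasDerivAt p.1 (hf.hasDerivAt_left p))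

lemma pdθ_conj {f : ℝ × ℝ → ℂ} (hf : IsLogTest f) (p : ℝ × ℝ) :
    pdθ (fun q => (starRingEnd ℂ) (f q)) p = (starRingEnd ℂ) (pdθ f p) :=
  (hf.conj.hasDerivAt_right p).unique
    (Complex.conjCLE.hasFDerivAt.comp_hasDerivAt p.2 (hf.hasDerivAt_right p))

lemma polarLap_conj {f : ℝ × ℝ → ℂ} (hf : IsLogTest f) (p : ℝ × ℝ) :
    polarLap (fun q => (starRingEnd ℂ) (f q)) p = (starRingEnd ℂ) (polarLap f p) := by
  have h1 : pdr (fun q => (starRingEnd ℂ) (f q)) = fun q => (starRingEnd ℂ) (pdr f q) :=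
    funext (pdr_conj hf)
  have h2 : pdθ (fun q => (starRingEnd ℂ) (f q)) = fun q => (starRingEnd ℂ) (pdθ f q) :=
    funext (pdθ_conj hf)
  simp only [polarLap, h1, h2, pdr_conj hf.pdr, pdθ_conj hf.pdθ]
  simp

lemma integral_polarMeasure {f : ℝ × ℝ → ℂ} (hf : ∀ p : ℝ × ℝ, p.1 ≤ 0 → f p = 0) :
    ∫ p, f p ∂polarMeasure = ∫ p, (p.1 : ℂ) * f p := by
  rw [polarMeasure, integral_withDensity_eq_integral_toReal_smul (by fun_prop) (by simp)]
  rw [← setIntegral_eq_integral_of_forall_compl_eq_zero (s := Ioi (0 : ℝ) ×ˢ (univ : Set ℝ))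
    (f := fun p : ℝ × ℝ => (p.1 : ℂ) * f p)]
  · refine setIntegral_congr_fun (measurableSet_Ioi.prod .univ) fun p hp => ?_
    rw [ENNReal.toReal_ofReal (le_of_lt hp.1), Complex.real_smul]
  · intro p hp
    rw [hf p (by simpa using hp), mul_zero]

lemma integrable_polarMeasure {f : ℝ × ℝ → ℂ} (hf : Continuous f) (hc : HasCompactSupport f) :
    Integrable f polarMeasure := by
  rw [polarMeasure, integrable_withDensity_iff_integrable_smul' (by fun_prop) (by simp)]
  have h : Integrable (fun p : ℝ × ℝ => p.1 • f p)
      (volume.restrict (Ioi (0 : ℝ) ×ˢ (univ : Set ℝ))) :=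
    ((continuous_fst.smul hf).integrable_of_hasCompactSupport
      hc.smul_left).integrableOn
  refine h.congr ?_
  filter_upwards [ae_restrict_mem (measurableSet_Ioi.prod .univ)] with p hp
  rw [ENNReal.toReal_ofReal (le_of_lt hp.1)]

instance sFinite_polarMeasure : SFinite polarMeasure := by
  unfold polarMeasure
  infer_instance

/-- `K_ξ(r) e^{iξθ}` is a weak solution of `Δu = u`. -/
lemma integral_besselK_mul_exp_mul_polarLap_sub {w : ℝ × ℝ → ℂ} (hw : IsLogTest w) (ξ : ℝ) :
    ∫ p, ((besselK ξ p.1 : ℂ) * Complex.exp (Complex.I * ξ * p.2)) * (polarLap w p - w p)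
      ∂polarMeasure = 0 := by
  have hE : ContDiff ℝ ∞ fun p : ℝ × ℝ => Complex.exp (Complex.I * ξ * p.2) := by
    have : ContDiff ℝ ∞ fun p : ℝ × ℝ => (p.2 : ℂ) := Complex.ofRealCLM.contDiff.comp contDiff_snd
    fun_prop
  have hfst : ContDiff ℝ ∞ fun p : ℝ × ℝ => (p.1 : ℂ) :=
    Complex.ofRealCLM.contDiff.comp contDiff_fst
  have hKc : ContDiffOn ℝ ∞ (fun p : ℝ × ℝ => (besselK ξ p.1 : ℂ)) (Ioi 0 ×ˢ univ) :=
    Complex.ofRealCLM.contDiff.comp_contDiffOn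
      ((contDiffOn_besselK ξ).comp contDiff_fst.contDiffOn fun p hp => hp.1)
  have hMc : ContDiffOn ℝ ∞ (fun p : ℝ × ℝ => (besselMoment 1 ξ p.1 : ℂ)) (Ioi 0 ×ˢ univ) :=
    Complex.ofRealCLM.contDiff.comp_contDiffOn
      ((contDiffOn_besselMoment ξ 1).comp contDiff_fst.contDiffOn fun p hp => hp.1)
  set A : ℝ × ℝ → ℂ := fun p => (p.1 * besselK ξ p.1 * Complex.exp (Complex.I * ξ * p.2)) * pdr w p
    + (p.1 * besselMoment 1 ξ p.1 * Complex.exp (Complex.I * ξ * p.2)) * w p with hA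
  set B : ℝ × ℝ → ℂ := fun p =>
    (1 / p.1 * besselK ξ p.1 * Complex.exp (Complex.I * ξ * p.2)) * pdθ w p
    - (Complex.I * ξ * (1 / p.1 * besselK ξ p.1 * Complex.exp (Complex.I * ξ * p.2))) * w p with hB
  have hinv := contDiffOn_one_div_fst
  have hAt : IsLogTest A := (hw.pdr.mul_left ((hfst.contDiffOn.mul hKc).mul hE.contDiffOn)).add
    (hw.mul_left ((hfst.contDiffOn.mul hMc).mul hE.contDiffOn))
  have hBt : IsLogTest B := (hw.pdθ.mul_left ((hinv.mul hKc).mul hE.contDiffOn)).sub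
    (hw.mul_left (contDiffOn_const.mul ((hinv.mul hKc).mul hE.contDiffOn)))
  rw [integral_polarMeasure fun p hp => by
    rw [hw.polarLap.apply_eq_zero hp, hw.apply_eq_zero hp, sub_zero, mul_zero]]
  have hkey : ∀ p : ℝ × ℝ, (p.1 : ℂ) * (((besselK ξ p.1 : ℂ) * Complex.exp (Complex.I * ξ * p.2)) *
      (polarLap w p - w p)) = pdr A p + pdθ B p := by
    intro p
    rcases le_or_gt p.1 0 with hp | hp
    · rw [hw.polarLap.apply_eq_zero hp, hw.apply_eq_zero hp, hAt.pdr.apply_eq_zero hp,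
        hBt.pdθ.apply_eq_zero hp]
      simp
    have hx : HasDerivAt (fun s : ℝ => (s : ℂ)) 1 p.1 := Complex.ofRealCLM.hasDerivAt
    have hK := (hasDerivAt_besselK ξ hp).ofReal_comp
    have hM := (hasDerivAt_besselMoment 1 ξ hp).ofReal_comp
    have h1 := (hAt.hasDerivAt_left p).unique
      ((((hx.mul hK).mul_const (Complex.exp (Complex.I * ξ * p.2))).mul
        (hw.pdr.hasDerivAt_left p)).add
          (((hx.mul hM).mul_const (Complex.exp (Complex.I * ξ * p.2))).mul
            (hw.hasDerivAt_left p)))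
    have hEd : HasDerivAt (fun s : ℝ => Complex.exp (Complex.I * ξ * s))
        (Complex.exp (Complex.I * ξ * p.2) * (Complex.I * ξ)) p.2 := by
      have h := ((Complex.ofRealCLM.hasDerivAt (x := p.2)).const_mul (Complex.I * ξ)).cexp
      simpa using h
    have hEd' := hEd.const_mul (1 / (p.1 : ℂ) * besselK ξ p.1)
    have h2 := (hBt.hasDerivAt_right p).unique
      ((hEd'.mul (hw.pdθ.hasDerivAt_right p)).sub
        ((hEd'.const_mul (Complex.I * ξ)).mul (hw.hasDerivAt_right p)))
    have hode : (p.1 : ℂ) ^ 2 * besselMoment 2 ξ p.1 - p.1 * besselMoment 1 ξ p.1 -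
        (p.1 ^ 2 + ξ ^ 2) * besselK ξ p.1 = 0 := by exact_mod_cast besselK_ode ξ hp
    have hp0 : (p.1 : ℂ) ≠ 0 := by exact_mod_cast hp.ne'
    rw [h1, h2, polarLap]
    simp only [Pi.mul_apply, Complex.ofReal_neg]
    norm_num
    field_simp
    ring_nf
    simp only [Complex.I_sq]
    linear_combination w p * hode
  simp only [hkey]
  rw [integral_add hAt.pdr.integrable hBt.pdθ.integrable]
  rw [show ∫ p, pdr A p = 0 from hAt.integral_fderiv_apply _,
    show ∫ p, pdθ B p = 0 from hBt.integral_fderiv_apply _, add_zero]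

/-- Superpositions of the functions `K_ξ(r) e^{iξθ}` are weak solutions of `Δu = u`. -/
lemma integral_superposition_mul_polarLap_sub {g : ℝ → ℂ} (hg : IntegrableOn g (Ioo (-1) 1))
    {w : ℝ × ℝ → ℂ} (hw : IsLogTest w) :
    ∫ p, (∫ ξ in Ioo (-1 : ℝ) 1, g ξ * (besselK ξ p.1 : ℂ) * Complex.exp (Complex.I * ξ * p.2)) *
      (polarLap w p - w p) ∂polarMeasure = 0 := by
  have hv := hw.polarLap.sub hw
  obtain ⟨a, ha, hva⟩ := hv.exists_pos_le
  have hint : Integrable (Function.uncurry fun (p : ℝ × ℝ) (ξ : ℝ) =>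
      g ξ * (besselK ξ p.1 : ℂ) * Complex.exp (Complex.I * ξ * p.2) * (polarLap w p - w p))
      (polarMeasure.prod (volume.restrict (Ioo (-1) 1))) := by
    refine Integrable.mono' (((integrable_polarMeasure hv.continuous hv.2.1).norm.mul_prod
      hg.norm).const_mul (besselK 1 a)) ?_ ?_
    · have h1 : Measurable fun q : (ℝ × ℝ) × ℝ => besselK q.2 q.1.1 :=
        measurable_besselK_uncurry.comp
          (by fun_prop : Measurable fun q : (ℝ × ℝ) × ℝ => (q.2, q.1.1))
      have h2 : AEStronglyMeasurable (fun q : (ℝ × ℝ) × ℝ => g q.2)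
        (polarMeasure.prod (volume.restrict (Ioo (-1) 1))) := hg.aestronglyMeasurable.comp_snd
      have h3 : Continuous fun q : (ℝ × ℝ) × ℝ => polarLap w q.1 - w q.1 :=
        hv.continuous.comp continuous_fst
      exact ((h2.mul (Complex.measurable_ofReal.comp h1).aestronglyMeasurable).mul
        (by fun_prop : Continuous fun q : (ℝ × ℝ) × ℝ =>
          Complex.exp (Complex.I * q.2 * q.1.2)).aestronglyMeasurable).mul h3.aestronglyMeasurable
    · have hae : ∀ᵐ q : (ℝ × ℝ) × ℝ ∂(polarMeasure.prod (volume.restrict (Ioo (-1) 1))),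
          q.2 ∈ Ioo (-1 : ℝ) 1 :=
        Measure.quasiMeasurePreserving_snd.ae (ae_restrict_mem measurableSet_Ioo)
      filter_upwards [hae] with q hq
      simp only [Function.uncurry]
      rcases lt_or_ge q.1.1 a with h | h
      · rw [hva _ h]
        simp
      have h0 := besselK_le_of_abs_le_one (abs_lt.2 hq).le ha h
      have h1 : ‖Complex.exp (Complex.I * q.2 * q.1.2)‖ = 1 := by
        rw [Complex.norm_exp]
        simp
      rw [norm_mul, norm_mul, norm_mul, h1, Complex.norm_real, Real.norm_eq_abs,
        abs_of_pos (besselK_pos _ (ha.trans_le h))]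
      calc _ = besselK q.2 q.1.1 * (‖polarLap w q.1 - w q.1‖ * ‖g q.2‖) := by ring
        _ ≤ _ := by gcongr
  simp only [← integral_mul_const]
  rw [integral_integral_swap hint]
  refine integral_eq_zero_of_ae (Eventually.of_forall fun ξ => ?_)
  simp only [Pi.zero_apply, mul_assoc (g ξ)]
  rw [integral_const_mul, integral_besselK_mul_exp_mul_polarLap_sub hw, mul_zero]

lemma weak_solution_of_superposition {ψ : ℝ × ℝ → ℂ} {g : ℝ → ℂ} {C : ℂ}
    (hg : IntegrableOn g (Ioo (-1) 1))
    (h : ∀ᵐ p ∂polarMeasure, ψ p = C *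
      ∫ ξ in Ioo (-1 : ℝ) 1, g ξ * (besselK ξ p.1 : ℂ) * Complex.exp (Complex.I * ξ * p.2))
    {φ : ℝ × ℝ → ℂ} (hφ : IsLogTest φ) :
    ∫ p, ψ p * (starRingEnd ℂ) (polarLap φ p - φ p) ∂polarMeasure = 0 := by
  have h1 := integral_superposition_mul_polarLap_sub hg hφ.conj
  have h2 : ∫ p, ψ p * (starRingEnd ℂ) (polarLap φ p - φ p) ∂polarMeasure =
      ∫ p, C * ((∫ ξ in Ioo (-1 : ℝ) 1,
        g ξ * (besselK ξ p.1 : ℂ) * Complex.exp (Complex.I * ξ * p.2)) *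
      (polarLap (fun q => (starRingEnd ℂ) (φ q)) p - (starRingEnd ℂ) (φ p))) ∂polarMeasure := by
    refine integral_congr_ae ?_
    filter_upwards [h] with p hp
    rw [hp, polarLap_conj hφ, map_sub, mul_assoc]
  rw [h2, integral_const_mul, h1, mul_zero]

lemma ae_ae_swap_of_ae_prod {α β : Type*} [MeasurableSpace α] [MeasurableSpace β] {μ : Measure α}
    {ν : Measure β} [SFinite μ] [SFinite ν] {P : α × β → Prop} (h : ∀ᵐ p ∂μ.prod ν, P p) :
    ∀ᵐ y ∂ν, ∀ᵐ x ∂μ, P (x, y) :=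
  Measure.ae_ae_of_ae_prod
    ((Measure.measurePreserving_swap (μ := ν) (ν := μ)).quasiMeasurePreserving.ae h)

lemma norm_sq_eq_integral {α : Type*} [MeasurableSpace α] {μ : Measure α} (f : Lp ℂ 2 μ) :
    ‖f‖ ^ 2 = ∫ a, ‖f a‖ ^ 2 ∂μ := by
  have h : (inner ℂ f f : ℂ) = ∫ a, inner ℂ (f a) (f a) ∂μ := L2.inner_def f f
  simp only [inner_self_eq_norm_sq_to_K, ← RCLike.ofReal_pow] at h
  rw [integral_ofReal] at h
  exact_mod_cast h

lemma measurable_of_measurable_dist {α X : Type*} [MeasurableSpace α] [PseudoMetricSpace X]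
    [SecondCountableTopology X] [MeasurableSpace X] [BorelSpace X] {f : α → X}
    (h : ∀ x, Measurable fun a => dist (f a) x) : Measurable f := by
  refine measurable_of_isOpen fun U hU => ?_
  choose! ε hε hεU using Metric.isOpen_iff.1 hU
  obtain ⟨T, hT, hTU⟩ := TopologicalSpace.isOpen_iUnion_countable
    (fun x : U => Metric.ball (x : X) (ε x)) fun _ => Metric.isOpen_ball
  have hU' : U = ⋃ x ∈ T, Metric.ball (x : X) (ε x) := by
    rw [hTU]
    ext x
    simp only [mem_iUnion]
    exact ⟨fun hx => ⟨⟨x, hx⟩, Metric.mem_ball_self (hε x hx)⟩, fun ⟨y, hy⟩ => hεU y y.2 hy⟩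
  rw [hU', preimage_iUnion₂]
  exact .biUnion hT fun x _ => measurableSet_lt (h x) measurable_const

/-- A square integrable function on a product is a square integrable function with values in
`L²`. -/
lemma exists_memLp_curry {α : Type*} [MeasurableSpace α] {ρ : Measure α} [SFinite ρ]
    [SecondCountableTopology (Lp ℂ 2 ρ)] {ψ : α × ℝ → ℂ} (hψ : MemLp ψ 2 (ρ.prod volume)) :
    ∃ Ψ : ℝ → Lp ℂ 2 ρ, MemLp Ψ 2 ∧ ∀ᵐ θ, Ψ θ =ᵐ[ρ] fun r => ψ (r, θ) := by
  obtain ⟨ψ', hm, he⟩ := hψ.aestronglyMeasurable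
  have hψ' : MemLp ψ' 2 (ρ.prod volume) := (memLp_congr_ae he).1 hψ
  have hi := (memLp_two_iff_integrable_sq_norm hm.aestronglyMeasurable).1 hψ'
  have hsl : ∀ θ, StronglyMeasurable fun r => ψ' (r, θ) := fun θ =>
    hm.comp_measurable measurable_prodMk_right
  obtain ⟨hS, hi2⟩ := (integrable_prod_iff' hi.aestronglyMeasurable).1 hi
  have hSm : MeasurableSet {θ | Integrable (fun r => ‖ψ' (r, θ)‖ ^ 2) ρ} :=
    measurableSet_integrable (f := fun θ r => ‖ψ' (r, θ)‖ ^ 2)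
      (((hm.comp_measurable measurable_swap).norm).pow 2)
  have hmem : ∀ θ ∈ {θ | Integrable (fun r => ‖ψ' (r, θ)‖ ^ 2) ρ}, MemLp (fun r => ψ' (r, θ)) 2 ρ :=
    fun θ hθ => (memLp_two_iff_integrable_sq_norm (hsl θ).aestronglyMeasurable).2 hθ
  set S := {θ | Integrable (fun r => ‖ψ' (r, θ)‖ ^ 2) ρ} with hSdef
  classical
  set Ψ : ℝ → Lp ℂ 2 ρ := fun θ => if h : θ ∈ S then (hmem θ h).toLp _ else 0 with hΨ
  have hΨS : ∀ θ ∈ S, Ψ θ =ᵐ[ρ] fun r => ψ' (r, θ) := by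
    intro θ hθ
    simp only [hΨ, dif_pos hθ]
    exact (hmem θ hθ).coeFn_toLp
  have hdist : ∀ f : Lp ℂ 2 ρ, Measurable fun θ => dist (Ψ θ) f := by
    intro f
    have h1 : Measurable fun θ => ∫ r, ‖ψ' (r, θ) - f r‖ ^ 2 ∂ρ := by
      have h2 : StronglyMeasurable fun p : α × ℝ => ‖ψ' p - f p.1‖ ^ 2 :=
        ((hm.sub ((Lp.stronglyMeasurable f).comp_measurable measurable_fst)).norm).pow 2
      exact (StronglyMeasurable.integral_prod_left' h2).measurable
    have h3 : (fun θ => dist (Ψ θ) f) =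
        S.piecewise (fun θ => √(∫ r, ‖ψ' (r, θ) - f r‖ ^ 2 ∂ρ)) (fun _ => dist 0 f) := by
      ext θ
      by_cases hθ : θ ∈ S
      · rw [piecewise_eq_of_mem _ _ _ hθ, dist_eq_norm, ← Real.sqrt_sq (norm_nonneg (Ψ θ - f)),
          norm_sq_eq_integral]
        congr 1
        refine integral_congr_ae ?_
        filter_upwards [hΨS θ hθ, Lp.coeFn_sub (Ψ θ) f] with r h1 h2
        rw [h2, Pi.sub_apply, h1]
      · rw [piecewise_eq_of_notMem _ _ _ hθ]
        simp only [hΨ, dif_neg hθ]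
    rw [h3]
    exact Measurable.piecewise hSm h1.sqrt measurable_const
  have hΨm : AEStronglyMeasurable Ψ volume := by
    let : MeasurableSpace (Lp ℂ 2 ρ) := borel _
    have : BorelSpace (Lp ℂ 2 ρ) := ⟨rfl⟩
    exact (measurable_of_measurable_dist hdist).stronglyMeasurable.aestronglyMeasurable
  refine ⟨Ψ, (memLp_two_iff_integrable_sq_norm hΨm).2 (hi2.congr ?_), ?_⟩
  · filter_upwards [hS] with θ hθ
    rw [norm_sq_eq_integral]
    refine integral_congr_ae ?_
    filter_upwards [hΨS θ hθ] with r hr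
    rw [hr, Real.norm_of_nonneg (by positivity)]
  · filter_upwards [hS, ae_ae_swap_of_ae_prod he] with θ hθ h1
    filter_upwards [hΨS θ hθ, h1] with r h2 h3
    rw [h2, h3]

/-- The measure `r dr` on the half-line. -/
noncomputable def radialMeasure : Measure ℝ :=
  (volume.restrict (Ioi (0 : ℝ))).withDensity fun r => ENNReal.ofReal r

instance sigmaFinite_radialMeasure : SigmaFinite radialMeasure :=
  SigmaFinite.withDensity_ofReal _

lemma polarMeasure_eq_prod : polarMeasure = radialMeasure.prod volume := by
  rw [radialMeasure, prod_withDensity_left (by fun_prop), ← Measure.restrict_univ (μ := volume),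
    Measure.prod_restrict, Measure.restrict_univ]
  rfl

lemma ae_radialMeasure_iff {P : ℝ → Prop} :
    (∀ᵐ r ∂radialMeasure, P r) ↔ ∀ᵐ r, r ∈ Ioi (0 : ℝ) → P r := by
  rw [radialMeasure, ae_withDensity_iff' (by fun_prop), ae_restrict_iff' measurableSet_Ioi]
  refine ⟨fun h => ?_, fun h => ?_⟩ <;> filter_upwards [h] with r hr h0
  · exact hr h0 (by simpa using h0)
  · exact fun _ => hr h0

lemma integral_radialMeasure {E : Type*} [NormedAddCommGroup E] [NormedSpace ℝ E] (f : ℝ → E) :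
    ∫ r, f r ∂radialMeasure = ∫ r in Ioi 0, r • f r := by
  rw [radialMeasure, integral_withDensity_eq_integral_toReal_smul (by fun_prop) (by simp)]
  refine setIntegral_congr_fun measurableSet_Ioi fun r hr => ?_
  simp only [ENNReal.toReal_ofReal (le_of_lt (mem_Ioi.1 hr))]

lemma integrable_radialMeasure_iff {E : Type*} [NormedAddCommGroup E] [NormedSpace ℝ E]
    {f : ℝ → E} : Integrable f radialMeasure ↔ IntegrableOn (fun r => r • f r) (Ioi 0) := by
  rw [radialMeasure, integrable_withDensity_iff_integrable_smul' (by fun_prop) (by simp)]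
  refine integrable_congr ?_
  filter_upwards [ae_restrict_mem measurableSet_Ioi] with r hr
  rw [ENNReal.toReal_ofReal (le_of_lt (mem_Ioi.1 hr))]

lemma SchwartzMap.integrable_mul_of_memLp {F : ℝ → ℂ} (hF : MemLp F 2) (β : 𝓢(ℝ, ℂ)) :
    Integrable fun θ => β θ * F θ :=
  MemLp.integrable_mul (p := 2) (q := 2) (β.memLp 2) hF

/-- A second order equation with square integrable data that holds against compactly supported test
functions holds against Schwartz functions. -/
lemma integral_schwartz_eq_zero_of_integral_test_eq_zero {F G : ℝ → ℂ} (hF : MemLp F 2)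
    (hG : MemLp G 2)
    (h : ∀ β : ℝ → ℂ, ContDiff ℝ ∞ β → HasCompactSupport β →
      ∫ θ, (β θ * F θ + deriv (deriv β) θ * G θ) = 0) (β : 𝓢(ℝ, ℂ)) :
    ∫ θ, (β θ * F θ + deriv (deriv β) θ * G θ) = 0 := by
  let b : ContDiffBump (0 : ℝ) := ⟨1, 2, one_pos, one_lt_two⟩
  set κ : ℝ → ℂ := fun x => (b x : ℂ) with hκ
  have hκs : ContDiff ℝ ∞ κ := Complex.ofRealCLM.contDiff.comp b.contDiff
  have hκc : HasCompactSupport κ := b.hasCompactSupport.comp_left Complex.ofReal_zero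
  have hκ1 : ContDiff ℝ ∞ (deriv κ) := (contDiff_infty_iff_deriv.1 hκs).2
  have hκ2 : ContDiff ℝ ∞ (deriv (deriv κ)) := (contDiff_infty_iff_deriv.1 hκ1).2
  obtain ⟨C0, hC0⟩ := hκc.exists_bound_of_continuous hκs.continuous
  obtain ⟨C1, hC1⟩ := hκc.deriv.exists_bound_of_continuous hκ1.continuous
  obtain ⟨C2, hC2⟩ := hκc.deriv.deriv.exists_bound_of_continuous hκ2.continuous
  have hκ0 : κ 0 = 1 := by
    simp only [hκ]
    rw [b.one_of_mem_closedBall (by simp [b])]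
    simp
  set β1 := SchwartzMap.derivCLM ℂ ℂ β with hβ1
  set β2 := SchwartzMap.derivCLM ℂ ℂ β1 with hβ2
  have hd1 : ∀ θ, HasDerivAt β (β1 θ) θ := fun θ => β.differentiableAt.hasDerivAt
  have hd2 : ∀ θ, HasDerivAt β1 (β2 θ) θ := fun θ => β1.differentiableAt.hasDerivAt
  have hβd : deriv (deriv β) = β2 := by
    rw [show deriv β = β1 from funext fun θ => (hd1 θ).deriv]
    exact funext fun θ => (hd2 θ).deriv
  rw [hβd]
  have hcut : ∀ (ε θ : ℝ), HasDerivAt (fun θ => κ (ε * θ)) (ε * deriv κ (ε * θ)) θ := by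
    intro ε θ
    have h1 := ((hκs.differentiable (by simp) (ε * θ)).hasDerivAt).scomp θ
      ((hasDerivAt_id θ).const_mul ε)
    simpa [Function.comp_def] using h1
  have hcut1 : ∀ (ε θ : ℝ),
      HasDerivAt (fun θ => deriv κ (ε * θ)) (ε * deriv (deriv κ) (ε * θ)) θ := by
    intro ε θ
    have h1 := ((hκ1.differentiable (by simp) (ε * θ)).hasDerivAt).scomp θ
      ((hasDerivAt_id θ).const_mul ε)
    simpa [Function.comp_def] using h1
  have hdd : ∀ ε : ℝ, deriv (deriv fun θ => κ (ε * θ) * β θ) = fun θ =>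
      κ (ε * θ) * β2 θ + 2 * ε * deriv κ (ε * θ) * β1 θ +
        ε ^ 2 * deriv (deriv κ) (ε * θ) * β θ := by
    intro ε
    rw [show (deriv fun θ => κ (ε * θ) * β θ) =
      fun θ => ε * deriv κ (ε * θ) * β θ + κ (ε * θ) * β1 θ from
      funext fun θ => ((hcut ε θ).mul (hd1 θ)).deriv]
    ext θ
    refine Eq.trans (HasDerivAt.deriv
      ((((hcut1 ε θ).const_mul (ε : ℂ)).mul (hd1 θ)).add ((hcut ε θ).mul (hd2 θ)))) ?_
    ring
  have hε0 : Tendsto (fun n : ℕ => 1 / ((n : ℝ) + 1)) atTop (𝓝 0) :=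
    tendsto_one_div_add_atTop_nhds_zero_nat
  have hzero : ∀ n : ℕ, ∫ θ, (κ (1 / ((n : ℝ) + 1) * θ) * β θ * F θ +
      (κ (1 / ((n : ℝ) + 1) * θ) * β2 θ +
        2 * (1 / ((n : ℝ) + 1) : ℝ) * deriv κ (1 / ((n : ℝ) + 1) * θ) * β1 θ +
        (1 / ((n : ℝ) + 1) : ℝ) ^ 2 * deriv (deriv κ) (1 / ((n : ℝ) + 1) * θ) * β θ) * G θ) = 0 := by
    intro n
    have hε : (1 / ((n : ℝ) + 1)) ≠ 0 := by positivity
    have h1 := h (fun θ => κ (1 / ((n : ℝ) + 1) * θ) * β θ)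
      ((hκs.comp (contDiff_const.mul contDiff_id)).mul β.smooth')
      ((hκc.comp_homeomorph (Homeomorph.mulLeft₀ _ hε)).mul_right)
    rw [hdd] at h1
    exact h1
  refine tendsto_nhds_unique (tendsto_integral_of_dominated_convergence (μ := volume)
    (fun θ => C0 * ‖β θ * F θ‖ +
      (C0 * ‖β2 θ * G θ‖ + 2 * C1 * ‖β1 θ * G θ‖ + C2 * ‖β θ * G θ‖)) ?_ ?_ ?_ ?_)
    (tendsto_const_nhds.congr fun n => (hzero n).symm)
  · intro n
    have := hF.aestronglyMeasurable
    have := hG.aestronglyMeasurable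
    have := hκs.continuous
    have := hκ1.continuous
    have := hκ2.continuous
    have := β.continuous
    have := β1.continuous
    have := β2.continuous
    refine AEStronglyMeasurable.add (.mul (Continuous.aestronglyMeasurable (by fun_prop)) ‹_›)
      (.mul (Continuous.aestronglyMeasurable (by fun_prop)) ‹_›)
  · exact ((β.integrable_mul_of_memLp hF).norm.const_mul _).add
      ((((β2.integrable_mul_of_memLp hG).norm.const_mul _).add
        ((β1.integrable_mul_of_memLp hG).norm.const_mul _)).add
        ((β.integrable_mul_of_memLp hG).norm.const_mul _))
  · intro n
    have hn : ‖((1 / ((n : ℝ) + 1) : ℝ) : ℂ)‖ ≤ 1 := by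
      rw [Complex.norm_real, Real.norm_of_nonneg (by positivity)]
      exact div_le_one_of_le₀ (by linarith [n.cast_nonneg (α := ℝ)]) (by positivity)
    refine Eventually.of_forall fun θ => ?_
    set x := 1 / ((n : ℝ) + 1) * θ
    set e : ℂ := ((1 / ((n : ℝ) + 1) : ℝ) : ℂ)
    have e0 := hC0 x
    have e1 := hC1 x
    have e2 := hC2 x
    have hC1' : 0 ≤ C1 := (norm_nonneg _).trans e1
    have hC2' : 0 ≤ C2 := (norm_nonneg _).trans e2
    have hsplit : κ x * β θ * F θ + (κ x * β2 θ + 2 * e * deriv κ x * β1 θ +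
        e ^ 2 * deriv (deriv κ) x * β θ) * G θ = κ x * (β θ * F θ) + (κ x * (β2 θ * G θ) +
        2 * (e * deriv κ x) * (β1 θ * G θ) + (e ^ 2 * deriv (deriv κ) x) * (β θ * G θ)) := by ring
    rw [hsplit]
    refine (norm_add_le _ _).trans (add_le_add ?_ ((norm_add_le _ _).trans (add_le_add
      ((norm_add_le _ _).trans (add_le_add ?_ ?_)) ?_)))
    · rw [norm_mul]
      gcongr
    · rw [norm_mul]
      gcongr
    · rw [norm_mul, norm_mul, norm_mul, Complex.norm_two]
      gcongr
      exact (mul_le_mul hn e1 (norm_nonneg _) zero_le_one).trans (one_mul _).le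
    · rw [norm_mul, norm_mul, norm_pow]
      gcongr
      exact (mul_le_mul (pow_le_one₀ (norm_nonneg _) hn) e2 (norm_nonneg _) zero_le_one).trans
        (one_mul _).le
  · refine Eventually.of_forall fun θ => ?_
    have hx : Tendsto (fun n : ℕ => 1 / ((n : ℝ) + 1) * θ) atTop (𝓝 0) := by
      simpa using hε0.mul_const θ
    have he : Tendsto (fun n : ℕ => ((1 / ((n : ℝ) + 1) : ℝ) : ℂ)) atTop (𝓝 0) := by
      have := (Complex.continuous_ofReal.tendsto 0).comp hε0
      rwa [Complex.ofReal_zero] at this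
    have t0 := (hκs.continuous.tendsto 0).comp hx
    have t1 := (hκ1.continuous.tendsto 0).comp hx
    have t2 := (hκ2.continuous.tendsto 0).comp hx
    rw [hκ0] at t0
    have := ((t0.mul_const (β θ)).mul_const (F θ)).add
      ((((t0.mul_const (β2 θ)).add (((he.const_mul 2).mul t1).mul_const (β1 θ))).add
        (((he.pow 2).mul t2).mul_const (β θ))).mul_const (G θ))
    simpa using this

section HilbertFourier

variable {H : Type*} [NormedAddCommGroup H] [InnerProductSpace ℂ H]

lemma SchwartzMap.integrable_smul_of_memLp {Φ : ℝ → H} (hΦ : MemLp Φ 2) (g : 𝓢(ℝ, ℂ)) :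
    Integrable fun θ => g θ • Φ θ :=
  memLp_one_iff_integrable.1 (hΦ.smul (p := 2) (q := 2) (r := 1) (g.memLp 2))

variable [CompleteSpace H]

lemma integral_fourier_smul_eq (Ψ : Lp H 2 (volume : Measure ℝ)) (g : 𝓢(ℝ, ℂ)) :
    ∫ θ, (𝓕 g) θ • Ψ θ = ∫ η, g η • (𝓕 Ψ : Lp H 2 (volume : Measure ℝ)) η := by
  rw [← Lp.toTemperedDistribution_apply, ← Lp.toTemperedDistribution_apply,
    ← Lp.fourier_toTemperedDistribution_eq, TemperedDistribution.fourier_apply]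

lemma integral_smul_eq_fourierInv (Ψ : Lp H 2 (volume : Measure ℝ)) (g : 𝓢(ℝ, ℂ)) :
    ∫ θ, g θ • Ψ θ = ∫ η, (𝓕⁻ g) η • (𝓕 Ψ : Lp H 2 (volume : Measure ℝ)) η := by
  rw [← integral_fourier_smul_eq, FourierTransform.fourier_fourierInv_eq]

lemma SchwartzMap.integral_mul_inner {Φ : ℝ → H} (hΦ : MemLp Φ 2) (g : 𝓢(ℝ, ℂ)) (A : H) :
    ∫ θ, g θ * inner ℂ A (Φ θ) = inner ℂ A (∫ θ, g θ • Φ θ) := by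
  rw [← integral_inner (g.integrable_smul_of_memLp hΦ)]
  simp only [inner_smul_right]

lemma deriv_deriv_fourier_eq {g : ℝ → ℂ} (hg : Continuous g) (hc : HasCompactSupport g) :
    deriv (deriv (𝓕 g)) = 𝓕 fun η => -(((2 * Real.pi * η) ^ 2 : ℝ) : ℂ) * g η := by
  have hs : Continuous fun η : ℝ => (-2 * ↑Real.pi * Complex.I * ↑η) • g η := by fun_prop
  have hc1 : HasCompactSupport fun η : ℝ => (-2 * ↑Real.pi * Complex.I * ↑η) • g η :=
    HasCompactSupport.mul_left hc
  have hi : ∀ f : ℝ → ℂ, Continuous f → HasCompactSupport f → Integrable fun x => x • f x :=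
    fun f hf hfc => (continuous_id.smul hf).integrable_of_hasCompactSupport hfc.smul_left
  rw [Real.deriv_fourier (hg.integrable_of_hasCompactSupport hc) (hi _ hg hc),
    Real.deriv_fourier (hs.integrable_of_hasCompactSupport hc1) (hi _ hs hc1)]
  congr 1
  ext η
  simp only [smul_eq_mul]
  push_cast
  linear_combination (4 * (Real.pi : ℂ) ^ 2 * η ^ 2 * g η) * Complex.I_sq

lemma SchwartzMap.exists_deriv_deriv_fourier {g : ℝ → ℂ} (hg : ContDiff ℝ ∞ g)
    (hc : HasCompactSupport g) : ∃ g₀ g₂ : 𝓢(ℝ, ℂ), (∀ η, g₀ η = g η) ∧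
      (∀ η, g₂ η = -((2 * Real.pi * η) ^ 2 : ℝ) * g η) ∧
        deriv (deriv ⇑(𝓕 g₀ : 𝓢(ℝ, ℂ))) = ⇑(𝓕 g₂ : 𝓢(ℝ, ℂ)) := by
  have hs : ContDiff ℝ ∞ fun η : ℝ => -(((2 * Real.pi * η) ^ 2 : ℝ) : ℂ) * g η :=
    (Complex.ofRealCLM.contDiff.comp ((contDiff_const.mul contDiff_id).pow 2)).neg.mul hg
  have hc2 : HasCompactSupport fun η : ℝ => -(((2 * Real.pi * η) ^ 2 : ℝ) : ℂ) * g η :=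
    hc.mul_left
  have e0 : ⇑(hc.toSchwartzMap hg) = g := rfl
  have e2 : ⇑(hc2.toSchwartzMap hs) =
    fun η : ℝ => -(((2 * Real.pi * η) ^ 2 : ℝ) : ℂ) * g η := rfl
  refine ⟨hc.toSchwartzMap hg, hc2.toSchwartzMap hs, congrFun e0, congrFun e2, ?_⟩
  rw [SchwartzMap.fourier_coe, SchwartzMap.fourier_coe, e0, e2,
    deriv_deriv_fourier_eq hg.continuous hc]

/-- On the Fourier side a weak equation `⟪A, Ψ⟫ + ⟪B, Ψ⟫'' = 0` becomes algebraic. -/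
lemma ae_inner_fourier_eq {Ψ : Lp H 2 (volume : Measure ℝ)} {A B : H}
    (h : ∀ β : ℝ → ℂ, ContDiff ℝ ∞ β → HasCompactSupport β →
      ∫ θ, (β θ * inner ℂ A (Ψ θ) + deriv (deriv β) θ * inner ℂ B (Ψ θ)) = 0) :
    ∀ᵐ η, inner ℂ A ((𝓕 Ψ : Lp H 2 (volume : Measure ℝ)) η) =
      ((2 * Real.pi * η) ^ 2 : ℝ) * inner ℂ B ((𝓕 Ψ : Lp H 2 (volume : Measure ℝ)) η) := by
  set Φ : Lp H 2 (volume : Measure ℝ) := 𝓕 Ψ with hΦ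
  have hA := (Lp.memLp Φ).const_inner (𝕜 := ℂ) A
  have hB := (Lp.memLp Φ).const_inner (𝕜 := ℂ) B
  have hloc : LocallyIntegrable fun η : ℝ => inner ℂ A (Φ η) -
      ((2 * Real.pi * η) ^ 2 : ℝ) * inner ℂ B (Φ η) := by
    have h1 := hA.locallyIntegrable one_le_two
    have h2 := (hB.locallyIntegrable one_le_two)
    have h3 := (locallyIntegrableOn_univ.2 h2).continuousOn_mul
      (g := fun η : ℝ => (((2 * Real.pi * η) ^ 2 : ℝ) : ℂ)) (by fun_prop)
      isClosed_univ.isLocallyClosed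
    exact h1.sub (locallyIntegrableOn_univ.1 h3)
  have := ae_eq_zero_of_integral_contDiff_smul_eq_zero hloc fun g hg hc => by
    obtain ⟨g₀, g₂, h0, h2, hd⟩ := SchwartzMap.exists_deriv_deriv_fourier
      (Complex.ofRealCLM.contDiff.comp hg) (hc.comp_left Complex.ofReal_zero)
    have key := integral_schwartz_eq_zero_of_integral_test_eq_zero
      ((Lp.memLp Ψ).const_inner A) ((Lp.memLp Ψ).const_inner B) h (𝓕 g₀)
    rw [hd, integral_add (SchwartzMap.integrable_mul_of_memLp ((Lp.memLp Ψ).const_inner A) _)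
      (SchwartzMap.integrable_mul_of_memLp ((Lp.memLp Ψ).const_inner B) _),
      SchwartzMap.integral_mul_inner (Lp.memLp Ψ), SchwartzMap.integral_mul_inner (Lp.memLp Ψ),
      integral_fourier_smul_eq, integral_fourier_smul_eq, ← hΦ,
      ← SchwartzMap.integral_mul_inner (Lp.memLp Φ), ← SchwartzMap.integral_mul_inner (Lp.memLp Φ),
      ← integral_add (SchwartzMap.integrable_mul_of_memLp hA _)
        (SchwartzMap.integrable_mul_of_memLp hB _)] at key
    rw [← key]
    refine integral_congr_ae (Eventually.of_forall fun η => ?_)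
    simp only [h0, h2, Function.comp_apply, Complex.real_smul, Complex.ofRealCLM_apply]
    ring
  filter_upwards [this] with η hη
  exact sub_eq_zero.1 hη

end HilbertFourier

/-- A continuous condition that holds almost everywhere for each parameter in a subset of a second
countable space holds almost everywhere for all parameters simultaneously. -/
lemma ae_forall_of_forall_ae {α E F : Type*} [MeasurableSpace α] {μ : Measure α}
    [TopologicalSpace E] [TopologicalSpace.PseudoMetrizableSpace E] [SecondCountableTopology E]
    [TopologicalSpace F] [T2Space F] {s : Set E}
    {u v : α → E → F} (hu : ∀ a, Continuous (u a)) (hv : ∀ a, Continuous (v a))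
    (h : ∀ x ∈ s, ∀ᵐ a ∂μ, u a x = v a x) : ∀ᵐ a ∂μ, ∀ x ∈ s, u a x = v a x := by
  obtain ⟨t, hts, htc, hst⟩ :=
    (TopologicalSpace.IsSeparable.of_separableSpace s).exists_countable_dense_subset
  have := (ae_ball_iff htc).2 fun x hx => h x (hts hx)
  filter_upwards [this] with a ha x hx
  exact (isClosed_eq (hu a) (hv a)).closure_subset_iff.2 ha (hst hx)

namespace IsRadialTest

variable {α : ℝ → ℝ}

lemma isLogTest_mul (hα : IsRadialTest α) {b : ℝ → ℂ} (hb : ContDiff ℝ ∞ b)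
    (hc : HasCompactSupport b) : IsLogTest fun p => (α p.1 : ℂ) * b p.2 := by
  have hz : ∀ p : ℝ × ℝ, p ∉ tsupport α ×ˢ tsupport b → (α p.1 : ℂ) * b p.2 = 0 := by
    intro p hp
    by_cases h1 : p.1 ∈ tsupport α
    · have h2 : p.2 ∉ tsupport b := fun h => hp ⟨h1, h⟩
      rw [image_eq_zero_of_notMem_tsupport h2, mul_zero]
    · rw [image_eq_zero_of_notMem_tsupport h1, Complex.ofReal_zero, zero_mul]
  refine ⟨?_, HasCompactSupport.intro (hα.2.1.isCompact.prod hc.isCompact) hz, ?_⟩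
  · exact (Complex.ofRealCLM.contDiff.comp (hα.1.comp contDiff_fst)).mul (hb.comp contDiff_snd)
  · refine (closure_minimal (fun p hp => ?_) ((isClosed_tsupport _).prod (isClosed_tsupport _))).trans
      (prod_mono hα.2.2 (subset_univ (tsupport b)))
    exact not_imp_comm.1 (hz p) hp

lemma pdr_mul (hα : IsRadialTest α) {b : ℝ → ℂ} (hb : ContDiff ℝ ∞ b) (hc : HasCompactSupport b) :
    pdr (fun p => (α p.1 : ℂ) * b p.2) = fun p => ((_root_.deriv α p.1 : ℝ) : ℂ) * b p.2 :=
  funext fun p => ((hα.isLogTest_mul hb hc).hasDerivAt_left p).unique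
    ((hα.differentiable p.1).hasDerivAt.ofReal_comp.mul_const (b p.2))

lemma pdθ_mul (hα : IsRadialTest α) {b : ℝ → ℂ} (hb : ContDiff ℝ ∞ b) (hc : HasCompactSupport b) :
    pdθ (fun p => (α p.1 : ℂ) * b p.2) = fun p => (α p.1 : ℂ) * _root_.deriv b p.2 :=
  funext fun p => ((hα.isLogTest_mul hb hc).hasDerivAt_right p).unique
    ((hb.differentiable (by simp) p.2).hasDerivAt.const_mul (α p.1 : ℂ))

lemma polarLap_mul (hα : IsRadialTest α) {b : ℝ → ℂ} (hb : ContDiff ℝ ∞ b)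
    (hc : HasCompactSupport b) (p : ℝ × ℝ) :
    polarLap (fun p => (α p.1 : ℂ) * b p.2) p =
      ((_root_.deriv (_root_.deriv α) p.1 + 1 / p.1 * _root_.deriv α p.1 : ℝ) : ℂ) * b p.2 +
        ((1 / p.1 ^ 2 * α p.1 : ℝ) : ℂ) * _root_.deriv (_root_.deriv b) p.2 := by
  have hb1 : ContDiff ℝ ∞ (_root_.deriv b) := (contDiff_infty_iff_deriv.1 hb).2
  rw [polarLap, hα.pdr_mul hb hc, hα.deriv.pdr_mul hb hc, hα.pdθ_mul hb hc,
    hα.pdθ_mul hb1 hc.deriv]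
  push_cast
  ring

lemma radial_part (hα : IsRadialTest α) : IsRadialTest fun r =>
    _root_.deriv (_root_.deriv α) r + 1 / r * _root_.deriv α r - α r :=
  (hα.deriv.deriv.add (hα.deriv.mul_left (contDiffOn_const.div contDiffOn_id
    fun _ hr => (mem_Ioi.1 hr).ne'))).sub hα

lemma angular_part (hα : IsRadialTest α) : IsRadialTest fun r => 1 / r ^ 2 * α r :=
  hα.mul_left (contDiffOn_const.div (contDiffOn_id.pow 2)
    fun _ hr => pow_ne_zero 2 (mem_Ioi.1 hr).ne')

lemma memLp (hα : IsRadialTest α) : MemLp (fun r => (α r : ℂ)) 2 radialMeasure := by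
  have hc : Continuous fun r => (α r : ℂ) := Complex.continuous_ofReal.comp hα.continuous
  rw [memLp_two_iff_integrable_sq_norm hc.aestronglyMeasurable, integrable_radialMeasure_iff]
  refine (Continuous.integrable_of_hasCompactSupport (by fun_prop) ?_).integrableOn
  exact hα.2.1.mono fun r hr h0 => hr (by simp [h0])

/-- A radial test function as an element of `L²(r dr)`. -/
noncomputable def toLp (hα : IsRadialTest α) : Lp ℂ 2 radialMeasure := hα.memLp.toLp _

lemma inner_toLp (hα : IsRadialTest α) (f : Lp ℂ 2 radialMeasure) :
    inner ℂ hα.toLp f = ∫ r, (α r : ℂ) * f r ∂radialMeasure := by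
  rw [L2.inner_def]
  refine integral_congr_ae ?_
  filter_upwards [hα.memLp.coeFn_toLp] with r hr
  rw [toLp, hr]
  simp [mul_comm]

end IsRadialTest

lemma integrable_mul_isLogTest {ψ : ℝ × ℝ → ℂ} (hψ : MemLp ψ 2 polarMeasure) {v : ℝ × ℝ → ℂ}
    (hv : IsLogTest v) : Integrable (fun p => ψ p * v p) polarMeasure := by
  have h : MemLp v 2 polarMeasure := by
    rw [memLp_two_iff_integrable_sq_norm hv.continuous.aestronglyMeasurable]
    have h1 := integrable_polarMeasure (f := fun p => ((‖v p‖ ^ 2 : ℝ) : ℂ))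
      (by have := hv.continuous; fun_prop)
      (hv.2.1.mono fun r hr h0 => hr (by simp [h0]))
    exact h1.re
  exact MemLp.integrable_mul (p := 2) (q := 2) hψ h

/-- Pairing with a product test function, one variable at a time. -/
lemma integral_mul_isRadialTest_mul {ψ : ℝ × ℝ → ℂ} (hψ : MemLp ψ 2 polarMeasure)
    {Ψ : ℝ → Lp ℂ 2 radialMeasure} (hΨ : ∀ᵐ θ, Ψ θ =ᵐ[radialMeasure] fun r => ψ (r, θ))
    {α : ℝ → ℝ} (hα : IsRadialTest α) {b : ℝ → ℂ} (hb : ContDiff ℝ ∞ b)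
    (hc : HasCompactSupport b) :
    ∫ p, ψ p * ((α p.1 : ℂ) * b p.2) ∂polarMeasure = ∫ θ, b θ * inner ℂ hα.toLp (Ψ θ) := by
  have hi := integrable_mul_isLogTest hψ (hα.isLogTest_mul hb hc)
  rw [polarMeasure_eq_prod] at hi ⊢
  rw [integral_prod_symm _ hi]
  refine integral_congr_ae ?_
  filter_upwards [hΨ] with θ hθ
  rw [hα.inner_toLp, ← integral_const_mul]
  refine integral_congr_ae ?_
  filter_upwards [hθ] with r hr
  rw [hr]
  ring

lemma integral_test_eq_zero_of_weak_solution {ψ : ℝ × ℝ → ℂ} (hψ : MemLp ψ 2 polarMeasure)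
    (hw : ∀ φ, IsLogTest φ →
      ∫ p, ψ p * (starRingEnd ℂ) (polarLap φ p - φ p) ∂polarMeasure = 0)
    {Ψ : ℝ → Lp ℂ 2 radialMeasure} (hΨ2 : MemLp Ψ 2)
    (hΨ : ∀ᵐ θ, Ψ θ =ᵐ[radialMeasure] fun r => ψ (r, θ))
    {α : ℝ → ℝ} (hα : IsRadialTest α) {β : ℝ → ℂ} (hβ : ContDiff ℝ ∞ β)
    (hc : HasCompactSupport β) :
    ∫ θ, (β θ * inner ℂ hα.radial_part.toLp (Ψ θ) +
      deriv (deriv β) θ * inner ℂ hα.angular_part.toLp (Ψ θ)) = 0 := by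
  have hβ2 : ContDiff ℝ ∞ (deriv (deriv β)) :=
    (contDiff_infty_iff_deriv.1 (contDiff_infty_iff_deriv.1 hβ).2).2
  have hb : ContDiff ℝ ∞ fun θ => (starRingEnd ℂ) (β θ) := Complex.conjCLE.contDiff.comp hβ
  have hbc : HasCompactSupport fun θ => (starRingEnd ℂ) (β θ) := hc.comp_left (map_zero _)
  have hbd : ∀ {f : ℝ → ℂ}, Differentiable ℝ f →
      deriv (fun θ => (starRingEnd ℂ) (f θ)) = fun θ => (starRingEnd ℂ) (deriv f θ) :=
    fun hf => funext fun θ => (Complex.conjCLE.hasFDerivAt.comp_hasDerivAt θ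
      (hf θ).hasDerivAt).deriv
  have h0 := hw _ (hα.isLogTest_mul hb hbc)
  have hsplit : ∀ p, ψ p * (starRingEnd ℂ) (polarLap (fun p => (α p.1 : ℂ) *
      (starRingEnd ℂ) (β p.2)) p - (α p.1 : ℂ) * (starRingEnd ℂ) (β p.2)) =
      ψ p * (((deriv (deriv α) p.1 + 1 / p.1 * deriv α p.1 - α p.1 : ℝ) : ℂ) * β p.2) +
        ψ p * (((1 / p.1 ^ 2 * α p.1 : ℝ) : ℂ) * deriv (deriv β) p.2) := by
    intro p
    rw [hα.polarLap_mul hb hbc, hbd (hβ.differentiable (by simp)),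
      hbd ((contDiff_infty_iff_deriv.1 hβ).2.differentiable (by simp))]
    simp only [map_sub, map_add, map_mul, Complex.conj_conj, Complex.conj_ofReal]
    push_cast
    ring
  simp only [hsplit] at h0
  rw [integral_add (integrable_mul_isLogTest hψ (hα.radial_part.isLogTest_mul hβ hc))
    (integrable_mul_isLogTest hψ (hα.angular_part.isLogTest_mul hβ2 hc.deriv.deriv)),
    integral_mul_isRadialTest_mul hψ hΨ hα.radial_part hβ hc,
    integral_mul_isRadialTest_mul hψ hΨ hα.angular_part hβ2 hc.deriv.deriv] at h0
  rw [integral_add, h0]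
  · exact SchwartzMap.integrable_mul_of_memLp (hΨ2.const_inner _) (hc.toSchwartzMap hβ)
  · exact SchwartzMap.integrable_mul_of_memLp (hΨ2.const_inner _)
      (hc.deriv.deriv.toSchwartzMap hβ2)

section HilbertFourier

variable {H : Type*} [NormedAddCommGroup H] [InnerProductSpace ℂ H]

lemma flip_neg_innerₗ_real : (-innerₗ ℝ).flip = -innerₗ ℝ := by
  ext
  simp

lemma continuous_fourierInv {g : ℝ → H} (hg : Integrable g) : Continuous (𝓕⁻ g) :=
  VectorFourier.fourierIntegral_continuous (L := -innerₗ ℝ) (μ := volume)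
    Real.continuous_fourierChar (continuous_inner (𝕜 := ℝ) (E := ℝ)).neg hg

variable [CompleteSpace H]

lemma integral_fourierInv_smul_eq {f : ℝ → ℂ} {g : ℝ → H} (hf : Integrable f)
    (hg : Integrable g) : ∫ x, 𝓕⁻ f x • g x = ∫ x, f x • 𝓕⁻ g x := by
  have h := VectorFourier.integral_fourierIntegral_smul_eq_flip (L := -innerₗ ℝ) (μ := volume)
    (ν := volume) Real.continuous_fourierChar
    (continuous_inner (𝕜 := ℝ) (E := ℝ)).neg hf hg
  rw [flip_neg_innerₗ_real] at h
  exact h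

/-- Fourier inversion for square integrable functions with integrable Fourier transform. -/
lemma ae_eq_fourierInv {Ψ : Lp H 2 (volume : Measure ℝ)}
    (hi : Integrable (𝓕 Ψ : Lp H 2 (volume : Measure ℝ))) :
    ∀ᵐ θ, Ψ θ = 𝓕⁻ ((𝓕 Ψ : Lp H 2 (volume : Measure ℝ)) : ℝ → H) θ := by
  have hc := continuous_fourierInv hi
  have := ae_eq_zero_of_integral_contDiff_smul_eq_zero
    (((Lp.memLp Ψ).locallyIntegrable one_le_two).sub hc.locallyIntegrable) fun g hg hgc => by
      have hs : ContDiff ℝ ∞ fun x => (g x : ℂ) := Complex.ofRealCLM.contDiff.comp hg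
      have hsc : HasCompactSupport fun x => (g x : ℂ) := hgc.comp_left Complex.ofReal_zero
      have h1 := integral_smul_eq_fourierInv Ψ (hsc.toSchwartzMap hs)
      rw [SchwartzMap.fourierInv_coe, integral_fourierInv_smul_eq (SchwartzMap.integrable _) hi]
        at h1
      have h2 := (hsc.toSchwartzMap hs).integrable_smul_of_memLp (Lp.memLp Ψ)
      have h3 : Integrable fun x => (hsc.toSchwartzMap hs) x •
          𝓕⁻ ((𝓕 Ψ : Lp H 2 (volume : Measure ℝ)) : ℝ → H) x :=
        (hs.continuous.smul hc).integrable_of_hasCompactSupport hsc.smul_right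
      rw [← sub_eq_zero, ← integral_sub h2 h3] at h1
      rw [← h1]
      refine integral_congr_ae (Eventually.of_forall fun x => ?_)
      simp only [Pi.sub_apply]
      rw [← smul_sub]
      exact (Complex.coe_smul (g x) _).symm
  filter_upwards [this] with θ hθ using sub_eq_zero.1 hθ

lemma ae_forall_inner_fourier_eq [SecondCountableTopology H]
    {Ψ : Lp H 2 (volume : Measure ℝ)} {ι : Type*} {A B : ι → H}
    (h : ∀ i, ∀ β : ℝ → ℂ, ContDiff ℝ ∞ β → HasCompactSupport β →
      ∫ θ, (β θ * inner ℂ (A i) (Ψ θ) + deriv (deriv β) θ * inner ℂ (B i) (Ψ θ)) = 0) :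
    ∀ᵐ η, ∀ i, inner ℂ (A i) ((𝓕 Ψ : Lp H 2 (volume : Measure ℝ)) η) =
      ((2 * Real.pi * η) ^ 2 : ℝ) * inner ℂ (B i) ((𝓕 Ψ : Lp H 2 (volume : Measure ℝ)) η) := by
  have := ae_forall_of_forall_ae (μ := volume) (s := range fun i => (A i, B i))
    (u := fun (η : ℝ) x => inner ℂ x.1 ((𝓕 Ψ : Lp H 2 (volume : Measure ℝ)) η))
    (v := fun (η : ℝ) x => ((2 * Real.pi * η) ^ 2 : ℝ) *
      inner ℂ x.2 ((𝓕 Ψ : Lp H 2 (volume : Measure ℝ)) η))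
    (fun η => continuous_fst.inner continuous_const)
    (fun η => continuous_const.mul (continuous_snd.inner continuous_const)) (by
      rintro _ ⟨i, rfl⟩
      exact ae_inner_fourier_eq (h i))
  filter_upwards [this] with η hη i using hη _ ⟨i, rfl⟩

end HilbertFourier

instance secondCountableTopology_Lp_radialMeasure :
    SecondCountableTopology (Lp ℂ 2 radialMeasure) :=
  haveI : Fact ((2 : ENNReal) ≠ ⊤) := ⟨ENNReal.ofNat_ne_top⟩
  Lp.SecondCountableTopology

/-- The partial Fourier transform of a square integrable weak solution of `Δψ = ψ` takes values in
the square integrable solutions of Bessel's equation. -/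
lemma ae_fourier_eq_const_mul_besselK {ψ : ℝ × ℝ → ℂ} (hψ : MemLp ψ 2 polarMeasure)
    (hw : ∀ φ, IsLogTest φ →
      ∫ p, ψ p * (starRingEnd ℂ) (polarLap φ p - φ p) ∂polarMeasure = 0)
    {Ψ : Lp (Lp ℂ 2 radialMeasure) 2 (volume : Measure ℝ)}
    (hΨ : ∀ᵐ θ, Ψ θ =ᵐ[radialMeasure] fun r => ψ (r, θ)) :
    ∀ᵐ η, ∃ c : ℂ, ((𝓕 Ψ : Lp (Lp ℂ 2 radialMeasure) 2 (volume : Measure ℝ)) η =ᵐ[radialMeasure]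
        fun r => c * besselK (2 * Real.pi * η) r) ∧ (1 ≤ |2 * Real.pi * η| → c = 0) ∧
      (|2 * Real.pi * η| < 1 →
        ‖c‖ ^ 2 * ((Real.exp (-Real.exp 1) / 2) ^ 2 / (2 * (1 - |2 * Real.pi * η|))) ≤
          ‖(𝓕 Ψ : Lp (Lp ℂ 2 radialMeasure) 2 (volume : Measure ℝ)) η‖ ^ 2) := by
  have hs := ae_forall_inner_fourier_eq (Ψ := Ψ)
    (A := fun α : {α // IsRadialTest α} => α.2.radial_part.toLp)
    (B := fun α => α.2.angular_part.toLp) fun α β hβ hc =>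
      integral_test_eq_zero_of_weak_solution hψ hw (Lp.memLp Ψ) hΨ α.2 hβ hc
  generalize (𝓕 Ψ : Lp (Lp ℂ 2 radialMeasure) 2 (volume : Measure ℝ)) = Φ at hs ⊢
  filter_upwards [hs] with η hη
  have hsq : IntegrableOn (fun r => r * ‖Φ η r‖ ^ 2) (Ioi 0) := integrable_radialMeasure_iff.1
    ((memLp_two_iff_integrable_sq_norm (Lp.memLp (Φ η)).aestronglyMeasurable).1 (Lp.memLp (Φ η)))
  have hm : AEStronglyMeasurable (Φ η) (volume.restrict (Ioi 0)) :=
    (Lp.stronglyMeasurable (Φ η)).aestronglyMeasurable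
  obtain ⟨c, h1, h2, h3⟩ := exists_eq_const_mul_besselK (ν := 2 * Real.pi * η) hm hsq
    fun α hα => by
      have hi : ∀ {γ : ℝ → ℝ}, IsRadialTest γ →
          Integrable (fun r => (γ r : ℂ) * Φ η r) radialMeasure := fun hγ =>
        MemLp.integrable_mul (p := 2) (q := 2) hγ.memLp (Lp.memLp _)
      have h := hη ⟨α, hα⟩
      simp only [IsRadialTest.inner_toLp] at h
      rw [← integral_const_mul, ← sub_eq_zero, ← integral_sub (hi hα.radial_part)
        ((hi hα.angular_part).const_mul _), integral_radialMeasure] at h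
      rw [← h, ← setIntegral_eq_integral_of_forall_compl_eq_zero (s := Ioi (0 : ℝ))]
      · refine setIntegral_congr_fun measurableSet_Ioi fun r hr => ?_
        have hr0 : (r : ℂ) ≠ 0 := Complex.ofReal_ne_zero.2 (mem_Ioi.1 hr).ne'
        simp only [besselOp, Complex.real_smul]
        push_cast
        field_simp
      · intro r hr
        have hr0 := not_lt.1 (mem_Ioi.not.1 hr)
        simp [besselOp, hα.apply_eq_zero hr0, hα.deriv.apply_eq_zero hr0,
          hα.deriv.deriv.apply_eq_zero hr0]
  refine ⟨c, ae_radialMeasure_iff.2 h1, h2, fun hν => (h3 hν).trans_eq ?_⟩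
  rw [norm_sq_eq_integral, integral_radialMeasure]
  rfl

lemma IsRadialTest.exists_pos_le {α : ℝ → ℝ} (hα : IsRadialTest α) :
    ∃ a > 0, ∀ r < a, α r = 0 := by
  rcases (tsupport α).eq_empty_or_nonempty with he | hne
  · exact ⟨1, one_pos, fun r _ => image_eq_zero_of_notMem_tsupport (by simp [he])⟩
  · obtain ⟨a, ha, hmin⟩ := hα.2.1.isCompact.exists_isLeast hne
    exact ⟨a, hα.2.2 ha, fun r hr => image_eq_zero_of_notMem_tsupport fun h => (hmin h).not_gt hr⟩

lemma stronglyMeasurable_superposition {g : ℝ → ℂ} (hg : Measurable g) :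
    StronglyMeasurable fun p : ℝ × ℝ => ∫ ξ in Ioo (-1 : ℝ) 1,
      g ξ * (besselK ξ p.1 : ℂ) * Complex.exp (Complex.I * ξ * p.2) := by
  refine StronglyMeasurable.integral_prod_right' (f := fun q : (ℝ × ℝ) × ℝ =>
    g q.2 * (besselK q.2 q.1.1 : ℂ) * Complex.exp (Complex.I * q.2 * q.1.2)) ?_
  have h1 : Measurable fun q : (ℝ × ℝ) × ℝ => besselK q.2 q.1.1 :=
    measurable_besselK_uncurry.comp (by fun_prop : Measurable fun q : (ℝ × ℝ) × ℝ => (q.2, q.1.1))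
  have h2 : Measurable fun q : (ℝ × ℝ) × ℝ =>
    Complex.exp (Complex.I * q.2 * q.1.2) := by fun_prop
  exact (((hg.comp measurable_snd).mul
    (Complex.measurable_ofReal.comp h1)).mul h2).stronglyMeasurable

lemma norm_mul_besselK_mul_exp_le {a r : ℝ} (ha : 0 < a) (har : a ≤ r) {ξ : ℝ}
    (hξ : ξ ∈ Ioo (-1 : ℝ) 1) (z : ℂ) (θ : ℝ) :
    ‖z * (besselK ξ r : ℂ) * Complex.exp (Complex.I * ξ * θ)‖ ≤ besselK 1 a * ‖z‖ := by
  have h1 : ‖Complex.exp (Complex.I * ξ * θ)‖ = 1 := by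
    rw [Complex.norm_exp]
    simp
  rw [norm_mul, norm_mul, h1, mul_one, mul_comm, Complex.norm_real, Real.norm_eq_abs,
    abs_of_pos (besselK_pos _ (ha.trans_le har))]
  gcongr
  exact besselK_le_of_abs_le_one (abs_lt.2 hξ).le ha har

lemma locallyIntegrableOn_superposition {g : ℝ → ℂ} (hg : Measurable g)
    (hi : IntegrableOn g (Ioo (-1) 1)) (θ : ℝ) :
    LocallyIntegrableOn (fun r : ℝ => ∫ ξ in Ioo (-1 : ℝ) 1,
      g ξ * (besselK ξ r : ℂ) * Complex.exp (Complex.I * ξ * θ)) (Ioi 0) := by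
  rw [locallyIntegrableOn_iff isOpen_Ioi.isLocallyClosed]
  intro K hK hKc
  rcases K.eq_empty_or_nonempty with rfl | hne
  · simp
  obtain ⟨a, haK, hmin⟩ := hKc.exists_isLeast hne
  have ha : 0 < a := hK haK
  refine Measure.integrableOn_of_bounded (M := ∫ ξ in Ioo (-1 : ℝ) 1, besselK 1 a * ‖g ξ‖)
    hKc.measure_lt_top.ne ?_ ?_
  · exact ((stronglyMeasurable_superposition hg).comp_measurable
      (measurable_prodMk_right (y := θ))).aestronglyMeasurable
  · filter_upwards [ae_restrict_mem hKc.measurableSet] with r hr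
    refine norm_integral_le_of_norm_le (hi.norm.const_mul _) ?_
    filter_upwards [ae_restrict_mem measurableSet_Ioo] with ξ hξ
    exact norm_mul_besselK_mul_exp_le ha (hmin hr) hξ _ _

lemma integral_isRadialTest_mul_superposition {g : ℝ → ℂ} (hg : Measurable g)
    (hi : IntegrableOn g (Ioo (-1) 1)) (θ : ℝ) {α : ℝ → ℝ} (hα : IsRadialTest α) :
    ∫ r, (α r : ℂ) * (∫ ξ in Ioo (-1 : ℝ) 1,
      g ξ * (besselK ξ r : ℂ) * Complex.exp (Complex.I * ξ * θ)) ∂radialMeasure =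
    ∫ ξ in Ioo (-1 : ℝ) 1, Complex.exp (Complex.I * ξ * θ) *
      ∫ r, (α r : ℂ) * (g ξ * (besselK ξ r : ℂ)) ∂radialMeasure := by
  obtain ⟨a, ha, hαa⟩ := hα.exists_pos_le
  have hαi : Integrable (fun r => (α r : ℂ)) radialMeasure := by
    rw [integrable_radialMeasure_iff]
    refine (Continuous.integrable_of_hasCompactSupport ?_ ?_).integrableOn
    · exact continuous_id.smul (Complex.continuous_ofReal.comp hα.continuous)
    · exact hα.2.1.mono fun r hr h0 => hr (by simp [h0])
  have hint : Integrable (Function.uncurry fun (r ξ : ℝ) =>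
      (α r : ℂ) * (g ξ * (besselK ξ r : ℂ) * Complex.exp (Complex.I * ξ * θ)))
      (radialMeasure.prod (volume.restrict (Ioo (-1) 1))) := by
    refine Integrable.mono' ((hαi.norm.mul_prod hi.norm).const_mul (besselK 1 a)) ?_ ?_
    · have h1 : Measurable fun q : ℝ × ℝ => besselK q.2 q.1 :=
        measurable_besselK_uncurry.comp measurable_swap
      have h2 : Measurable fun q : ℝ × ℝ => Complex.exp (Complex.I * q.2 * θ) := by fun_prop
      have h3 : Measurable fun q : ℝ × ℝ => (α q.1 : ℂ) :=
        Complex.measurable_ofReal.comp (hα.continuous.measurable.comp measurable_fst)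
      exact (h3.mul (((hg.comp measurable_snd).mul
        (Complex.measurable_ofReal.comp h1)).mul h2)).aestronglyMeasurable
    · have hae : ∀ᵐ q : ℝ × ℝ ∂(radialMeasure.prod (volume.restrict (Ioo (-1) 1))),
          q.2 ∈ Ioo (-1 : ℝ) 1 :=
        Measure.quasiMeasurePreserving_snd.ae (ae_restrict_mem measurableSet_Ioo)
      filter_upwards [hae] with q hq
      simp only [Function.uncurry]
      rcases lt_or_ge q.1 a with h | h
      · rw [hαa _ h]
        simp
      rw [norm_mul]
      calc _ ≤ ‖(α q.1 : ℂ)‖ * (besselK 1 a * ‖g q.2‖) := by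
            gcongr
            exact norm_mul_besselK_mul_exp_le ha h hq _ _
        _ = _ := by ring
  simp only [← integral_const_mul]
  rw [integral_integral_swap hint]
  refine integral_congr_ae (Eventually.of_forall fun ξ => integral_congr_ae
    (Eventually.of_forall fun r => ?_))
  ring

/-- Testing against radial test functions detects equality almost everywhere. -/
lemma ae_eq_of_integral_isRadialTest {u v : ℝ → ℂ} (hu : LocallyIntegrableOn u (Ioi 0))
    (hv : LocallyIntegrableOn v (Ioi 0))
    (h : ∀ α, IsRadialTest α →
      ∫ r, (α r : ℂ) * u r ∂radialMeasure = ∫ r, (α r : ℂ) * v r ∂radialMeasure) :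
    u =ᵐ[radialMeasure] v := by
  have h0 := (isOpen_Ioi (a := (0 : ℝ))).ae_eq_zero_of_integral_contDiff_smul_eq_zero
    (hu.sub hv) fun γ hγ hγc hγs => by
      have hγt : IsRadialTest γ := ⟨hγ, hγc, hγs⟩
      have hα := hγt.mul_left (g := fun r : ℝ => 1 / r)
        (contDiffOn_const.div contDiffOn_id fun _ hr => (mem_Ioi.1 hr).ne')
      have h1 := h _ hα
      have hset : ∀ w : ℝ → ℂ, ∫ r, ((1 / r * γ r : ℝ) : ℂ) * w r ∂radialMeasure =
          ∫ r, γ r • w r := by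
        intro w
        rw [integral_radialMeasure, ← setIntegral_eq_integral_of_forall_compl_eq_zero
          (s := Ioi (0 : ℝ)) (f := fun r => γ r • w r)]
        · refine setIntegral_congr_fun measurableSet_Ioi fun r hr => ?_
          have hr0 : (r : ℂ) ≠ 0 := Complex.ofReal_ne_zero.2 (mem_Ioi.1 hr).ne'
          simp only [Complex.real_smul]
          push_cast
          field_simp
        · intro r hr
          rw [hγt.apply_eq_zero (not_lt.1 (mem_Ioi.not.1 hr)), zero_smul]
      rw [hset, hset, ← sub_eq_zero, ← integral_sub (hγt.integrable_smul hu)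
        (hγt.integrable_smul hv)] at h1
      rw [← h1]
      simp only [Pi.sub_apply, smul_sub]
  rw [EventuallyEq, ae_radialMeasure_iff]
  filter_upwards [h0] with r hr hr0 using sub_eq_zero.1 (hr hr0)

lemma locallyIntegrableOn_of_memLp_radialMeasure (f : Lp ℂ 2 radialMeasure) :
    LocallyIntegrableOn f (Ioi 0) := by
  refine locallyIntegrableOn_of_integrableOn_mul_sq
    (Lp.stronglyMeasurable f).aestronglyMeasurable ?_
  exact integrable_radialMeasure_iff.1
    ((memLp_two_iff_integrable_sq_norm (Lp.memLp f).aestronglyMeasurable).1 (Lp.memLp f))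

lemma inner_fourierInv {H : Type*} [NormedAddCommGroup H] [InnerProductSpace ℂ H]
    [CompleteSpace H] {Φ : ℝ → H} (hΦ : Integrable Φ) (x : H) (θ : ℝ) :
    inner ℂ x (𝓕⁻ Φ θ) = ∫ η : ℝ, inner ℂ x
      (Complex.exp (((2 * Real.pi * inner ℝ η θ : ℝ) : ℂ) * Complex.I) • Φ η) := by
  have hm : Continuous fun η : ℝ =>
      Complex.exp (((2 * Real.pi * inner ℝ η θ : ℝ) : ℂ) * Complex.I) := by
    fun_prop
  have he : Integrable fun η : ℝ =>
      Complex.exp (((2 * Real.pi * inner ℝ η θ : ℝ) : ℂ) * Complex.I) • Φ η := by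
    refine hΦ.mono (hm.aestronglyMeasurable.smul hΦ.aestronglyMeasurable) ?_
    refine Eventually.of_forall fun η => ?_
    rw [norm_smul, Complex.norm_exp_ofReal_mul_I, one_mul]
  rw [Real.fourierInv_eq']
  exact ((innerSL ℂ x).integral_comp_comm he).symm

/-- The inverse Fourier transform of a field of multiples of Bessel functions, evaluated
pointwise. -/
lemma fourierInv_ae_eq_superposition {Φ : ℝ → Lp ℂ 2 radialMeasure} (hΦ : Integrable Φ)
    {g : ℝ → ℂ} (hg : Measurable g) (hi : IntegrableOn g (Ioo (-1) 1))
    (h : ∀ᵐ η, (2 * Real.pi * η ∈ Ioo (-1 : ℝ) 1 →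
        Φ η =ᵐ[radialMeasure] fun r => g (2 * Real.pi * η) * besselK (2 * Real.pi * η) r) ∧
      (2 * Real.pi * η ∉ Ioo (-1 : ℝ) 1 → Φ η = 0)) (θ : ℝ) :
    𝓕⁻ Φ θ =ᵐ[radialMeasure] fun r => ((1 / (2 * Real.pi) : ℝ) : ℂ) *
      ∫ ξ in Ioo (-1 : ℝ) 1, g ξ * (besselK ξ r : ℂ) * Complex.exp (Complex.I * ξ * θ) := by
  refine ae_eq_of_integral_isRadialTest (locallyIntegrableOn_of_memLp_radialMeasure _)
    ((locallyIntegrableOn_superposition hg hi θ).continuousOn_mul continuousOn_const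
      isOpen_Ioi.isLocallyClosed) fun α hα => ?_
  rw [← hα.inner_toLp, inner_fourierInv hΦ]
  let G : ℝ → ℂ := (Ioo (-1 : ℝ) 1).indicator fun ξ => Complex.exp (Complex.I * ξ * θ) *
      ∫ r, (α r : ℂ) * (g ξ * (besselK ξ r : ℂ)) ∂radialMeasure
  have hG : ∫ η, inner ℂ hα.toLp (Complex.exp (↑(2 * Real.pi * inner ℝ η θ) * Complex.I) • Φ η) =
      ∫ η, G (2 * Real.pi * η) := by
    refine integral_congr_ae ?_
    filter_upwards [h] with η hη
    rw [inner_smul_right]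
    by_cases hm : 2 * Real.pi * η ∈ Ioo (-1 : ℝ) 1
    · simp only [G, indicator_of_mem hm]
      congr 1
      · congr 1
        simp only [RCLike.inner_apply, conj_trivial]
        push_cast
        ring
      · rw [hα.inner_toLp]
        refine integral_congr_ae ?_
        filter_upwards [hη.1 hm] with r hr
        rw [hr]
    · simp only [G, indicator_of_notMem hm, hη.2 hm, inner_zero_right, mul_zero]
  rw [hG, Measure.integral_comp_mul_left, integral_indicator measurableSet_Ioo,
    ← integral_isRadialTest_mul_superposition hg hi θ hα, abs_of_pos (by positivity),
    Complex.real_smul, ← integral_const_mul]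
  refine integral_congr_ae (Eventually.of_forall fun r => ?_)
  simp only [one_div]
  ring

lemma radialMeasure_Icc_ne_top : radialMeasure (Icc 1 2) ≠ ⊤ := by
  have h : IntegrableOn (fun _ : ℝ => (1 : ℝ)) (Icc 1 2) radialMeasure := by
    rw [← integrable_indicator_iff measurableSet_Icc, integrable_radialMeasure_iff]
    have : IntegrableOn (fun r : ℝ => r) (Icc 1 2) := continuous_id.integrableOn_Icc
    refine (((integrable_indicator_iff measurableSet_Icc).2 this).integrableOn).congr_fun
      (fun r _ => ?_) measurableSet_Ioi
    by_cases hr : r ∈ Icc (1 : ℝ) 2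
    · simp [indicator_of_mem hr]
    · simp [indicator_of_notMem hr]
  exact (((integrableOn_const_iff (by simp)).1 h).resolve_left (by simp)).ne

/-- A local mean of `K_ν`, used to normalise multiples of `K_ν`. -/
noncomputable def meanBesselK (ν : ℝ) : ℝ := ∫ r in Icc 1 2, besselK ν r ∂radialMeasure

lemma measurable_meanBesselK : Measurable meanBesselK :=
  (StronglyMeasurable.integral_prod_right' (ν := radialMeasure.restrict (Icc 1 2))
    measurable_besselK_uncurry.stronglyMeasurable).measurable

lemma meanBesselK_pos (ν : ℝ) : 0 < meanBesselK ν := by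
  have h : meanBesselK ν = ∫ r in (1 : ℝ)..2, r * besselK ν r := by
    rw [meanBesselK, ← integral_indicator measurableSet_Icc, integral_radialMeasure,
      intervalIntegral.integral_of_le one_le_two, ← integral_Icc_eq_integral_Ioc,
      ← integral_indicator measurableSet_Icc, ← integral_indicator measurableSet_Ioi]
    congr 1
    ext r
    by_cases hr : r ∈ Icc (1 : ℝ) 2
    · have h0 : r ∈ Ioi (0 : ℝ) := zero_lt_one.trans_le hr.1
      simp [indicator_of_mem hr, indicator_of_mem h0]
    · rw [indicator_of_notMem hr]
      exact indicator_apply_eq_zero.2 fun _ => by rw [indicator_of_notMem hr, smul_zero]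
  rw [h]
  refine intervalIntegral.intervalIntegral_pos_of_pos_on ?_ (fun r hr => ?_) one_lt_two
  · refine ContinuousOn.intervalIntegrable (continuousOn_id.mul
      ((continuousOn_besselK ν).mono fun r hr => ?_))
    rw [uIcc_of_le one_le_two] at hr
    exact zero_lt_one.trans_le hr.1
  · have h0 : 0 < r := zero_lt_one.trans hr.1
    exact mul_pos h0 (besselK_pos ν h0)

/-- The amplitude of a function that is a multiple of `K_ν`. -/
noncomputable def besselAmplitude (ν : ℝ) (f : Lp ℂ 2 radialMeasure) : ℂ :=
  inner ℂ (indicatorConstLp 2 measurableSet_Icc radialMeasure_Icc_ne_top (1 : ℂ)) f /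
    meanBesselK ν

lemma besselAmplitude_eq {ν : ℝ} {f : Lp ℂ 2 radialMeasure} {c : ℂ}
    (h : f =ᵐ[radialMeasure] fun r => c * besselK ν r) : besselAmplitude ν f = c := by
  rw [besselAmplitude, L2.inner_indicatorConstLp_one, integral_congr_ae (ae_restrict_of_ae h),
    integral_const_mul, integral_complex_ofReal, ← meanBesselK]
  exact mul_div_cancel_right₀ _ (Complex.ofReal_ne_zero.2 (meanBesselK_pos ν).ne')

lemma measurable_besselAmplitude {Φ : ℝ → Lp ℂ 2 radialMeasure} (hΦ : StronglyMeasurable Φ) :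
    Measurable fun ξ => besselAmplitude ξ (Φ (ξ / (2 * Real.pi))) := by
  have h1 : StronglyMeasurable fun ξ : ℝ => Φ (ξ / (2 * Real.pi)) :=
    hΦ.comp_measurable (by fun_prop)
  exact (stronglyMeasurable_const.inner h1).measurable.div
    (Complex.measurable_ofReal.comp measurable_meanBesselK)

lemma ae_two_pi_mul {P : ℝ → Prop} (h : ∀ᵐ η, P η) : ∀ᵐ ξ : ℝ, P (ξ / (2 * Real.pi)) := by
  have := (Measure.quasiMeasurePreserving_smul (volume : Measure ℝ)
    (r := (2 * Real.pi)⁻¹) (by positivity)).ae h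
  filter_upwards [this] with ξ hξ
  rwa [div_eq_inv_mul]

/-- Square-integrability of `η ↦ c(η) K_{2πη}` forces the Gamma-weighted square-integrability of
the coefficients. -/
lemma integrableOn_weight_of_norm_sq_le {Φ : ℝ → Lp ℂ 2 radialMeasure} (hΦ : MemLp Φ 2)
    {g : ℝ → ℂ} (hg : Measurable g) {C : ℝ} (hC : 0 < C)
    (h : ∀ᵐ η, |2 * Real.pi * η| < 1 →
      ‖g (2 * Real.pi * η)‖ ^ 2 * (C / (2 * (1 - |2 * Real.pi * η|))) ≤ ‖Φ η‖ ^ 2) :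
    IntegrableOn (fun ξ : ℝ =>
      (1 / 2) * Real.Gamma (1 + ξ) * Real.Gamma (1 - ξ) * ‖g ξ‖ ^ 2) (Ioo (-1) 1) := by
  have hi : Integrable fun ξ : ℝ => ‖Φ (ξ / (2 * Real.pi))‖ ^ 2 :=
    ((memLp_two_iff_integrable_sq_norm hΦ.aestronglyMeasurable).1 hΦ).comp_div (by positivity)
  refine (hi.const_mul C⁻¹).integrableOn.mono' ?_ ?_
  · exact (continuousOn_Gamma_one_add_mul_Gamma_one_sub.aestronglyMeasurable
      measurableSet_Ioo).mul (hg.norm.pow_const 2).aestronglyMeasurable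
  · filter_upwards [ae_restrict_of_ae (ae_two_pi_mul h), ae_restrict_mem measurableSet_Ioo]
      with ξ h1 hξ
    rw [mul_div_cancel₀ _ (by positivity : (2 * Real.pi) ≠ 0)] at h1
    have ha : |ξ| < 1 := abs_lt.2 hξ
    have h2 := Gamma_one_add_mul_Gamma_one_sub_le ha
    have h3 := one_le_Gamma_one_add_mul_Gamma_one_sub ha
    have h4 := h1 ha
    have h5 : 0 < 1 - |ξ| := sub_pos.2 ha
    rw [Real.norm_of_nonneg (by rw [mul_assoc (1 / 2 : ℝ)]; positivity)]
    calc _ = 1 / 2 * (Real.Gamma (1 + ξ) * Real.Gamma (1 - ξ)) * ‖g ξ‖ ^ 2 := by ring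
      _ ≤ 1 / 2 * (1 / (1 - |ξ|)) * ‖g ξ‖ ^ 2 := by gcongr
      _ = C⁻¹ * (‖g ξ‖ ^ 2 * (C / (2 * (1 - |ξ|)))) := by field_simp
      _ ≤ _ := by gcongr

lemma integrable_of_memLp_of_eq_zero {H : Type*} [NormedAddCommGroup H] {Φ : ℝ → H}
    (hΦ : MemLp Φ 2) {a b : ℝ} (h : ∀ᵐ η, η ∉ Icc a b → Φ η = 0) : Integrable Φ := by
  have h1 : IntegrableOn Φ (Icc a b) := (hΦ.restrict _).integrable (by norm_num)
  refine ((integrable_indicator_iff measurableSet_Icc).2 h1).congr ?_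
  filter_upwards [h] with η hη
  by_cases hm : η ∈ Icc a b
  · rw [indicator_of_mem hm]
  · rw [indicator_of_notMem hm, hη hm]

lemma ae_prod_of_ae_ae_swap {α β : Type*} [MeasurableSpace α] [MeasurableSpace β]
    {μ : Measure α} {ν : Measure β} [SFinite μ] [SFinite ν] {u v : α × β → ℂ}
    (hu : AEStronglyMeasurable u (μ.prod ν)) (hv : StronglyMeasurable v)
    (h : ∀ᵐ y ∂ν, ∀ᵐ x ∂μ, u (x, y) = v (x, y)) : u =ᵐ[μ.prod ν] v := by
  have hm : MeasurableSet {p : β × α | hu.mk u p.swap = v p.swap} :=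
    measurableSet_eq_fun (hu.stronglyMeasurable_mk.measurable.comp measurable_swap)
      (hv.measurable.comp measurable_swap)
  have h1 : ∀ᵐ p ∂ν.prod μ, hu.mk u p.swap = v p.swap := by
    rw [Measure.ae_prod_iff_ae_ae hm]
    filter_upwards [h, ae_ae_swap_of_ae_prod hu.ae_eq_mk] with y h1 h2
    filter_upwards [h1, h2] with x h3 h4
    exact h4.symm.trans h3
  have h2 := (Measure.measurePreserving_swap (μ := μ) (ν := ν)).quasiMeasurePreserving.ae h1
  filter_upwards [h2, hu.ae_eq_mk] with p h3 h4
  rw [h4]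
  simpa using h3

theorem exists_superposition_of_weak_solution {ψ : ℝ × ℝ → ℂ} (hψ : MemLp ψ 2 polarMeasure)
    (hw : ∀ φ : ℝ × ℝ → ℂ, IsLogTest φ →
      ∫ p, ψ p * (starRingEnd ℂ) (polarLap φ p - φ p) ∂polarMeasure = 0) :
    ∃ g : ℝ → ℂ, Measurable g ∧
      IntegrableOn (fun ξ : ℝ =>
        (1 / 2) * Real.Gamma (1 + ξ) * Real.Gamma (1 - ξ) * ‖g ξ‖ ^ 2) (Ioo (-1) 1) ∧
      ∀ᵐ p ∂polarMeasure, ψ p = ((1 / (2 * Real.pi) : ℝ) : ℂ) *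
        ∫ ξ in Ioo (-1 : ℝ) 1,
          g ξ * (besselK ξ p.1 : ℂ) * Complex.exp (Complex.I * ξ * p.2) := by
  have hpi : 0 < 2 * Real.pi := by positivity
  have hψ' : MemLp ψ 2 (radialMeasure.prod volume) := polarMeasure_eq_prod ▸ hψ
  obtain ⟨Ψ₀, hΨ₀, hΨψ₀⟩ := exists_memLp_curry hψ'
  obtain ⟨Ψ, hΨ⟩ : ∃ Ψ : Lp (Lp ℂ 2 radialMeasure) 2 (volume : Measure ℝ),
      ∀ᵐ θ, Ψ θ =ᵐ[radialMeasure] fun r => ψ (r, θ) := by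
    refine ⟨hΨ₀.toLp Ψ₀, ?_⟩
    filter_upwards [hΨ₀.coeFn_toLp, hΨψ₀] with θ h1 h2
    rwa [h1]
  let Φ : Lp (Lp ℂ 2 radialMeasure) 2 (volume : Measure ℝ) := 𝓕 Ψ
  have hc := ae_fourier_eq_const_mul_besselK hψ hw hΨ
  let g : ℝ → ℂ := fun ξ => besselAmplitude ξ (Φ (ξ / (2 * Real.pi)))
  have hg : Measurable g := measurable_besselAmplitude (Lp.stronglyMeasurable Φ)
  have hgη : ∀ᵐ η, (Φ η =ᵐ[radialMeasure]
        fun r => g (2 * Real.pi * η) * besselK (2 * Real.pi * η) r) ∧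
      (1 ≤ |2 * Real.pi * η| → Φ η = 0) ∧ (|2 * Real.pi * η| < 1 →
      ‖g (2 * Real.pi * η)‖ ^ 2 * ((Real.exp (-Real.exp 1) / 2) ^ 2 /
        (2 * (1 - |2 * Real.pi * η|))) ≤ ‖Φ η‖ ^ 2) := by
    filter_upwards [hc] with η ⟨c, h1, h2, h3⟩
    have hgc : g (2 * Real.pi * η) = c := by
      simp only [g]
      rw [mul_div_cancel_left₀ _ hpi.ne']
      exact besselAmplitude_eq h1
    rw [hgc]
    refine ⟨h1, fun h => ?_, h3⟩
    refine Lp.ext (h1.trans ((Lp.coeFn_zero ℂ 2 radialMeasure).symm.mono fun r hr => ?_))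
    simp only [← hr, h2 h, zero_mul, Pi.zero_apply]
  have hweight := integrableOn_weight_of_norm_sq_le (Lp.memLp Φ) hg (by positivity)
    (hgη.mono fun η h => h.2.2)
  have hgi := integrableOn_of_integrableOn_weight hg hweight
  have hΦi : Integrable Φ := by
    refine integrable_of_memLp_of_eq_zero (Lp.memLp Φ) (a := -1) (b := 1) ?_
    filter_upwards [hgη] with η h hη
    refine h.2.1 ?_
    have h1 : 1 < |η| := by
      by_contra! hle
      exact hη (abs_le.1 hle)
    rw [abs_mul, abs_of_pos hpi]
    nlinarith [Real.pi_gt_three]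
  refine ⟨g, hg, hweight, ?_⟩
  rw [polarMeasure_eq_prod]
  refine ae_prod_of_ae_ae_swap (ν := volume) hψ'.aestronglyMeasurable
    ((stronglyMeasurable_superposition hg).const_mul _) ?_
  filter_upwards [hΨ, ae_eq_fourierInv hΦi] with θ h1 h2
  have h3 := fourierInv_ae_eq_superposition hΦi hg hgi (hgη.mono fun η h =>
    ⟨fun _ => h.1, fun hη => h.2.1 (not_lt.1 fun hlt => hη (abs_lt.1 hlt))⟩) θ
  rw [← h2] at h3
  filter_upwards [h1, h3] with r h4 h5
  rw [← h4, h5]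

/-- `ψ ∈ L²(ℝ₊ × ℝ, r dr dθ)` satisfies `Δψ = ψ` distributionally iff
`ψ(r,θ) = (1/2π) ∫_{−1}^{1} g(ξ) K_ξ(r) e^{iξθ} dξ` a.e. for some measurable
`g : (−1,1) → ℂ` with `∫_{−1}^{1} (1/2)Γ(1+ξ)Γ(1−ξ)|g(ξ)|² dξ < ∞`. -/
theorem stmt7 (ψ : Lp ℂ 2 polarMeasure) :
    (∀ φ : ℝ × ℝ → ℂ, IsLogTest φ →
        ∫ p, ψ p * (starRingEnd ℂ) (polarLap φ p - φ p) ∂polarMeasure = 0) ↔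
    ∃ g : ℝ → ℂ, Measurable g ∧
      IntegrableOn (fun ξ : ℝ =>
        (1 / 2) * Real.Gamma (1 + ξ) * Real.Gamma (1 - ξ) * ‖g ξ‖ ^ 2) (Ioo (-1) 1) ∧
      ∀ᵐ p ∂polarMeasure, ψ p = ((1 / (2 * Real.pi) : ℝ) : ℂ) *
        ∫ ξ in Ioo (-1 : ℝ) 1,
          g ξ * (besselK ξ p.1 : ℂ) * Complex.exp (Complex.I * ξ * p.2) := by
  refine ⟨exists_superposition_of_weak_solution (Lp.memLp ψ), ?_⟩
  rintro ⟨g, hg, hgw, h⟩ φ hφ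
  exact weak_solution_of_superposition (integrableOn_of_integrableOn_weight hg hgw) h hφ
end

section
/- For every ν ∈ (−1, 1), ∫₀^∞ K_ν(z)² z dz = (1/2) Γ(1+ν) Γ(1−ν); in particular, for ν ≠ 0 this value equals πν / (2 sin πν). -/
open MeasureTheory Set

/-- The Laplace-type integral defining `Γ`, as a lower Lebesgue integral. -/
theorem lintegral_rpow_mul_exp_neg_mul_Ioi {a r : ℝ} (ha : 0 < a) (hr : 0 < r) :
    ∫⁻ t in Ioi (0:ℝ), ENNReal.ofReal (t ^ (a - 1) * Real.exp (-(r * t)))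
      = ENNReal.ofReal ((1 / r) ^ a * Real.Gamma a) := by
  have hint := Real.integral_rpow_mul_exp_neg_mul_Ioi ha hr
  have hpos : 0 < (1 / r) ^ a * Real.Gamma a :=
    mul_pos (Real.rpow_pos_of_pos (by positivity) _) (Real.Gamma_pos_of_pos ha)
  rw [← hint, ofReal_integral_eq_lintegral_ofReal]
  · by_contra h
    rw [integral_undef h] at hint
    exact hpos.ne hint
  · filter_upwards [ae_restrict_mem measurableSet_Ioi] with t ht
    exact mul_nonneg (Real.rpow_nonneg (le_of_lt ht) _) (Real.exp_pos _).le

theorem lintegral_mul_exp_neg_mul_Ioi {r : ℝ} (hr : 0 < r) :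
    ∫⁻ t in Ioi (0:ℝ), ENNReal.ofReal (t * Real.exp (-(r * t)))
      = ENNReal.ofReal (1 / r ^ 2) := by
  have h := lintegral_rpow_mul_exp_neg_mul_Ioi (a := 2) two_pos hr
  norm_num at h
  simpa using h

/-- The beta integral `∫₀^∞ p^ν / (1+p)² dp = Γ(1+ν) Γ(1−ν)`. -/
theorem lintegral_rpow_div_one_add_sq {ν : ℝ} (hν : ν ∈ Ioo (-1 : ℝ) 1) :
    ∫⁻ p in Ioi (0:ℝ), ENNReal.ofReal (p ^ ν / (1 + p) ^ 2)
      = ENNReal.ofReal (Real.Gamma (1 + ν) * Real.Gamma (1 - ν)) := by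
  obtain ⟨h1, h2⟩ := hν
  have hΓ : 0 < Real.Gamma (1 + ν) := Real.Gamma_pos_of_pos (by linarith)
  calc ∫⁻ p in Ioi (0:ℝ), ENNReal.ofReal (p ^ ν / (1 + p) ^ 2)
      = ∫⁻ p in Ioi (0:ℝ), ∫⁻ y in Ioi (0:ℝ),
          ENNReal.ofReal (p ^ ν * (y * Real.exp (-((1 + p) * y)))) := by
        refine setLIntegral_congr_fun measurableSet_Ioi fun p (hp : 0 < p) => ?_
        have hpν : 0 ≤ p ^ ν := Real.rpow_nonneg hp.le _
        simp only [ENNReal.ofReal_mul hpν]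
        rw [lintegral_const_mul _ (by fun_prop),
          lintegral_mul_exp_neg_mul_Ioi (by linarith), ← ENNReal.ofReal_mul hpν]
        congr 1
        ring
    _ = ∫⁻ y in Ioi (0:ℝ), ∫⁻ p in Ioi (0:ℝ),
          ENNReal.ofReal (p ^ ν * (y * Real.exp (-((1 + p) * y)))) := by
        refine lintegral_lintegral_swap (Measurable.aemeasurable ?_)
        simp only [Function.uncurry_def]
        fun_prop
    _ = ∫⁻ y in Ioi (0:ℝ), ENNReal.ofReal (Real.Gamma (1 + ν)) *
          ENNReal.ofReal (y ^ ((1 - ν) - 1) * Real.exp (-(1 * y))) := by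
        refine setLIntegral_congr_fun measurableSet_Ioi fun y (hy : 0 < y) => ?_
        have hc : 0 ≤ y * Real.exp (-y) := by positivity
        have hsplit : ∀ p : ℝ, p ^ ν * (y * Real.exp (-((1 + p) * y)))
            = (y * Real.exp (-y)) * (p ^ ((1 + ν) - 1) * Real.exp (-(y * p))) := by
          intro p
          rw [show -((1 + p) * y) = -y + -(y * p) by ring, Real.exp_add, add_sub_cancel_left]
          ring
        simp only [hsplit, ENNReal.ofReal_mul hc]
        rw [lintegral_const_mul _ (by fun_prop),
          lintegral_rpow_mul_exp_neg_mul_Ioi (by linarith) hy, ← ENNReal.ofReal_mul hc,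
          ← ENNReal.ofReal_mul hΓ.le]
        congr 1
        rw [one_div, Real.inv_rpow hy.le, ← Real.rpow_neg hy.le,
          show (1 - ν) - 1 = 1 + -(1 + ν) by ring, Real.rpow_add hy, Real.rpow_one, one_mul]
        ring
    _ = ENNReal.ofReal (Real.Gamma (1 + ν) * Real.Gamma (1 - ν)) := by
        rw [lintegral_const_mul _ (by fun_prop),
          lintegral_rpow_mul_exp_neg_mul_Ioi (by linarith) one_pos, ← ENNReal.ofReal_mul hΓ.le]
        simp

theorem lintegral_exp_mul_div_cosh_sq {ν c : ℝ} (hν : ν ∈ Ioo (-1 : ℝ) 1) (hc : 0 < c) :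
    ∫⁻ w : ℝ, ENNReal.ofReal (c * (Real.exp (ν * (c * w)) / (4 * Real.cosh (c * w / 2) ^ 2)))
      = ENNReal.ofReal (Real.Gamma (1 + ν) * Real.Gamma (1 - ν)) := by
  have himage : Set.image (fun w : ℝ => Real.exp (c * w)) univ = Ioi 0 := by
    ext x
    simp only [image_univ, mem_range, mem_Ioi]
    refine ⟨fun ⟨w, hw⟩ => hw ▸ Real.exp_pos _, fun hx => ⟨Real.log x / c, ?_⟩⟩
    rw [mul_div_cancel₀ _ hc.ne', Real.exp_log hx]
  have hderiv : ∀ w ∈ (univ : Set ℝ), HasDerivWithinAt (fun w : ℝ => Real.exp (c * w))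
      (Real.exp (c * w) * c) univ w := fun w _ => by
    simpa using ((hasDerivAt_id w).const_mul c).exp
  have hinj : InjOn (fun w : ℝ => Real.exp (c * w)) univ := fun a _ b _ h =>
    mul_left_cancel₀ hc.ne' (Real.exp_injective h)
  rw [← lintegral_rpow_div_one_add_sq hν, ← himage,
    lintegral_image_eq_lintegral_abs_deriv_mul MeasurableSet.univ hderiv hinj,
    Measure.restrict_univ]
  refine lintegral_congr fun w => ?_
  rw [← ENNReal.ofReal_mul (abs_nonneg _), abs_of_pos (by positivity)]
  congr 1
  have hsq : 1 + Real.exp (c * w) = Real.exp (c * w / 2) * (2 * Real.cosh (c * w / 2)) := by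
    rw [Real.cosh_eq, mul_div_cancel₀ _ two_ne_zero, mul_add, ← Real.exp_add, ← Real.exp_add]
    simp [add_comm]
  have hexp : Real.exp (c * w) = Real.exp (c * w / 2) ^ 2 := by
    rw [← Real.exp_nat_mul]
    congr 1
    push_cast
    ring
  have hcosh := (Real.cosh_pos (c * w / 2)).ne'
  rw [← Real.exp_mul, hsq, mul_comm (c * w) ν, hexp]
  have := (Real.exp_pos (c * w / 2)).ne'
  field_simp
  norm_num

theorem lintegral_one_div_cosh_sq :
    ∫⁻ s : ℝ, ENNReal.ofReal (1 / Real.cosh s ^ 2) = 2 := by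
  have h := lintegral_exp_mul_div_cosh_sq (ν := 0) (c := 2) (by norm_num) two_pos
  have hpt : ∀ s : ℝ, 1 / Real.cosh s ^ 2
      = 2 * (2 * (Real.exp (0 * (2 * s)) / (4 * Real.cosh (2 * s / 2) ^ 2))) := by
    intro s
    have := (Real.cosh_pos s).ne'
    rw [mul_div_cancel_left₀ _ two_ne_zero]
    simp only [zero_mul, Real.exp_zero]
    field_simp
    norm_num
  simp only [hpt, ENNReal.ofReal_mul (zero_le_two (α := ℝ))] at h ⊢
  rw [lintegral_const_mul _ (by fun_prop), h]
  simp

theorem cosh_add_cosh_sub (w s : ℝ) :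
    Real.cosh (s + w / 2) + Real.cosh (w - (s + w / 2))
      = 2 * Real.cosh (w / 2) * Real.cosh s := by
  rw [show w - (s + w / 2) = w / 2 - s by ring, add_comm s, Real.cosh_add, Real.cosh_sub]
  ring

/-- The two-sided integral `∫_ℝ e^{−z cosh t + νt} dt`, equal to `2 K_ν(z)`. -/
noncomputable def lbesselK (ν z : ℝ) : ENNReal :=
  ∫⁻ t : ℝ, ENNReal.ofReal (Real.exp (-z * Real.cosh t + ν * t))

theorem measurable_lbesselK (ν : ℝ) : Measurable (lbesselK ν) := by
  refine Measurable.lintegral_prod_right ?_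
  simp only [Function.uncurry_def]
  fun_prop

theorem lbesselK_neg (ν z : ℝ) : lbesselK (-ν) z = lbesselK ν z := by
  unfold lbesselK
  rw [← lintegral_neg_eq_self]
  simp

theorem besselK_eq_toReal (ν z : ℝ) : besselK ν z = (lbesselK ν z).toReal / 2 := by
  have habs := integral_comp_abs
    (f := fun t : ℝ => Real.exp (-z * Real.cosh t) * Real.cosh (ν * t))
  have hcosh : ∀ t : ℝ, Real.cosh (ν * |t|) = Real.cosh (ν * t) := fun t => by
    rcases abs_choice t with h | h <;> simp [h]
  simp only [Real.cosh_abs, hcosh] at habs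
  have hlint : ∫⁻ t : ℝ, ENNReal.ofReal (Real.exp (-z * Real.cosh t) * Real.cosh (ν * t))
      = lbesselK ν z := by
    have h2 : (2:ENNReal) * ∫⁻ t : ℝ,
        ENNReal.ofReal (Real.exp (-z * Real.cosh t) * Real.cosh (ν * t))
        = 2 * lbesselK ν z := by
      rw [two_mul (lbesselK ν z)]
      nth_rw 2 [← lbesselK_neg]
      unfold lbesselK
      rw [← lintegral_add_left (by fun_prop), ← lintegral_const_mul _ (by fun_prop)]
      refine lintegral_congr fun t => ?_
      rw [← ENNReal.ofReal_add (by positivity) (by positivity), ← ENNReal.ofReal_ofNat 2,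
        ← ENNReal.ofReal_mul zero_le_two, Real.exp_add, Real.exp_add, Real.cosh_eq (ν * t), neg_mul ν t]
      congr 1
      ring
    exact (ENNReal.mul_right_inj two_ne_zero ENNReal.ofNat_ne_top).1 h2
  rw [← hlint, ← integral_eq_lintegral_of_nonneg_ae
    (ae_of_all _ fun t => mul_nonneg (Real.exp_pos _).le (Real.cosh_pos _).le)
    (by fun_prop), habs, besselK]
  ring

theorem lbesselK_sq (ν z : ℝ) :
    lbesselK ν z ^ 2 = ∫⁻ w : ℝ, ∫⁻ s : ℝ, ENNReal.ofReal
      (Real.exp (ν * w) * Real.exp (-(2 * Real.cosh (w / 2) * Real.cosh s * z))) := by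
  calc lbesselK ν z ^ 2
      = ∫⁻ s : ℝ, ∫⁻ t : ℝ, ENNReal.ofReal (Real.exp (-z * Real.cosh s + ν * s)) *
          ENNReal.ofReal (Real.exp (-z * Real.cosh t + ν * t)) := by
        rw [sq, lbesselK, ← lintegral_mul_const _ (by fun_prop)]
        refine lintegral_congr fun s => ?_
        rw [lintegral_const_mul _ (by fun_prop)]
    _ = ∫⁻ s : ℝ, ∫⁻ w : ℝ, ENNReal.ofReal (Real.exp (-z * Real.cosh s + ν * s)) *
          ENNReal.ofReal (Real.exp (-z * Real.cosh (w - s) + ν * (w - s))) := by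
        refine lintegral_congr fun s => ?_
        exact (lintegral_sub_right_eq_self (fun t : ℝ =>
          ENNReal.ofReal (Real.exp (-z * Real.cosh s + ν * s)) *
          ENNReal.ofReal (Real.exp (-z * Real.cosh t + ν * t))) s).symm
    _ = ∫⁻ w : ℝ, ∫⁻ s : ℝ, ENNReal.ofReal (Real.exp (-z * Real.cosh s + ν * s)) *
          ENNReal.ofReal (Real.exp (-z * Real.cosh (w - s) + ν * (w - s))) := by
        refine lintegral_lintegral_swap (Measurable.aemeasurable ?_)
        simp only [Function.uncurry_def]
        fun_prop
    _ = _ := by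
        refine lintegral_congr fun w => ?_
        rw [← lintegral_add_right_eq_self _ (w / 2)]
        refine lintegral_congr fun s => ?_
        rw [← ENNReal.ofReal_mul (Real.exp_pos _).le, ← Real.exp_add, ← Real.exp_add,
          ← cosh_add_cosh_sub]
        congr 2
        ring

theorem lintegral_lbesselK_sq_mul {ν : ℝ} (hν : ν ∈ Ioo (-1 : ℝ) 1) :
    ∫⁻ z in Ioi (0:ℝ), lbesselK ν z ^ 2 * ENNReal.ofReal z
      = ENNReal.ofReal (Real.Gamma (1 + ν) * Real.Gamma (1 - ν)) * 2 := by
  have hmeas : Measurable fun p : (ℝ × ℝ) × ℝ => ENNReal.ofReal (Real.exp (ν * p.1.2) *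
      Real.exp (-(2 * Real.cosh (p.1.2 / 2) * Real.cosh p.2 * p.1.1))) *
        ENNReal.ofReal p.1.1 := by
    fun_prop
  calc ∫⁻ z in Ioi (0:ℝ), lbesselK ν z ^ 2 * ENNReal.ofReal z
      = ∫⁻ z in Ioi (0:ℝ), ∫⁻ w : ℝ, ∫⁻ s : ℝ, ENNReal.ofReal
          (Real.exp (ν * w) * Real.exp (-(2 * Real.cosh (w / 2) * Real.cosh s * z))) *
            ENNReal.ofReal z := by
        refine lintegral_congr fun z => ?_
        rw [lbesselK_sq, ← lintegral_mul_const' _ _ ENNReal.ofReal_ne_top]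
        refine lintegral_congr fun w => ?_
        rw [lintegral_mul_const' _ _ ENNReal.ofReal_ne_top]
    _ = ∫⁻ w : ℝ, ∫⁻ z in Ioi (0:ℝ), ∫⁻ s : ℝ, ENNReal.ofReal
          (Real.exp (ν * w) * Real.exp (-(2 * Real.cosh (w / 2) * Real.cosh s * z))) *
            ENNReal.ofReal z :=
        lintegral_lintegral_swap hmeas.lintegral_prod_right'.aemeasurable
    _ = ∫⁻ w : ℝ, ∫⁻ s : ℝ, ∫⁻ z in Ioi (0:ℝ), ENNReal.ofReal
          (Real.exp (ν * w) * Real.exp (-(2 * Real.cosh (w / 2) * Real.cosh s * z))) *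
            ENNReal.ofReal z := by
        refine lintegral_congr fun w => ?_
        refine lintegral_lintegral_swap (Measurable.aemeasurable ?_)
        simp only [Function.uncurry_def]
        fun_prop
    _ = ∫⁻ w : ℝ, ∫⁻ s : ℝ, ENNReal.ofReal
          (1 * (Real.exp (ν * (1 * w)) / (4 * Real.cosh (1 * w / 2) ^ 2))) *
            ENNReal.ofReal (1 / Real.cosh s ^ 2) := by
        refine lintegral_congr fun w => lintegral_congr fun s => ?_
        have hw := Real.cosh_pos (w / 2)
        have hs := Real.cosh_pos s
        have hpt : ∀ z : ℝ, ENNReal.ofReal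
            (Real.exp (ν * w) * Real.exp (-(2 * Real.cosh (w / 2) * Real.cosh s * z))) *
              ENNReal.ofReal z = ENNReal.ofReal (Real.exp (ν * w)) * ENNReal.ofReal
                (z * Real.exp (-(2 * Real.cosh (w / 2) * Real.cosh s * z))) := fun z => by
          rw [← ENNReal.ofReal_mul (by positivity), ← ENNReal.ofReal_mul (by positivity)]
          congr 1
          ring
        simp only [hpt]
        rw [lintegral_const_mul _ (by fun_prop), lintegral_mul_exp_neg_mul_Ioi (by positivity),
          ← ENNReal.ofReal_mul (by positivity), ← ENNReal.ofReal_mul (by positivity)]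
        congr 1
        simp only [one_mul]
        field_simp
        norm_num
    _ = ENNReal.ofReal (Real.Gamma (1 + ν) * Real.Gamma (1 - ν)) * 2 := by
        rw [← lintegral_exp_mul_div_cosh_sq hν one_pos, ← lintegral_one_div_cosh_sq,
          ← lintegral_mul_const _ (by fun_prop)]
        refine lintegral_congr fun w => ?_
        rw [lintegral_const_mul _ (by fun_prop)]

theorem integral_besselK_sq_mul {ν : ℝ} (hν : ν ∈ Ioo (-1 : ℝ) 1) :
    ∫ z in Ioi (0:ℝ), besselK ν z ^ 2 * z
      = (1 / 2) * Real.Gamma (1 + ν) * Real.Gamma (1 - ν) := by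
  have hmeas : Measurable fun z => lbesselK ν z ^ 2 * ENNReal.ofReal z :=
    ((measurable_lbesselK ν).pow_const 2).mul ENNReal.measurable_ofReal
  have hlint := lintegral_lbesselK_sq_mul hν
  have hΓ : 0 ≤ Real.Gamma (1 + ν) * Real.Gamma (1 - ν) :=
    mul_nonneg (Real.Gamma_nonneg_of_nonneg (by linarith [hν.1]))
      (Real.Gamma_nonneg_of_nonneg (by linarith [hν.2]))
  calc ∫ z in Ioi (0:ℝ), besselK ν z ^ 2 * z
      = ∫ z in Ioi (0:ℝ), (lbesselK ν z ^ 2 * ENNReal.ofReal z).toReal / 4 := by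
        refine setIntegral_congr_fun measurableSet_Ioi fun z (hz : 0 < z) => ?_
        simp only [besselK_eq_toReal, ENNReal.toReal_mul, ENNReal.toReal_pow,
          ENNReal.toReal_ofReal hz.le]
        ring
    _ = (ENNReal.ofReal (Real.Gamma (1 + ν) * Real.Gamma (1 - ν)) * 2).toReal / 4 := by
        rw [integral_div, integral_toReal hmeas.aemeasurable, hlint]
        refine ae_lt_top hmeas ?_
        rw [hlint]
        exact ENNReal.mul_ne_top ENNReal.ofReal_ne_top ENNReal.ofNat_ne_top
    _ = (1 / 2) * Real.Gamma (1 + ν) * Real.Gamma (1 - ν) := by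
        rw [ENNReal.toReal_mul, ENNReal.toReal_ofReal hΓ, ENNReal.toReal_ofNat]
        ring

theorem Gamma_one_add_mul_Gamma_one_sub {ν : ℝ} (hν : ν ≠ 0) :
    Real.Gamma (1 + ν) * Real.Gamma (1 - ν) = Real.pi * ν / Real.sin (Real.pi * ν) := by
  rw [add_comm, Real.Gamma_add_one hν, mul_assoc, Real.Gamma_mul_Gamma_one_sub]
  ring

/-- For `ν ∈ (−1,1)`, `∫₀^∞ K_ν(z)² z dz = (1/2)Γ(1+ν)Γ(1−ν)`; for
`ν ≠ 0` this value equals `πν / (2 sin πν)`. -/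
theorem stmt8 (ν : ℝ) (hν : ν ∈ Ioo (-1 : ℝ) 1) :
    (∫ z in Ioi (0:ℝ), besselK ν z ^ 2 * z) = (1 / 2) * Real.Gamma (1 + ν) * Real.Gamma (1 - ν)
    ∧ (ν ≠ 0 → (∫ z in Ioi (0:ℝ), besselK ν z ^ 2 * z)
        = Real.pi * ν / (2 * Real.sin (Real.pi * ν))) := by
  refine ⟨integral_besselK_sq_mul hν, fun hν0 => ?_⟩
  rw [integral_besselK_sq_mul hν, mul_assoc, Gamma_one_add_mul_Gamma_one_sub hν0,
    div_mul_div_comm, one_mul]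
end

section
/- The two one-parameter unitary groups {U₁(s)}_{s∈ℝ} and {U₂(t)}_{t∈ℝ} on L²(ℝ₊ × ℝ, r dr dθ) do not commute: there exist s, t ∈ ℝ with U₁(s) U₂(t) ≠ U₂(t) U₁(s). -/
open MeasureTheory Set

/-- `LiftRel w p q` says that `q` is the point of the log-surface (in polar coordinates)
obtained by lifting the planar translation by the vector `w` starting at `p`:  `q`
projects to the planar point `(p₁cos p₂ + w₁, p₁ sin p₂ + w₂)`, with the radial part
determined by that point and with `|θ' − θ| < π`. -/
def LiftRel (w : ℝ × ℝ) (p q : ℝ × ℝ) : Prop :=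
  q.1 = Real.sqrt ((p.1 * Real.cos p.2 + w.1) ^ 2 + (p.1 * Real.sin p.2 + w.2) ^ 2) ∧
  q.1 * Real.cos q.2 = p.1 * Real.cos p.2 + w.1 ∧
  q.1 * Real.sin q.2 = p.1 * Real.sin p.2 + w.2 ∧
  |q.2 - p.2| < Real.pi

theorem liftRel_norm_arg (w p : ℝ × ℝ) (z : ℂ) (k : ℤ)
    (hre : z.re = p.1 * Real.cos p.2 + w.1) (him : z.im = p.1 * Real.sin p.2 + w.2)
    (h : |z.arg + k * (2 * Real.pi) - p.2| < Real.pi) :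
    LiftRel w p (‖z‖, z.arg + k * (2 * Real.pi)) := by
  refine ⟨?_, ?_, ?_, h⟩
  · rw [← hre, ← him, Complex.norm_eq_sqrt_sq_add_sq]
  · simp only [Real.cos_add_int_mul_two_pi]
    rw [Complex.norm_mul_cos_arg, hre]
  · simp only [Real.sin_add_int_mul_two_pi]
    rw [Complex.norm_mul_sin_arg, him]

theorem exists_ae_eq_of_ae_forall_rel {α β : Type*} [MeasurableSpace α] {μ : Measure α}
    {R : α → α → Prop} {T f : α → β} (h : ∀ᵐ q ∂μ, ∀ r, R q r → T q = f r) :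
    ∃ g : α → β, T =ᵐ[μ] g ∧ ∀ q, (∃ r, R q r) → ∃ r, R q r ∧ g q = f r := by
  classical
  refine ⟨fun q => if hq : ∃ r, R q r then f hq.choose else T q, ?_, ?_⟩
  · filter_upwards [h] with q hq
    by_cases hr : ∃ r, R q r
    · simp only [hr, dif_pos]
      exact hq _ hr.choose_spec
    · simp [hr]
  · intro q hr
    exact ⟨hr.choose, hr.choose_spec, by simp only [hr, dif_pos]⟩

theorem polarMeasure_Ioo_prod_Ioo_lt_top (a b c d : ℝ) :
    polarMeasure (Ioo a b ×ˢ Ioo c d) < ⊤ := by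
  have hm : MeasurableSet (Ioo a b ×ˢ Ioo c d) := measurableSet_Ioo.prod measurableSet_Ioo
  rw [polarMeasure, withDensity_apply _ hm]
  calc ∫⁻ p in Ioo a b ×ˢ Ioo c d, ENNReal.ofReal p.1
        ∂((volume : Measure (ℝ × ℝ)).restrict (Ioi (0 : ℝ) ×ˢ univ))
      ≤ ∫⁻ _ in Ioo a b ×ˢ Ioo c d, ENNReal.ofReal b
        ∂((volume : Measure (ℝ × ℝ)).restrict (Ioi (0 : ℝ) ×ˢ univ)) :=
        setLIntegral_mono' hm fun p hp => ENNReal.ofReal_le_ofReal hp.1.2.le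
    _ < ⊤ := by
        rw [setLIntegral_const]
        refine ENNReal.mul_lt_top ENNReal.ofReal_lt_top
          ((Measure.restrict_apply_le _ _).trans_lt ?_)
        rw [Measure.volume_eq_prod, Measure.prod_prod, Real.volume_Ioo, Real.volume_Ioo]
        exact ENNReal.mul_lt_top ENNReal.ofReal_lt_top ENNReal.ofReal_lt_top

theorem polarMeasure_Ioo_prod_Ioo_ne_zero {b c d : ℝ} (hb : 0 < b) (hcd : c < d) :
    polarMeasure (Ioo 0 b ×ˢ Ioo c d) ≠ 0 := by
  intro h
  have hm : MeasurableSet (Ioo 0 b ×ˢ Ioo c d) := measurableSet_Ioo.prod measurableSet_Ioo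
  rw [polarMeasure, withDensity_apply_eq_zero (by fun_prop)] at h
  have hpos : {p : ℝ × ℝ | ENNReal.ofReal p.1 ≠ 0} ∩ Ioo 0 b ×ˢ Ioo c d
      = Ioo 0 b ×ˢ Ioo c d := by
    refine inter_eq_right.2 fun p hp => ?_
    simpa using hp.1.1
  rw [hpos, Measure.restrict_apply hm, inter_eq_left.2
    (prod_mono Ioo_subset_Ioi_self (subset_univ _)), Measure.volume_eq_prod,
    Measure.prod_prod, Real.volume_Ioo, Real.volume_Ioo] at h
  simp at h
  rcases h with h | h <;> linarith

/-- A sector in the first quadrant on which both coordinates lie in `(0, 1)`. -/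
theorem cos_sin_mem_Ioo_of_mem_sector {p : ℝ × ℝ}
    (hp : p ∈ Ioo (0 : ℝ) 1 ×ˢ Ioo (0 : ℝ) (Real.pi / 2)) :
    p.1 * Real.cos p.2 ∈ Ioo (0 : ℝ) 1 ∧ p.1 * Real.sin p.2 ∈ Ioo (0 : ℝ) 1 := by
  obtain ⟨⟨h1, h2⟩, h3, h4⟩ := hp
  have hc : 0 < Real.cos p.2 := Real.cos_pos_of_mem_Ioo ⟨by linarith, h4⟩
  have hs : 0 < Real.sin p.2 := Real.sin_pos_of_pos_of_lt_pi h3 (by linarith)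
  have hc1 := Real.cos_le_one p.2
  have hs1 := Real.sin_le_one p.2
  exact ⟨⟨by positivity, by nlinarith⟩, by positivity, by nlinarith⟩

/-- Going left and then down around the origin ends at a positive angle. -/
theorem exists_liftRel_left_down {p : ℝ × ℝ}
    (hp : p ∈ Ioo (0 : ℝ) 1 ×ˢ Ioo (0 : ℝ) (Real.pi / 2)) :
    ∃ q, LiftRel (-1, 0) p q ∧ (∃ r, LiftRel (0, -1) q r) ∧
      ∀ r, LiftRel (0, -1) q r → r ∈ Ioo (0 : ℝ) 2 ×ˢ Ioo (0 : ℝ) (2 * Real.pi) := by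
  obtain ⟨⟨hx0, hx1⟩, hy0, hy1⟩ := cos_sin_mem_Ioo_of_mem_sector hp
  obtain ⟨-, hθ0, hθ1⟩ := hp
  have hπ := Real.pi_pos
  set x := p.1 * Real.cos p.2
  set y := p.1 * Real.sin p.2
  set z : ℂ := ⟨x - 1, y⟩ with hz
  have hzπ := z.arg_le_pi
  have hz0 : 0 ≤ z.arg := Complex.arg_nonneg_iff.2 hy0.le
  have hz2 : Real.pi / 2 < z.arg := by
    by_contra! hcon
    have := Complex.abs_arg_le_pi_div_two_iff.1 (abs_le.2 ⟨by linarith, hcon⟩)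
    simp only [hz] at this
    linarith
  have hq := liftRel_norm_arg (-1, 0) p z 0 (by simp [hz, x]; ring) (by simp [hz, y])
    (by rw [abs_lt]; push_cast; constructor <;> linarith)
  refine ⟨_, hq, ?_, ?_⟩
  · obtain ⟨-, hqc, hqs, -⟩ := hq
    set v : ℂ := ⟨x - 1, y - 1⟩ with hv
    have hv0 : v.arg < 0 := Complex.arg_neg_iff.2 (by simp only [hv]; linarith)
    have hvπ := v.neg_pi_lt_arg
    have hv2 : v.arg < -(Real.pi / 2) := by
      by_contra! hcon
      have := Complex.abs_arg_le_pi_div_two_iff.1 (abs_le.2 ⟨hcon, by linarith⟩)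
      simp only [hv] at this
      linarith
    refine ⟨_, liftRel_norm_arg (0, -1) _ v 1 ?_ ?_ ?_⟩
    · rw [hqc]; simp [hv, x]; ring
    · rw [hqs]; simp [hv, y]; ring
    · rw [abs_lt]; push_cast; constructor <;> linarith
  · rintro r ⟨hr1, hrc, hrs, hr⟩
    obtain ⟨-, hqc, hqs, -⟩ := hq
    rw [hqc] at hr1 hrc
    rw [hqs] at hr1 hrs
    simp only [Int.cast_zero, zero_mul, add_zero, abs_lt] at hr hr1 hrc hrs
    have hr0 : 0 ≤ r.1 := by rw [hr1]; positivity
    have hrne : r.1 ≠ 0 := by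
      intro h0
      rw [h0, zero_mul] at hrc
      linarith
    refine ⟨⟨lt_of_le_of_ne hr0 hrne.symm, ?_⟩, ?_, by linarith⟩
    · rw [hr1, Real.sqrt_lt' two_pos]
      nlinarith
    · by_contra! hcon
      have := mul_nonneg hr0
        (Real.cos_nonneg_of_neg_pi_div_two_le_of_le (x := r.2) (by linarith) (by linarith))
      linarith

/-- Going down and then left around the origin ends at a nonpositive angle. -/
theorem exists_liftRel_down_left {p : ℝ × ℝ}
    (hp : p ∈ Ioo (0 : ℝ) 1 ×ˢ Ioo (0 : ℝ) (Real.pi / 2)) :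
    ∃ q, LiftRel (0, -1) p q ∧ (∃ r, LiftRel (-1, 0) q r) ∧
      ∀ r, LiftRel (-1, 0) q r → r ∉ Ioo (0 : ℝ) 2 ×ˢ Ioo (0 : ℝ) (2 * Real.pi) := by
  obtain ⟨⟨hx0, hx1⟩, hy0, hy1⟩ := cos_sin_mem_Ioo_of_mem_sector hp
  obtain ⟨-, hθ0, hθ1⟩ := hp
  have hπ := Real.pi_pos
  set x := p.1 * Real.cos p.2
  set y := p.1 * Real.sin p.2
  set z : ℂ := ⟨x, y - 1⟩ with hz
  have hz0 : z.arg < 0 := Complex.arg_neg_iff.2 (by simp only [hz]; linarith)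
  have hz2 : -(Real.pi / 2) ≤ z.arg :=
    (abs_le.1 (Complex.abs_arg_le_pi_div_two_iff.2 hx0.le)).1
  have hq := liftRel_norm_arg (0, -1) p z 0 (by simp [hz, x]) (by simp [hz, y]; ring)
    (by rw [abs_lt]; push_cast; constructor <;> linarith)
  refine ⟨_, hq, ?_, ?_⟩
  · obtain ⟨-, hqc, hqs, -⟩ := hq
    set v : ℂ := ⟨x - 1, y - 1⟩ with hv
    have hv0 : v.arg < 0 := Complex.arg_neg_iff.2 (by simp only [hv]; linarith)
    have hvπ := v.neg_pi_lt_arg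
    refine ⟨_, liftRel_norm_arg (-1, 0) _ v 0 ?_ ?_ ?_⟩
    · rw [hqc]; simp [hv, x]; ring
    · rw [hqs]; simp [hv, y]; ring
    · rw [abs_lt]; push_cast; constructor <;> linarith
  · rintro r ⟨-, -, hrs, hr⟩ ⟨⟨hr0, -⟩, hr2, -⟩
    obtain ⟨-, -, hqs, -⟩ := hq
    rw [hqs] at hrs
    simp only [Int.cast_zero, zero_mul, add_zero, abs_lt] at hr hrs
    have := mul_nonneg hr0.le (Real.sin_nonneg_of_nonneg_of_le_pi hr2.le (by linarith))
    linarith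

/-- The two lifted-translation one-parameter unitary groups `U₁, U₂` on
`L²(ℝ₊ × ℝ, r dr dθ)` (`U₁(s)f = f ∘ τ¹₋ₛ`, `U₂(t)f = f ∘ τ²₋ₜ`) do not commute: there
are `s, t` with `U₁(s)U₂(t) ≠ U₂(t)U₁(s)`. -/
theorem stmt13
    (U₁ U₂ : ℝ → (Lp ℂ 2 polarMeasure ≃ₗᵢ[ℂ] Lp ℂ 2 polarMeasure))
    (hU₁ : ∀ (s : ℝ) (f : ℝ × ℝ → ℂ) (F : Lp ℂ 2 polarMeasure), ⇑F =ᵐ[polarMeasure] f →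
      ∀ᵐ p ∂polarMeasure, ∀ q, LiftRel (-s, 0) p q → (U₁ s F) p = f q)
    (hU₂ : ∀ (t : ℝ) (f : ℝ × ℝ → ℂ) (F : Lp ℂ 2 polarMeasure), ⇑F =ᵐ[polarMeasure] f →
      ∀ᵐ p ∂polarMeasure, ∀ q, LiftRel (0, -t) p q → (U₂ t F) p = f q) :
    ∃ (s t : ℝ) (F : Lp ℂ 2 polarMeasure), U₁ s (U₂ t F) ≠ U₂ t (U₁ s F) := by
  have hA : MeasurableSet (Ioo (0 : ℝ) 2 ×ˢ Ioo (0 : ℝ) (2 * Real.pi)) :=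
    measurableSet_Ioo.prod measurableSet_Ioo
  have hAfin := (polarMeasure_Ioo_prod_Ioo_lt_top 0 2 0 (2 * Real.pi)).ne
  set F := indicatorConstLp 2 hA hAfin (1 : ℂ)
  refine ⟨1, 1, F, fun hcomm => ?_⟩
  have hF : ⇑F =ᵐ[polarMeasure] _ := indicatorConstLp_coeFn
  obtain ⟨g₂, hg₂, hg₂'⟩ := exists_ae_eq_of_ae_forall_rel (hU₂ 1 _ F hF)
  obtain ⟨g₁, hg₁, hg₁'⟩ := exists_ae_eq_of_ae_forall_rel (hU₁ 1 _ F hF)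
  have h12 := hU₁ 1 g₂ _ hg₂
  have h21 := hU₂ 1 g₁ _ hg₁
  rw [← hcomm] at h21
  refine polarMeasure_Ioo_prod_Ioo_ne_zero one_pos Real.pi_div_two_pos
    (measure_mono_null ?_ (ae_iff.1 (h12.and h21)))
  rintro p hp ⟨hp1, hp2⟩
  obtain ⟨q, hq, hr, hmem⟩ := exists_liftRel_left_down hp
  obtain ⟨q', hq', hr', hmem'⟩ := exists_liftRel_down_left hp
  obtain ⟨r, hqr, hgr⟩ := hg₂' q hr
  obtain ⟨r', hqr', hgr'⟩ := hg₁' q' hr'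
  have h := (hp1 q hq).symm.trans (hp2 q' hq')
  rw [hgr, hgr', indicator_of_mem (hmem r hqr), indicator_of_notMem (hmem' r' hqr')] at h
  exact one_ne_zero h
end

section
/- The operator H = d/dx with domain C_c^∞(ℝ) in L²(ℝ) is essentially skew-adjoint: its Hilbert-space adjoint equals the negative of its closure. Moreover, its closure is the infinitesimal generator of the translation group, i.e., for every f ∈ C_c^∞(ℝ), the map t ↦ (x ↦ f(x − t)) ∈ L²(ℝ) is differentiable at 0 with derivative −f′. -/
open MeasureTheory Set

/-- `C_c^∞(ℝ)`: smooth compactly supported functions on `ℝ`. -/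
def IsRTest (f : ℝ → ℂ) : Prop := ContDiff ℝ (⊤ : ℕ∞) f ∧ HasCompactSupport f

namespace LinearPMap

open scoped InnerProductSpace
open Filter Topology

variable {𝕜 E : Type*} [RCLike 𝕜] [NormedAddCommGroup E] [InnerProductSpace 𝕜 E]
  {T : E →ₗ.[𝕜] E}

theorem mem_neg_graph_iff {f : E →ₗ.[𝕜] E} {p : E × E} :
    p ∈ (-f).graph ↔ (p.1, -p.2) ∈ f.graph := by
  rw [neg_graph]
  refine ⟨?_, fun hp => ⟨_, hp, by simp⟩⟩
  rintro ⟨q, hq, rfl⟩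
  simpa using hq

theorem norm_le_norm_apply_add_self
    (hskew : ∀ v w : T.domain, ⟪T v, (w : E)⟫_𝕜 + ⟪(v : E), T w⟫_𝕜 = 0) (v : T.domain) :
    ‖(v : E)‖ ≤ ‖T v + v‖ := by
  have h : RCLike.re ⟪T v, (v : E)⟫_𝕜 = 0 := by
    have h := congrArg RCLike.re (hskew v v)
    rw [_root_.map_add, inner_re_symm (v : E), _root_.map_zero] at h
    linarith
  have h2 := norm_add_sq (𝕜 := 𝕜) (T v) (v : E)
  rw [h] at h2
  refine le_of_sq_le_sq ?_ (norm_nonneg _)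
  nlinarith [sq_nonneg ‖T v‖]

variable [CompleteSpace E]

theorem mk_mem_adjoint_graph_iff (hT : Dense (T.domain : Set E)) {y w : E} :
    (y, w) ∈ T.adjoint.graph ↔ ∀ v : T.domain, ⟪T v, y⟫_𝕜 = ⟪(v : E), w⟫_𝕜 := by
  rw [adjoint_graph_eq_graph_adjoint hT, Submodule.mem_adjoint_iff]
  refine ⟨fun h v => sub_eq_zero.1 (h v (T v) (T.mem_graph v)), fun h a b hab => ?_⟩
  obtain ⟨v, rfl, rfl⟩ := T.mem_graph_iff.1 hab
  exact sub_eq_zero.2 (h v)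

theorem denseRange_apply_add_self
    (h : ∀ z : E, (∀ v : T.domain, ⟪z, T v + v⟫_𝕜 = 0) → z = 0) :
    DenseRange fun v : T.domain => T v + (v : E) := by
  have : Dense (LinearMap.range (T.toFun + T.domain.subtype) : Set E) := by
    rw [Submodule.dense_iff_topologicalClosure_eq_top, Submodule.topologicalClosure_eq_top_iff,
      Submodule.eq_bot_iff]
    intro z hz
    exact h z fun v => (Submodule.mem_orthogonal' _ _).1 hz _ ⟨v, rfl⟩
  simpa [DenseRange, LinearMap.coe_range] using! this

/-- A densely defined skew-symmetric operator `T` such that both `T + 1` and `T - 1` have dense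
range is essentially skew-adjoint. -/
theorem adjoint_eq_neg_closure (hT : Dense (T.domain : Set E))
    (hskew : ∀ v w : T.domain, ⟪T v, (w : E)⟫_𝕜 + ⟪(v : E), T w⟫_𝕜 = 0)
    (hadd : ∀ z : E, (∀ v : T.domain, ⟪z, T v + v⟫_𝕜 = 0) → z = 0)
    (hsub : ∀ z : E, (∀ v : T.domain, ⟪z, T v - v⟫_𝕜 = 0) → z = 0) :
    T.adjoint = -T.closure := by
  have hclosed : _root_.IsClosed (T.adjoint.graph : Set (E × E)) := adjoint_isClosed hT
  have hgraph (v : T.domain) : ((v : E), -T v) ∈ T.adjoint.graph :=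
    (mk_mem_adjoint_graph_iff hT).2 fun w => by
      rw [inner_neg_right]; exact eq_neg_of_add_eq_zero_left (hskew w v)
  have hle : T ≤ -T.adjoint := by
    refine le_of_le_graph fun x hx => mem_neg_graph_iff.2 ?_
    obtain ⟨v, hv, hv'⟩ := T.mem_graph_iff.1 hx
    rw [← hv, ← hv']
    exact hgraph v
  have hneg : (-T.adjoint).IsClosed := by
    have : ((-T.adjoint).graph : Set (E × E))
        = (fun p : E × E => (p.1, -p.2)) ⁻¹' T.adjoint.graph :=
      Set.ext fun _ => mem_neg_graph_iff
    rw [LinearPMap.IsClosed, this]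
    exact hclosed.preimage (by fun_prop)
  have hcl : T.IsClosable := isClosable_iff_exists_closed_extension.2 ⟨_, hneg, hle⟩
  have key : ∀ y w : E, (y, w) ∈ T.adjoint.graph → (y, -w) ∈ T.closure.graph := by
    intro y w hyw
    obtain ⟨s, hs, hlim⟩ := mem_closure_iff_seq_limit.1 (denseRange_apply_add_self hadd (y - w))
    choose u hu using hs
    have hcauchy : CauchySeq fun n => (u n : E) := by
      refine Metric.cauchySeq_iff.2 fun ε hε => ?_
      obtain ⟨N, hN⟩ := Metric.cauchySeq_iff.1 hlim.cauchySeq ε hε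
      refine ⟨N, fun m hm n hn => lt_of_le_of_lt ?_ (hN m hm n hn)⟩
      rw [dist_eq_norm, dist_eq_norm, ← hu m, ← hu n]
      have := norm_le_norm_apply_add_self hskew (u m - u n)
      rw [T.map_sub] at this
      convert! this using 2
      simp only [Submodule.coe_sub]
      abel
    obtain ⟨x, hx⟩ := cauchySeq_tendsto_of_complete hcauchy
    have hTu : Tendsto (fun n => T (u n)) atTop (𝓝 (y - w - x)) := by
      refine (hlim.sub hx).congr fun n => ?_
      rw [← hu n]; simp
    have hxg : (x, -(y - w - x)) ∈ T.adjoint.graph :=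
      hclosed.mem_of_tendsto (hx.prodMk_nhds hTu.neg) (Eventually.of_forall fun n => hgraph (u n))
    have hz : y - x = 0 := by
      refine hsub _ fun v => ?_
      have h := (mk_mem_adjoint_graph_iff hT).1 (T.adjoint.graph.sub_mem hyw hxg) v
      rw [show w - -(y - w - x) = y - x by abel] at h
      rw [← inner_conj_symm, inner_sub_left, h, sub_self, _root_.map_zero]
    obtain rfl : y = x := sub_eq_zero.1 hz
    rw [← hcl.graph_closure_eq_closure_graph]
    refine mem_closure_of_tendsto (hx.prodMk_nhds ?_)
      (Eventually.of_forall fun n => T.mem_graph (u n))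
    simpa using hTu
  have hcle : T.closure ≤ -T.adjoint := by
    refine le_of_le_graph ?_
    rw [← hcl.graph_closure_eq_closure_graph]
    exact T.graph.topologicalClosure_minimal (le_graph_of_le hle) hneg
  refine eq_of_eq_graph (Submodule.ext fun p => ⟨fun hp => mem_neg_graph_iff.2 (key _ _ hp), ?_⟩)
  intro hp
  simpa using mem_neg_graph_iff.1 (le_graph_of_le hcle (mem_neg_graph_iff.1 hp))

end LinearPMap

namespace IsRTest

open Filter Topology
open scoped InnerProductSpace ENNReal

variable {f g : ℝ → ℂ}

theorem continuous (hf : IsRTest f) : Continuous f := hf.1.continuous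

theorem hasDerivAt (hf : IsRTest f) (x : ℝ) : HasDerivAt f (deriv f x) x :=
  (hf.1.differentiable (by simp) x).hasDerivAt

theorem memLp (hf : IsRTest f) (p : ℝ≥0∞) : MemLp f p :=
  hf.continuous.memLp_of_hasCompactSupport hf.2

theorem integrable (hf : IsRTest f) : Integrable f :=
  hf.continuous.integrable_of_hasCompactSupport hf.2

theorem deriv (hf : IsRTest f) : IsRTest (deriv f) :=
  ⟨(contDiff_infty_iff_deriv.1 hf.1).2, hf.2.deriv⟩

theorem sub (hf : IsRTest f) (hg : IsRTest g) : IsRTest (f - g) :=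
  ⟨hf.1.sub hg.1, hf.2.sub hg.2⟩

theorem smooth_mul (hf : IsRTest f) (hg : ContDiff ℝ (⊤ : ℕ∞) g) : IsRTest (g * f) :=
  ⟨hg.mul hf.1, hf.2.mul_left⟩

theorem const_smul (hf : IsRTest f) (c : ℂ) : IsRTest (c • f) :=
  ⟨contDiff_const.smul hf.1, hf.2.mul_left⟩

theorem comp_sub_right (hf : IsRTest f) (t : ℝ) : IsRTest fun x => f (x - t) :=
  ⟨hf.1.comp (contDiff_id.sub contDiff_const), hf.2.comp_homeomorph (Homeomorph.subRight t)⟩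

/-- A test function of integral zero has a primitive which is a test function. -/
theorem exists_hasDerivAt (hf : IsRTest f) (h : ∫ x, f x = 0) :
    ∃ F, IsRTest F ∧ ∀ x, HasDerivAt F (f x) x := by
  obtain ⟨R, hR⟩ := hf.2.isCompact.isBounded.subset_ball 0
  have hsupp : Function.support f ⊆ Ioo (-R) R := by
    have := (subset_tsupport f).trans hR
    rwa [Real.ball_eq_Ioo, zero_sub, zero_add] at this
  have hderiv (x : ℝ) : HasDerivAt (fun u => ∫ s in (-R)..u, f s) (f x) x :=
    (hf.continuous.integral_hasStrictDerivAt (-R) x).hasDerivAt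
  refine ⟨fun u => ∫ s in (-R)..u, f s, ⟨?_, ?_⟩, hderiv⟩
  · refine contDiff_infty_iff_deriv.2 ⟨fun x => (hderiv x).differentiableAt, ?_⟩
    rw [funext fun x => (hderiv x).deriv]
    exact hf.1
  · refine HasCompactSupport.intro (isCompact_Icc (a := -R) (b := R)) fun x hx => ?_
    rcases lt_or_ge x (-R) with hxR | hxR
    · refine intervalIntegral.integral_zero_ae (Eventually.of_forall fun s hs => ?_)
      rw [uIoc_of_ge hxR.le] at hs
      by_contra hne
      exact (hsupp hne).1.not_ge hs.2
    · have hxR' : R < x := not_le.1 fun h => hx ⟨hxR, h⟩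
      change ∫ s in (-R)..x, f s = 0
      rw [intervalIntegral.integral_eq_integral_of_support_subset, h]
      exact hsupp.trans fun s hs => ⟨hs.1, hs.2.le.trans hxR'.le⟩

theorem contDiff_cexp_mul (c : ℂ) : ContDiff ℝ (⊤ : ℕ∞) fun x : ℝ => Complex.exp (c * x) := by
  have : ContDiff ℝ (⊤ : ℕ∞) fun x : ℝ => (x : ℂ) := Complex.ofRealCLM.contDiff
  fun_prop

theorem exists_deriv_sub_smul_eq (hf : IsRTest f) (c : ℂ)
    (h : ∫ x : ℝ, Complex.exp (-c * x) * f x = 0) :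
    ∃ F, IsRTest F ∧ ∀ x, _root_.deriv F x - c * F x = f x := by
  obtain ⟨G, hG, hG'⟩ := (hf.smooth_mul (contDiff_cexp_mul (-c))).exists_hasDerivAt h
  refine ⟨_, hG.smooth_mul (contDiff_cexp_mul c), fun x => ?_⟩
  have hexp : HasDerivAt (fun x : ℝ => Complex.exp (c * x)) (Complex.exp (c * x) * c) x := by
    have h1 : HasDerivAt (fun z : ℂ => Complex.exp (c * z)) (Complex.exp (c * x) * c) (x : ℂ) := by
      simpa using ((hasDerivAt_id (x : ℂ)).const_mul c).cexp
    exact h1.comp_ofReal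
  have hcancel : Complex.exp (c * x) * Complex.exp (-c * x) = 1 := by
    rw [← Complex.exp_add]; simp
  rw [(hexp.mul (hG' x)).deriv]
  simp only [Pi.mul_apply]
  linear_combination f x * hcancel

/-- The class in `L²(ℝ)` of a test function. -/
noncomputable def toL2 (hf : IsRTest f) : Lp ℂ 2 (volume : Measure ℝ) := (hf.memLp 2).toLp f

theorem coeFn_toL2 (hf : IsRTest f) : hf.toL2 =ᵐ[volume] f := (hf.memLp 2).coeFn_toLp

theorem norm_toL2_comp_sub_right (hf : IsRTest f) (t : ℝ) :
    ‖(hf.comp_sub_right t).toL2‖ = ‖hf.toL2‖ := by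
  rw [toL2, toL2, Lp.norm_toLp, Lp.norm_toLp]
  exact congrArg _ (eLpNorm_comp_measurePreserving hf.continuous.aestronglyMeasurable
    (measurePreserving_sub_right volume t))

theorem dense_setOf_ae_eq :
    Dense {F : Lp ℂ 2 (volume : Measure ℝ) | ∃ f, IsRTest f ∧ F =ᵐ[volume] f} := by
  refine (Lp.dense_hasCompactSupport_contDiff (p := 2) (by simp)).mono ?_
  rintro F ⟨g, hF, hg, hg'⟩
  exact ⟨g, ⟨hg', hg⟩, hF⟩

theorem integral_cexp_mul_comp_sub_right (c : ℂ) (t : ℝ) :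
    ∫ x : ℝ, Complex.exp (-c * x) * f (x - t)
      = Complex.exp (-c * t) * ∫ x : ℝ, Complex.exp (-c * x) * f x := by
  rw [← integral_const_mul,
    ← integral_sub_right_eq_self (fun x : ℝ => _ * (Complex.exp (-c * x) * f x)) t]
  refine integral_congr_ae (Eventually.of_forall fun x => ?_)
  simp only
  rw [← mul_assoc, ← Complex.exp_add]
  push_cast
  ring_nf

theorem exists_integral_cexp_mul_eq_one (c : ℂ) :
    ∃ f, IsRTest f ∧ ∫ x : ℝ, Complex.exp (-c * x) * f x = 1 := by
  let b : ContDiffBump (0 : ℝ) := ⟨1, 2, by norm_num, by norm_num⟩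
  have hb : IsRTest fun x => (b.normed volume x : ℂ) :=
    ⟨Complex.ofRealCLM.contDiff.comp b.contDiff_normed,
      b.hasCompactSupport_normed.comp_left Complex.ofReal_zero⟩
  refine ⟨_, hb.smooth_mul (contDiff_cexp_mul c), ?_⟩
  have (x : ℝ) : Complex.exp (-c * x) * (Complex.exp (c * x) * (b.normed volume x : ℂ))
      = (b.normed volume x : ℂ) := by
    rw [← mul_assoc, ← Complex.exp_add]; simp
  simp only [Pi.mul_apply, this]
  rw [integral_complex_ofReal, b.integral_normed, Complex.ofReal_one]

/-- The range of `d/dx - c` on test functions has trivial orthogonal complement in `L²(ℝ)`. -/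
theorem eq_zero_of_inner_deriv_sub_smul_eq_zero {c : ℝ} (hc : c ≠ 0)
    (h : Lp ℂ 2 (volume : Measure ℝ))
    (horth : ∀ {F : ℝ → ℂ} (hF : IsRTest F), ⟪h, hF.deriv.toL2 - (c : ℂ) • hF.toL2⟫_ℂ = 0) :
    h = 0 := by
  have horth' {f : ℝ → ℂ} (hf : IsRTest f) (h0 : ∫ x : ℝ, Complex.exp (-c * x) * f x = 0) :
      ⟪h, hf.toL2⟫_ℂ = 0 := by
    obtain ⟨F, hF, hF'⟩ := hf.exists_deriv_sub_smul_eq c h0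
    rw [← horth hF]
    congr 1
    simp only [toL2]
    rw [← MemLp.toLp_const_smul, ← MemLp.toLp_sub]
    exact MemLp.toLp_congr _ _ (Eventually.of_forall fun x => (hF' x).symm)
  obtain ⟨θ, hθ, hθ1⟩ := exists_integral_cexp_mul_eq_one c
  refine dense_setOf_ae_eq.eq_zero_of_inner_left ℂ ?_
  rintro G ⟨g, hg, hG⟩
  obtain rfl : G = hg.toL2 := Lp.ext (hG.trans hg.coeFn_toL2.symm)
  set K := ∫ x : ℝ, Complex.exp (-c * x) * g x with hK
  have hintegrable {f : ℝ → ℂ} (hf : IsRTest f) :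
      Integrable fun x : ℝ => Complex.exp (-(c : ℂ) * x) * f x :=
    (hf.smooth_mul (contDiff_cexp_mul (-c))).integrable
  have hshift (t : ℝ) : ⟪h, hg.toL2⟫_ℂ
      = K * Complex.exp (c * t) * ⟪h, (hθ.comp_sub_right t).toL2⟫_ℂ := by
    have hθt := (hθ.comp_sub_right t).const_smul (K * Complex.exp (c * t))
    have h0 : ⟪h, (hg.sub hθt).toL2⟫_ℂ = 0 := by
      refine horth' _ ?_
      have (x : ℝ) : Complex.exp (-c * x)
          * (g - (K * Complex.exp (c * t)) • fun x => θ (x - t)) x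
          = Complex.exp (-c * x) * g x
            - K * Complex.exp (c * t) * (Complex.exp (-c * x) * θ (x - t)) := by
        simp only [Pi.sub_apply, Pi.smul_apply, smul_eq_mul]; ring
      simp only [this]
      rw [integral_sub (hintegrable hg) ((hintegrable (hθ.comp_sub_right t)).const_mul _),
        integral_const_mul,
        integral_cexp_mul_comp_sub_right, hθ1, ← hK, mul_one, mul_assoc, ← Complex.exp_add]
      simp
    have hsub : (hg.sub hθt).toL2
        = hg.toL2 - (K * Complex.exp (c * t)) • (hθ.comp_sub_right t).toL2 := by
      simp only [toL2]
      rw [← MemLp.toLp_const_smul, ← MemLp.toLp_sub]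
    rw [hsub, inner_sub_right, inner_smul_right] at h0
    exact sub_eq_zero.1 h0
  have hbound (s : ℝ) : ‖⟪h, hg.toL2⟫_ℂ‖ ≤ ‖K‖ * Real.exp s * (‖h‖ * ‖hθ.toL2‖) := by
    rw [hshift (s / c), norm_mul, norm_mul, Complex.norm_exp]
    have : ((c : ℂ) * ((s / c : ℝ) : ℂ)).re = s := by
      rw [← Complex.ofReal_mul, Complex.ofReal_re, mul_div_cancel₀ _ hc]
    rw [this, ← hθ.norm_toL2_comp_sub_right (s / c)]
    gcongr
    exact norm_inner_le_norm _ _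
  have hlim : Tendsto (fun s => ‖K‖ * Real.exp s * (‖h‖ * ‖hθ.toL2‖)) atBot (𝓝 0) := by
    simpa using (Real.tendsto_exp_atBot.const_mul ‖K‖).mul_const (‖h‖ * ‖hθ.toL2‖)
  exact norm_le_zero_iff.1 (ge_of_tendsto' hlim hbound)

theorem inner_deriv_add_inner_deriv (hf : IsRTest f) (hg : IsRTest g) :
    ⟪hf.deriv.toL2, hg.toL2⟫_ℂ + ⟪hf.toL2, hg.deriv.toL2⟫_ℂ = 0 := by
  have hinner {u v : ℝ → ℂ} (hu : IsRTest u) (hv : IsRTest v) :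
      ⟪hu.toL2, hv.toL2⟫_ℂ = ∫ x, star (u x) * v x := by
    rw [L2.inner_def]
    refine integral_congr_ae ?_
    filter_upwards [hu.coeFn_toL2, hv.coeFn_toL2] with x hx hx'
    rw [hx, hx', RCLike.inner_apply']
    rfl
  have hintegrable {u v : ℝ → ℂ} (hu : IsRTest u) (hv : IsRTest v) :
      Integrable ((fun x => star (u x)) * v) :=
    (hu.continuous.star.mul hv.continuous).integrable_of_hasCompactSupport hv.2.mul_left
  rw [hinner, hinner, integral_mul_deriv_eq_deriv_mul_of_integrable
    (fun x _ => (hf.hasDerivAt x).star) (fun x _ => hg.hasDerivAt x) (hintegrable hf hg.deriv)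
    (hintegrable hf.deriv hg) (hintegrable hf hg), add_neg_cancel]

theorem norm_comp_sub_sub_add_le {K : NNReal} (hf : IsRTest f)
    (hK : LipschitzWith K (_root_.deriv f)) (x t : ℝ) :
    ‖f (x - t) - f x + t * _root_.deriv f x‖ ≤ K * t ^ 2 := by
  have hd (s : ℝ) : HasDerivAt (fun s : ℝ => f (x - s) + s * _root_.deriv f x)
      (-_root_.deriv f (x - s) + _root_.deriv f x) s := by
    have h1 := (hf.hasDerivAt (x - s)).scomp s ((hasDerivAt_id s).const_sub x)
    have h2 := ((hasDerivAt_id s).ofReal_comp).mul_const (_root_.deriv f x)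
    simpa using! h1.add h2
  have := (convex_uIcc (0 : ℝ) t).norm_image_sub_le_of_norm_hasDerivWithin_le (C := K * |t|)
    (fun s _ => (hd s).hasDerivWithinAt) (fun s hs => ?_) left_mem_uIcc right_mem_uIcc
  · calc _ = ‖f (x - t) + t * _root_.deriv f x
            - (f (x - 0) + (0 : ℝ) * _root_.deriv f x)‖ := by
          congr 1; simp; ring
      _ ≤ _ := this
      _ = K * t ^ 2 := by rw [sub_zero, Real.norm_eq_abs, mul_assoc, abs_mul_abs_self, sq]
  · rw [neg_add_eq_sub, ← dist_eq_norm]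
    refine (hK.dist_le_mul _ _).trans ?_
    gcongr
    rw [Real.dist_eq, sub_sub_cancel]
    simpa using abs_sub_left_of_mem_uIcc hs

theorem hasDerivAt_translation (hf : IsRTest f) {V : ℝ → Lp ℂ 2 (volume : Measure ℝ)}
    {G : Lp ℂ 2 (volume : Measure ℝ)} (hV : ∀ t : ℝ, V t =ᵐ[volume] fun x => f (x - t))
    (hG : G =ᵐ[volume] fun x => -_root_.deriv f x) : HasDerivAt V G 0 := by
  obtain ⟨K, hK⟩ := hf.deriv.1.lipschitzWith_of_hasCompactSupport hf.deriv.2 (by simp)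
  obtain ⟨R, hR⟩ := hf.2.isCompact.isBounded.subset_closedBall 0
  have hzero {x : ℝ} (hx : R < |x|) : f x = 0 ∧ _root_.deriv f x = 0 := by
    have hx' : x ∉ tsupport f := fun h => hx.not_ge (by simpa using hR h)
    exact ⟨image_eq_zero_of_notMem_tsupport hx',
      image_eq_zero_of_notMem_tsupport fun h => hx' (tsupport_deriv_subset h)⟩
  let B : Lp ℝ 2 (volume : Measure ℝ) :=
    indicatorConstLp 2 (measurableSet_Icc (a := -(R + 1)) (b := R + 1)) (by simp) 1
  have hB : B =ᵐ[volume] (Icc (-(R + 1)) (R + 1)).indicator fun _ => (1 : ℝ) :=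
    indicatorConstLp_coeFn
  rw [hasDerivAt_iff_isLittleO]
  have hO : (fun t => V t - V 0 - (t - 0) • G) =O[𝓝 0] fun t => t ^ 2 := by
    refine Asymptotics.IsBigO.of_bound (K * ‖B‖) ?_
    filter_upwards [Metric.ball_mem_nhds (0 : ℝ) one_pos] with t ht
    rw [mem_ball_zero_iff, Real.norm_eq_abs] at ht
    rw [mul_right_comm]
    refine Lp.norm_le_mul_norm_of_ae_le_mul ?_
    filter_upwards [Lp.coeFn_sub (V t - V 0) ((t - 0) • G), Lp.coeFn_sub (V t) (V 0),
      Lp.coeFn_smul (t - 0) G, hV t, hV 0, hG, hB] with x h1 h2 h3 h4 h5 h6 h7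
    rw [h1, Pi.sub_apply, h2, Pi.sub_apply, h3, Pi.smul_apply, h4, h5, h6, h7]
    have heq : f (x - t) - f (x - 0) - (t - 0) • -_root_.deriv f x
        = f (x - t) - f x + t * _root_.deriv f x := by
      simp
    rw [heq]
    by_cases hx : x ∈ Icc (-(R + 1)) (R + 1)
    · rw [indicator_of_mem hx]
      simpa using hf.norm_comp_sub_sub_add_le hK x t
    · have hx1 : R + 1 < |x| := not_le.1 fun h => hx (abs_le.1 h)
      have hx2 : R < |x - t| := by linarith [abs_sub_abs_le_abs_sub x t]
      rw [(hzero hx2).1, (hzero (by linarith)).1, (hzero (by linarith)).2,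
        indicator_of_notMem hx]
      simp
  simpa using hO.trans_isLittleO (Asymptotics.isLittleO_pow_id one_lt_two)

end IsRTest

/-- `H = d/dx` with domain `C_c^∞(ℝ)` in `L²(ℝ)` is essentially
skew-adjoint (`T.adjoint = -T.closure`), and its closure generates the translation
group: for `f ∈ C_c^∞(ℝ)`, `t ↦ f(· − t)` (as a curve in `L²(ℝ)`) is differentiable at
`0` with derivative `−f′`. -/
theorem stmt17 (T : Lp ℂ 2 (volume : Measure ℝ) →ₗ.[ℂ] Lp ℂ 2 (volume : Measure ℝ))
    (hdom : ∀ F : Lp ℂ 2 (volume : Measure ℝ),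
      F ∈ T.domain ↔ ∃ f, IsRTest f ∧ ⇑F =ᵐ[(volume : Measure ℝ)] f)
    (hact : ∀ (w : T.domain) (f : ℝ → ℂ), IsRTest f →
      ⇑(w : Lp ℂ 2 (volume : Measure ℝ)) =ᵐ[(volume : Measure ℝ)] f →
      ⇑(T w) =ᵐ[(volume : Measure ℝ)] deriv f) :
    T.adjoint = -T.closure ∧
    (∀ f : ℝ → ℂ, IsRTest f →
      ∀ V : ℝ → Lp ℂ 2 (volume : Measure ℝ), ∀ G : Lp ℂ 2 (volume : Measure ℝ),
        (∀ t : ℝ, ⇑(V t) =ᵐ[(volume : Measure ℝ)] fun x => f (x - t)) →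
        ⇑G =ᵐ[(volume : Measure ℝ)] (fun x => -deriv f x) →
        HasDerivAt V G 0) := by
  have hT : Dense (T.domain : Set (Lp ℂ 2 (volume : Measure ℝ))) :=
    IsRTest.dense_setOf_ae_eq.mono fun F hF => (hdom F).2 hF
  have hmem {f : ℝ → ℂ} (hf : IsRTest f) : hf.toL2 ∈ T.domain := (hdom _).2 ⟨f, hf, hf.coeFn_toL2⟩
  have happly {f : ℝ → ℂ} (hf : IsRTest f) : T ⟨hf.toL2, hmem hf⟩ = hf.deriv.toL2 :=
    Lp.ext ((hact _ f hf hf.coeFn_toL2).trans hf.deriv.coeFn_toL2.symm)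
  have hrep (v : T.domain) : ∃ (f : ℝ → ℂ) (hf : IsRTest f), v = ⟨hf.toL2, hmem hf⟩ := by
    obtain ⟨f, hf, hvf⟩ := (hdom v).1 v.2
    exact ⟨f, hf, Subtype.ext (Lp.ext (hvf.trans hf.coeFn_toL2.symm))⟩
  refine ⟨LinearPMap.adjoint_eq_neg_closure hT ?_ ?_ ?_,
    fun f hf V G hV hG => hf.hasDerivAt_translation hV hG⟩
  · intro v w
    obtain ⟨f, hf, rfl⟩ := hrep v
    obtain ⟨g, hg, rfl⟩ := hrep w
    rw [happly, happly]
    exact hf.inner_deriv_add_inner_deriv hg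
  · refine fun z hz => IsRTest.eq_zero_of_inner_deriv_sub_smul_eq_zero (c := -1) (by simp) z
      fun hF => ?_
    simpa [happly] using hz ⟨_, hmem hF⟩
  · refine fun z hz => IsRTest.eq_zero_of_inner_deriv_sub_smul_eq_zero (c := 1) (by simp) z
      fun hF => ?_
    simpa [happly] using hz ⟨_, hmem hF⟩
end
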